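/- arXiv:1412.0609 — 2 statements merged into one kernel-verified Lean document; each statement's English description precedes it below -/
import Mathlib

section
/- Let f and g be continuous, positive, non-increasing functions on [0,∞), let a > 0, r ∈ ℕ, n ∈ ℤ₊. If G and H both belong to Γ^r_{n,g}[0,a] and each has n+r+1 oscillation points, i.e., each satisfies: there exist points 0 ≤ t_1 < ⋯ < t_{n+r+1} = a with value at t_i equal to (−1)^{i+r+1} times its weighted norm ‖·‖_{C[0,a],f} times f(t_i), then G = H. -/
open Set Filter MeasureTheory
open scoped Topology

noncomputable section

/-- Weighted sup-norm `‖x‖_{C(S),w} = sup_{t ∈ S} |x t| / w t`. -/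
def wNorm (x w : ℝ → ℝ) (S : Set ℝ) : ℝ :=
  sSup ((fun t => |x t| / w t) '' S)

/-- Sup-norm `‖x‖_{C(S)} = sup_{t ∈ S} |x t|`. -/
def supNorm (x : ℝ → ℝ) (S : Set ℝ) : ℝ :=
  sSup ((fun t => |x t|) '' S)

/-- `G` is a perfect `g`-spline of order `r` on `[0,a]` with exactly `m` knots
`u 1 < ⋯ < u m` (where `u 0 = 0` and `u (m+1) = a`) and sign `ε ∈ {1,-1}`:
`G ∈ C^{r-1}[0,a]`, and on each open interval between consecutive knots `G` is
`r` times differentiable with `G^{(r)}(t) = ε·(-1)^i·g(t)` there. -/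
def PerfectSplineWith (g : ℝ → ℝ) (r : ℕ) (a : ℝ) (m : ℕ) (u : ℕ → ℝ) (ε : ℝ)
    (G : ℝ → ℝ) : Prop :=
  (ε = 1 ∨ ε = -1) ∧ u 0 = 0 ∧ u (m + 1) = a ∧ (∀ i ≤ m, u i < u (i + 1)) ∧
  ContDiffOn ℝ (r - 1 : ℕ) G (Icc 0 a) ∧
  ∀ i ≤ m, ContDiffOn ℝ (r : ℕ) G (Ioo (u i) (u (i + 1))) ∧
    ∀ s ∈ Ioo (u i) (u (i + 1)),
      iteratedDerivWithin r G (Ioo (u i) (u (i + 1))) s = ε * (-1 : ℝ) ^ i * g s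

/-- `Γ^r_{n,g}[0,a]`: perfect `g`-splines of order `r` on `[0,a]` with at most `n` knots. -/
def InGamma (g : ℝ → ℝ) (r n : ℕ) (a : ℝ) (G : ℝ → ℝ) : Prop :=
  ∃ m ≤ n, ∃ u : ℕ → ℝ, ∃ ε : ℝ, PerfectSplineWith g r a m u ε G

/-- `b 1 < ⋯ < b (n+r+1)` are `n+r+1` oscillation points of `G` on `[0,a]`
with respect to the weight `f`, as in (5). -/
def OscPointsAt (f : ℝ → ℝ) (r n : ℕ) (a : ℝ) (G : ℝ → ℝ) (b : ℕ → ℝ) : Prop :=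
  0 ≤ b 1 ∧ b (n + r + 1) = a ∧ (∀ i, 1 ≤ i → i < n + r + 1 → b i < b (i + 1)) ∧
  ∀ i, 1 ≤ i → i ≤ n + r + 1 →
    G (b i) = (-1 : ℝ) ^ (i + r + 1) * (wNorm G f (Icc 0 a) * f (b i))

/-- `G` has `n+r+1` oscillation points on `[0,a]`. -/
def HasOsc (f : ℝ → ℝ) (r n : ℕ) (a : ℝ) (G : ℝ → ℝ) : Prop :=
  ∃ b : ℕ → ℝ, OscPointsAt f r n a G b

/-- `G` is the extremal spline `G_{r,n,f,a}`: a member of `Γ^r_{n,g}[0,a]`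
with `n+r+1` oscillation points. -/
def IsExtremalSpline (f g : ℝ → ℝ) (r n : ℕ) (a : ℝ) (G : ℝ → ℝ) : Prop :=
  InGamma g r n a G ∧ HasOsc f r n a G

/-- Iterated antiderivatives: `g_0 = g`, `g_{k+1}(t) = ∫_0^t g_k`. -/
def gk (g : ℝ → ℝ) : ℕ → ℝ → ℝ
  | 0 => g
  | k + 1 => fun t => ∫ s in (0:ℝ)..t, gk g k s

/-- The constants `A_k` of the paper:
`A_0 = ∫_0^∞ g`, and
`A_k = ∫_0^∞ [ Σ_{s=0}^{k-1} (-1)^{k-s-1} A_s t^{k-s-1}/(k-s-1)! + (-1)^k g_k(t) ] dt`. -/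
def Acoef (g : ℝ → ℝ) : ℕ → ℝ
  | 0 => ∫ t in Ioi (0 : ℝ), g t
  | k + 1 => ∫ t in Ioi (0 : ℝ),
      ((∑ s : Fin (k + 1), (-1 : ℝ) ^ (k - s.1) * Acoef g s.1 * t ^ (k - s.1) /
        (Nat.factorial (k - s.1) : ℝ)) + (-1 : ℝ) ^ (k + 1) * gk g (k + 1) t)

/-- `P_k(t) = Σ_{s=0}^{k-1} (-1)^{k-s-1} A_s t^{k-s-1}/(k-s-1)! + (-1)^k g_k(t)`. -/
def Pfun (g : ℝ → ℝ) (k : ℕ) (t : ℝ) : ℝ :=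
  (∑ s : Fin k, (-1 : ℝ) ^ (k - 1 - s.1) * Acoef g s.1 * t ^ (k - 1 - s.1) /
    (Nat.factorial (k - 1 - s.1) : ℝ)) + (-1 : ℝ) ^ k * gk g k t

/-- Conditions (6): `A_0 < ∞` and `A_k < ∞` for `k = 1, …, r-1`,
expressed as integrability of the corresponding integrands over `(0,∞)`. -/
def Cond6 (g : ℝ → ℝ) (r : ℕ) : Prop :=
  IntegrableOn g (Ioi 0) ∧ ∀ k, 1 ≤ k → k ≤ r - 1 → IntegrableOn (Pfun g k) (Ioi 0)

/-- Membership in the class `W^r_{f,g}(ℝ₊)`: `x ∈ C[0,∞)` with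
`‖x‖_{C[0,∞),f} < ∞`, `x ∈ C^{r-1}[0,∞)`, `x^{(r-1)}` locally absolutely
continuous with `|x^{(r)}| ≤ g` a.e., the latter encoded by the increment bound
`|x^{(r-1)}(t) - x^{(r-1)}(s)| ≤ ∫_s^t g`. -/
def MemW (f g : ℝ → ℝ) (r : ℕ) (x : ℝ → ℝ) : Prop :=
  ContinuousOn x (Ici 0) ∧
  ContDiffOn ℝ (r - 1 : ℕ) x (Ici 0) ∧
  BddAbove ((fun t => |x t| / f t) '' Ici 0) ∧
  ∀ s t : ℝ, 0 ≤ s → s ≤ t →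
    |iteratedDerivWithin (r - 1) x (Ici 0) t - iteratedDerivWithin (r - 1) x (Ici 0) s| ≤
      ∫ u in s..t, g u

/-- The modulus of continuity `ω(D^k, δ)` of the `k`-th differentiation operator on
`W^r_{f,g}(ℝ₊)`. -/
def omegaD (f g : ℝ → ℝ) (r k : ℕ) (δ : ℝ) : ℝ :=
  sSup {y | ∃ x : ℝ → ℝ, MemW f g r x ∧ wNorm x f (Ici 0) ≤ δ ∧
    y = supNorm (iteratedDerivWithin k x (Ici 0)) (Ici 0)}

/-- A perfect `g`-spline of order `r` on `[0,∞)` with exactly `n` knots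
`u 1 < ⋯ < u n` (and `u 0 = 0`), sign `ε`. -/
def PerfectSplineInf (g : ℝ → ℝ) (r n : ℕ) (u : ℕ → ℝ) (ε : ℝ) (Q : ℝ → ℝ) : Prop :=
  (ε = 1 ∨ ε = -1) ∧ u 0 = 0 ∧ (∀ i < n, u i < u (i + 1)) ∧
  ContDiffOn ℝ (r - 1 : ℕ) Q (Ici 0) ∧
  (∀ i < n, ContDiffOn ℝ (r : ℕ) Q (Ioo (u i) (u (i + 1))) ∧
    ∀ s ∈ Ioo (u i) (u (i + 1)),
      iteratedDerivWithin r Q (Ioo (u i) (u (i + 1))) s = ε * (-1 : ℝ) ^ i * g s) ∧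
  ContDiffOn ℝ (r : ℕ) Q (Ioi (u n)) ∧
  ∀ s ∈ Ioi (u n), iteratedDerivWithin r Q (Ioi (u n)) s = ε * (-1 : ℝ) ^ n * g s

end


/-- strict alternation -/
def SAlt (F : ℝ → ℝ) (lo hi s : ℝ) (m : ℕ) : Prop :=
  ∃ x : ℕ → ℝ, (∀ i < m, lo ≤ x i ∧ x i < hi) ∧ (∀ i, i + 1 < m → x i < x (i + 1)) ∧
    ∀ i < m, 0 < s * (-1 : ℝ) ^ i * F (x i)

lemma rd_anti {F F' : ℝ → ℝ} {x y : ℝ} (hc : ContinuousOn F (Icc x y))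
    (hd : ∀ z ∈ Ico x y, HasDerivWithinAt F (F' z) (Ici z) z)
    (hn : ∀ z ∈ Ico x y, F' z ≤ 0) {v w : ℝ} (hv : x ≤ v) (hvw : v ≤ w) (hw : w ≤ y) :
    F w ≤ F v := by
  have := @image_le_of_deriv_right_le_deriv_boundary F F' v w
    (hc.mono (Icc_subset_Icc hv hw))
    (fun z hz => hd z ⟨hv.trans hz.1, hz.2.trans_le hw⟩) (fun _ => F v) (fun _ => 0) le_rfl
    continuousOn_const (fun z _ => hasDerivWithinAt_const _ _ _)
    (fun z hz => hn z ⟨hv.trans hz.1, hz.2.trans_le hw⟩)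
  exact this ⟨hvw, le_rfl⟩

lemma W1 {F F' : ℝ → ℝ} {x y s : ℝ} (hs : s ≠ 0) (hc : ContinuousOn F (Icc x y))
    (hd : ∀ z ∈ Ico x y, HasDerivWithinAt F (F' z) (Ici z) z)
    (hx : s * F x ≤ 0) (hy : 0 ≤ s * F y) (hz : ∃ z ∈ Icc x y, F z ≠ 0) :
    ∃ ξ ∈ Ico x y, 0 < s * F' ξ := by
  by_contra hcon
  push Not at hcon
  obtain ⟨z, hz, hz0⟩ := hz
  have key := @rd_anti (fun t => s * F t) (fun t => s * F' t) x y (continuousOn_const.mul hc)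
    (fun z hz => (hd z hz).const_mul s) hcon
  have h1 := key le_rfl hz.1 hz.2
  have h2 := key hz.1 hz.2 le_rfl
  have : s * F z = 0 := by linarith
  rcases mul_eq_zero.1 this with h | h
  · exact hs h
  · exact hz0 h

lemma W {F F' : ℝ → ℝ} {lo hi s : ℝ} (hs : s ≠ 0) (hc : ContinuousOn F (Icc lo hi))
    (hd : ∀ z ∈ Ico lo hi, HasDerivWithinAt F (F' z) (Ici z) z) (m : ℕ) (y : ℕ → ℝ)
    (hy : ∀ i ≤ m, lo ≤ y i ∧ y i ≤ hi) (hm : ∀ i < m, y i < y (i + 1))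
    (hsg : ∀ i ≤ m, 0 ≤ s * (-1 : ℝ) ^ i * F (y i))
    (hnz : ∀ i < m, ∃ z ∈ Icc (y i) (y (i + 1)), F z ≠ 0) : SAlt F' lo hi (-s) m := by
  have H : ∀ i, i < m → ∃ ξ ∈ Ico (y i) (y (i + 1)), 0 < (-s * (-1) ^ i) * F' ξ := by
    intro i hi'
    have h1 := hy i hi'.le
    have h2 := hy (i + 1) hi'
    refine W1 ?_ (hc.mono (Icc_subset_Icc h1.1 h2.2))
      (fun z hz => hd z ⟨h1.1.trans hz.1, hz.2.trans_le h2.2⟩) ?_ ?_ (hnz i hi')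
    · simp [hs]
    · have := hsg i hi'.le; linarith
    · have := hsg (i + 1) hi'; rw [pow_succ] at this; linarith
  choose! ξ hξ hp using H
  refine ⟨ξ, fun i hi' => ⟨(hy i hi'.le).1.trans (hξ i hi').1,
    (hξ i hi').2.trans_le (hy (i + 1) hi').2⟩, fun i hi' => ?_, hp⟩
  exact (hξ i (by omega)).2.trans_le (hξ (i + 1) hi').1

lemma SAlt.none {F F' : ℝ → ℝ} {lo hi s : ℝ} {m : ℕ} (hs : s ≠ 0)
    (hc : ContinuousOn F (Icc lo hi))
    (hd : ∀ z ∈ Ico lo hi, HasDerivWithinAt F (F' z) (Ici z) z)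
    (h : SAlt F lo hi s (m + 1)) : SAlt F' lo hi (-s) m := by
  obtain ⟨x, h1, h2, h3⟩ := h
  refine W hs hc hd m x (fun i hi' => ⟨(h1 i (by omega)).1, (h1 i (by omega)).2.le⟩)
    (fun i hi' => h2 i (by omega)) (fun i hi' => (h3 i (by omega)).le) ?_
  intro i hi'
  refine ⟨x i, ⟨le_rfl, (h2 i (by omega)).le⟩, fun h0 => ?_⟩
  have := h3 i (by omega)
  rw [h0] at this; simp at this

lemma SAlt.right {F F' : ℝ → ℝ} {lo hi s : ℝ} {m : ℕ} (hs : s ≠ 0)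
    (hc : ContinuousOn F (Icc lo hi))
    (hd : ∀ z ∈ Ico lo hi, HasDerivWithinAt F (F' z) (Ici z) z) (h0 : F hi = 0) (hl : lo ≤ hi)
    (h : SAlt F lo hi s m) : SAlt F' lo hi (-s) m := by
  obtain ⟨x, h1, h2, h3⟩ := h
  refine W hs hc hd m (fun i => if i < m then x i else hi) ?_ ?_ ?_ ?_
  · intro i hi'
    try dsimp only
    split_ifs with h
    · exact ⟨(h1 i h).1, (h1 i h).2.le⟩
    · exact ⟨hl, le_rfl⟩
  · intro i hi'
    try dsimp only
    rw [if_pos hi']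
    split_ifs with h
    · exact h2 i h
    · exact (h1 i hi').2
  · intro i hi'
    try dsimp only
    split_ifs with h
    · exact (h3 i h).le
    · simp [h0]
  · intro i hi'
    refine ⟨x i, ?_, fun h0 => ?_⟩
    · try dsimp only
      rw [if_pos hi']
      refine ⟨le_rfl, ?_⟩
      split_ifs with h
      · exact (h2 i h).le
      · exact (h1 i hi').2.le
    · have := h3 i hi'
      rw [h0] at this; simp at this

lemma SAlt.cons {F : ℝ → ℝ} {lo hi s : ℝ} {m : ℕ} (x : ℕ → ℝ)
    (h1 : ∀ i < m, lo ≤ x i ∧ x i < hi) (h2 : ∀ i, i + 1 < m → x i < x (i + 1))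
    (h3 : ∀ i < m, 0 < s * (-1 : ℝ) ^ i * F (x i)) (y : ℝ) (hy : lo ≤ y) (hyh : y < hi)
    (hm : 0 < m → y < x 0) (hF : 0 < -s * F y) : SAlt F lo hi (-s) (m + 1) := by
  refine ⟨fun i => Nat.casesOn i y x, ?_, ?_, ?_⟩
  · rintro (_ | i) hi'
    · exact ⟨hy, hyh⟩
    · exact h1 i (by omega)
  · rintro (_ | i) hi'
    · exact hm (by omega)
    · exact h2 i (by omega)
  · rintro (_ | i) hi'
    · simpa using hF
    · have := h3 i (by omega)
      simp only [pow_succ]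
      linarith

lemma SAlt.left {F F' : ℝ → ℝ} {lo hi s : ℝ} {m : ℕ} (hs : s ≠ 0)
    (hc : ContinuousOn F (Icc lo hi))
    (hd : ∀ z ∈ Ico lo hi, HasDerivWithinAt F (F' z) (Ici z) z) (h0 : F lo = 0)
    (h : SAlt F lo hi s m) : SAlt F' lo hi s m := by
  obtain ⟨x, h1, h2, h3⟩ := h
  have hlo : ∀ i < m, lo < x i := by
    intro i hi'
    refine lt_of_le_of_ne (h1 i hi').1 fun h => ?_
    have := h3 i hi'
    rw [← h, h0] at this; simp at this
  rcases Nat.eq_zero_or_pos m with rfl | hm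
  · exact ⟨x, by simp, by simp, by simp⟩
  have hlh : lo ≤ hi := (h1 0 hm).1.trans (h1 0 hm).2.le
  have := @W F F' lo hi (-s) (by simpa using hs) hc hd m (fun i => Nat.casesOn i lo x) ?_ ?_ ?_ ?_
  · simpa using this
  · rintro (_ | i) hi'
    · exact ⟨le_rfl, hlh⟩
    · exact ⟨(h1 i (by omega)).1, (h1 i (by omega)).2.le⟩
  · rintro (_ | i) hi'
    · exact hlo 0 hm
    · exact h2 i (by omega)
  · rintro (_ | i) hi'
    · simp [h0]
    · have := h3 i (by omega)
      simp only [pow_succ]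
      linarith
  · intro i hi'
    refine ⟨x i, ?_, fun h0 => ?_⟩
    · refine ⟨?_, le_rfl⟩
      rcases i with _ | i
      · exact (hlo 0 hm).le
      · exact (h2 i hi').le
    · have := h3 i hi'
      rw [h0] at this; simp at this

lemma SAlt.both {F F' : ℝ → ℝ} {lo hi s : ℝ} {m : ℕ} (hm : 0 < m) (hs : s ≠ 0)
    (hc : ContinuousOn F (Icc lo hi))
    (hd : ∀ z ∈ Ico lo hi, HasDerivWithinAt F (F' z) (Ici z) z) (h0 : F lo = 0) (h0' : F hi = 0)
    (h : SAlt F lo hi s m) : SAlt F' lo hi s (m + 1) := by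
  obtain ⟨x, h1, h2, h3⟩ := h
  have hlo : ∀ i < m, lo < x i := by
    intro i hi'
    refine lt_of_le_of_ne (h1 i hi').1 fun h => ?_
    have := h3 i hi'
    rw [← h, h0] at this; simp at this
  have hlh : lo ≤ hi := (h1 0 hm).1.trans (h1 0 hm).2.le
  have := @W F F' lo hi (-s) (by simpa using hs) hc hd (m + 1)
    (fun i => Nat.casesOn i lo (fun i => if i < m then x i else hi)) ?_ ?_ ?_ ?_
  · simpa using this
  · rintro (_ | i) hi'
    · exact ⟨le_rfl, hlh⟩
    · try dsimp only
      split_ifs with h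
      · exact ⟨(h1 i h).1, (h1 i h).2.le⟩
      · exact ⟨hlh, le_rfl⟩
  · rintro (_ | i) hi'
    · try dsimp only
      rw [if_pos hm]
      exact hlo 0 hm
    · try dsimp only
      rw [if_pos (by omega)]
      split_ifs with h
      · exact h2 i h
      · exact (h1 i (by omega)).2
  · rintro (_ | i) hi'
    · simp [h0]
    · try dsimp only
      split_ifs with h
      · have := h3 i h
        simp only [pow_succ]
        linarith
      · simp [h0']
  · rintro (_ | i) hi'
    · refine ⟨x 0, ?_, fun h0 => ?_⟩
      · try dsimp only
        rw [if_pos hm]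
        exact ⟨(hlo 0 hm).le, le_rfl⟩
      · have := h3 0 hm
        rw [h0] at this; simp at this
    · refine ⟨x i, ?_, fun h0 => ?_⟩
      · try dsimp only
        rw [if_pos (by omega)]
        refine ⟨le_rfl, ?_⟩
        split_ifs with h
        · exact (h2 i h).le
        · exact (h1 i (by omega)).2.le
      · have := h3 i (by omega)
        rw [h0] at this; simp at this

/-- a chain of right derivatives -/
def Ch (r : ℕ) (a : ℝ) (F : ℕ → ℝ → ℝ) : Prop :=
  ∀ j < r, ContinuousOn (F j) (Icc 0 a) ∧
    ∀ x ∈ Ico 0 a, HasDerivWithinAt (F j) (F (j + 1) x) (Ici x) x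

lemma Ch.c {r : ℕ} {a : ℝ} {F : ℕ → ℝ → ℝ} (h : Ch r a F) {j : ℕ} (hj : j < r) {lo hi : ℝ}
    (hlo : 0 ≤ lo) (hhi : hi ≤ a) : ContinuousOn (F j) (Icc lo hi) :=
  (h j hj).1.mono (Icc_subset_Icc hlo hhi)

lemma Ch.d {r : ℕ} {a : ℝ} {F : ℕ → ℝ → ℝ} (h : Ch r a F) {j : ℕ} (hj : j < r) {lo hi : ℝ}
    (hlo : 0 ≤ lo) (hhi : hi ≤ a) :
    ∀ z ∈ Ico lo hi, HasDerivWithinAt (F j) (F (j + 1) z) (Ici z) z :=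
  fun z hz => (h j hj).2 z ⟨hlo.trans hz.1, hz.2.trans_le hhi⟩

lemma Ch.sub {r : ℕ} {a : ℝ} {F K : ℕ → ℝ → ℝ} (h : Ch r a F) (h' : Ch r a K) :
    Ch r a (fun j x => F j x - K j x) := fun j hj =>
  ⟨(h j hj).1.sub (h' j hj).1, fun x hx => ((h j hj).2 x hx).sub ((h' j hj).2 x hx)⟩

lemma neg_pow_ne {s : ℝ} (hs : s ≠ 0) (k : ℕ) : (-1 : ℝ) ^ k * s ≠ 0 :=
  mul_ne_zero (pow_ne_zero _ (by norm_num)) hs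

lemma it_none {r : ℕ} {a : ℝ} {F : ℕ → ℝ → ℝ} (h : Ch r a F) {lo hi s : ℝ} (hs : s ≠ 0)
    (hlo : 0 ≤ lo) (hhi : hi ≤ a) (j m k : ℕ) (hk : j + k ≤ r)
    (H : SAlt (F j) lo hi s (m + k)) : SAlt (F (j + k)) lo hi ((-1) ^ k * s) m := by
  induction k generalizing m with
  | zero => simpa using H
  | succ k ih =>
    have := ih (m + 1) (by omega) (by convert H using 1; omega)
    have := this.none (neg_pow_ne hs k) (h.c (by omega) hlo hhi) (h.d (by omega) hlo hhi)
    have e : (-1 : ℝ) ^ (k + 1) * s = -((-1) ^ k * s) := by rw [pow_succ]; ring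
    rw [e]
    exact this

lemma it_right {r : ℕ} {a : ℝ} {F : ℕ → ℝ → ℝ} (h : Ch r a F) {lo hi s : ℝ} (hs : s ≠ 0)
    (hlo : 0 ≤ lo) (hhi : hi ≤ a) (hl : lo ≤ hi) (h0 : ∀ j < r, F j hi = 0)
    (j m k : ℕ) (hk : j + k ≤ r)
    (H : SAlt (F j) lo hi s m) : SAlt (F (j + k)) lo hi ((-1) ^ k * s) m := by
  induction k generalizing m with
  | zero => simpa using H
  | succ k ih =>
    have := ih m (by omega) H
    have := this.right (neg_pow_ne hs k) (h.c (by omega) hlo hhi) (h.d (by omega) hlo hhi)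
      (h0 _ (by omega)) hl
    have e : (-1 : ℝ) ^ (k + 1) * s = -((-1) ^ k * s) := by rw [pow_succ]; ring
    rw [e]
    exact this

lemma it_left {r : ℕ} {a : ℝ} {F : ℕ → ℝ → ℝ} (h : Ch r a F) {lo hi s : ℝ} (hs : s ≠ 0)
    (hlo : 0 ≤ lo) (hhi : hi ≤ a) (h0 : ∀ j < r, F j lo = 0)
    (j m k : ℕ) (hk : j + k ≤ r)
    (H : SAlt (F j) lo hi s m) : SAlt (F (j + k)) lo hi s m := by
  induction k generalizing m with
  | zero => simpa using H
  | succ k ih =>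
    have := ih m (by omega) H
    have hjk : j + k < r := by omega
    exact this.left hs (h.c hjk hlo hhi) (h.d hjk hlo hhi) (h0 _ hjk)

lemma it_both {r : ℕ} {a : ℝ} {F : ℕ → ℝ → ℝ} (h : Ch r a F) {lo hi s : ℝ} (hs : s ≠ 0)
    (hlo : 0 ≤ lo) (hhi : hi ≤ a) (h0 : ∀ j < r, F j lo = 0) (h0' : ∀ j < r, F j hi = 0)
    (j m k : ℕ) (hm : 0 < m) (hk : j + k ≤ r)
    (H : SAlt (F j) lo hi s m) : SAlt (F (j + k)) lo hi s (m + k) := by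
  induction k with
  | zero => simpa using H
  | succ k ih =>
    have := ih (by omega)
    have hjk : j + k < r := by omega
    have hmk : 0 < m + k := by omega
    exact this.both hmk hs (h.c hjk hlo hhi) (h.d hjk hlo hhi) (h0 _ hjk) (h0' _ hjk)

lemma SAlt.merge {F : ℝ → ℝ} {lo hi s : ℝ} {m : ℕ} (hm : 0 < m)
    (h : SAlt F lo hi s m) (h' : SAlt F lo hi (-s) m) :
    SAlt F lo hi s (m + 1) ∨ SAlt F lo hi (-s) (m + 1) := by
  obtain ⟨x, h1, h2, h3⟩ := h
  obtain ⟨y, k1, k2, k3⟩ := h'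
  have a1 := h3 0 hm
  have a2 := k3 0 hm
  simp only [pow_zero, mul_one] at a1 a2
  rcases lt_trichotomy (x 0) (y 0) with hl | hl | hl
  · left
    have := SAlt.cons y k1 k2 k3 (x 0) (h1 0 hm).1 (h1 0 hm).2 (fun _ => hl) (by simpa using a1)
    simpa using this
  · rw [hl] at a1; linarith
  · right
    exact SAlt.cons x h1 h2 h3 (y 0) (k1 0 hm).1 (k1 0 hm).2 (fun _ => hl) a2

lemma SAlt.tail {F : ℝ → ℝ} {lo hi s : ℝ} {m : ℕ}
    (h : SAlt F lo hi s (m + 1)) : SAlt F lo hi (-s) m := by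
  obtain ⟨x, h1, h2, h3⟩ := h
  refine ⟨fun i => x (i + 1), fun i hi' => h1 _ (by omega), fun i hi' => h2 _ (by omega), ?_⟩
  intro i hi'
  have := h3 (i + 1) (by omega)
  rw [pow_succ] at this
  try dsimp only
  linarith

lemma SAlt.take {F : ℝ → ℝ} {lo hi s : ℝ} {m k : ℕ} (hk : k ≤ m)
    (h : SAlt F lo hi s m) : SAlt F lo hi s k := by
  obtain ⟨x, h1, h2, h3⟩ := h
  exact ⟨x, fun i hi' => h1 _ (by omega), fun i hi' => h2 _ (by omega), fun i hi' => h3 _ (by omega)⟩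

lemma sgn_cases (k : ℕ) : (-1 : ℝ) ^ k = 1 ∨ (-1 : ℝ) ^ k = -1 := neg_one_pow_eq_or ℝ k

/-- counting: `κ` relates the sign of `φ` with the parity of `N`. -/
lemma L3 {φ : ℝ → ℝ} {N : ℝ → ℕ} {lo hi s κ : ℝ} {m P : ℕ} (hs : s = 1 ∨ s = -1)
    (hsg : ∀ x ∈ Ico lo hi, ∀ σ : ℝ, (σ = 1 ∨ σ = -1) → 0 < σ * φ x → (-1 : ℝ) ^ (N x) = κ * σ)
    (hmono : ∀ x ∈ Ico lo hi, ∀ y ∈ Ico lo hi, x ≤ y → N x ≤ N y)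
    (hP : ∀ x ∈ Ico lo hi, P ≤ N x) (h : SAlt φ lo hi s m) (hm : 0 < m) :
    ∃ x ∈ Ico lo hi, P + (m - 1) ≤ N x ∧ (κ * s = -(-1 : ℝ) ^ P → P + m ≤ N x) := by
  obtain ⟨x, h1, h2, h3⟩ := h
  have hpar : ∀ i < m, (-1 : ℝ) ^ (N (x i)) = κ * (s * (-1) ^ i) := by
    intro i hi'
    refine hsg _ (h1 i hi') _ ?_ (h3 i hi')
    rcases hs with rfl | rfl <;> rcases sgn_cases i with h | h <;> simp [h]
  have hκ : κ ≠ 0 := by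
    rintro rfl
    have := hpar 0 hm
    simp at this
  have hs0 : s ≠ 0 := by rcases hs with rfl | rfl <;> norm_num
  have key : ∀ i < m, P + i ≤ N (x i) ∧ (κ * s = -(-1 : ℝ) ^ P → P + i + 1 ≤ N (x i)) := by
    intro i
    induction i with
    | zero =>
      intro hi'
      refine ⟨hP _ (h1 0 hi'), fun hk => ?_⟩
      have := hP _ (h1 0 hi')
      rcases this.eq_or_lt with h | h
      · have h' := hpar 0 hi'
        rw [← h] at h'
        simp only [pow_zero, mul_one] at h'
        rw [hk] at h'
        rcases sgn_cases P with h | h <;> rw [h] at h' <;> norm_num at h'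
      · omega
    | succ i ih =>
      intro hi'
      have hh := ih (by omega)
      have hle := hmono _ (h1 i (by omega)) _ (h1 (i + 1) hi') (h2 i hi').le
      have hne : N (x i) ≠ N (x (i + 1)) := by
        intro he
        have e1 := hpar i (by omega)
        have e2 := hpar (i + 1) hi'
        rw [he, e2, pow_succ] at e1
        have : κ * (s * (-1) ^ i) = 0 := by linarith
        exact mul_ne_zero hκ (mul_ne_zero hs0 (pow_ne_zero _ (by norm_num))) this
      refine ⟨by omega, fun hk => ?_⟩
      have := hh.2 hk
      omega
  refine ⟨x (m - 1), h1 _ (by omega), (key _ (by omega)).1, fun hk => ?_⟩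
  have := (key _ (by omega : m - 1 < m)).2 hk
  omega

structure Spl (g : ℝ → ℝ) (r n : ℕ) (a : ℝ) (G : ℕ → ℝ → ℝ) (N : ℝ → ℕ) : Prop where
  ch : Ch r a G
  top : ∀ x ∈ Ico 0 a, G r x = (-1 : ℝ) ^ (N x) * g x
  mono : ∀ x ∈ Ico 0 a, ∀ y ∈ Ico 0 a, x ≤ y → N x ≤ N y
  bd : ∀ x ∈ Ico 0 a, N x ≤ n
  rc : ∀ x ∈ Ico 0 a, ∃ e, x < e ∧ e ≤ a ∧ ∀ y ∈ Ico x e, N y = N x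

structure Osc (f : ℝ → ℝ) (r n : ℕ) (a M : ℝ) (F : ℝ → ℝ) (t : ℕ → ℝ) : Prop where
  lo : 0 ≤ t 1
  hi : t (n + r + 1) = a
  lt : ∀ i, 1 ≤ i → i < n + r + 1 → t i < t (i + 1)
  val : ∀ i, 1 ≤ i → i ≤ n + r + 1 → F (t i) = (-1 : ℝ) ^ (i + r + 1) * (M * f (t i))
  le : ∀ x ∈ Icc 0 a, |F x| ≤ M * f x

lemma Osc.mono {f : ℝ → ℝ} {r n : ℕ} {a M : ℝ} {F : ℝ → ℝ} {t : ℕ → ℝ}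
    (h : Osc f r n a M F t) {i j : ℕ} (hi : 1 ≤ i) (hij : i ≤ j) (hj : j ≤ n + r + 1) :
    t i ≤ t j := by
  induction j, hij using Nat.le_induction with
  | base => exact le_rfl
  | succ j hij ih => exact (ih (by omega)).trans (h.lt j (by omega) (by omega)).le

lemma Osc.smono {f : ℝ → ℝ} {r n : ℕ} {a M : ℝ} {F : ℝ → ℝ} {t : ℕ → ℝ}
    (h : Osc f r n a M F t) {i j : ℕ} (hi : 1 ≤ i) (hij : i < j) (hj : j ≤ n + r + 1) :
    t i < t j :=
  (h.lt i hi (by omega)).trans_le (h.mono (by omega) hij hj)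

lemma Osc.mem {f : ℝ → ℝ} {r n : ℕ} {a M : ℝ} {F : ℝ → ℝ} {t : ℕ → ℝ}
    (h : Osc f r n a M F t) {i : ℕ} (hi : 1 ≤ i) (hj : i ≤ n + r + 1) : t i ∈ Icc 0 a :=
  ⟨h.lo.trans (h.mono le_rfl hi hj), by rw [← h.hi]; exact h.mono hi hj le_rfl⟩

lemma sgn_sq (k : ℕ) : (-1 : ℝ) ^ k * (-1) ^ k = 1 := by
  rcases sgn_cases k with h | h <;> rw [h] <;> norm_num

lemma sgn_ne (k : ℕ) : (-1 : ℝ) ^ k ≠ 0 := pow_ne_zero _ (by norm_num)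

/-- alternation of weak type pushed to the first derivative -/
lemma oscW {r : ℕ} {a : ℝ} {F : ℕ → ℝ → ℝ} (hr : 1 ≤ r) (h : Ch r a F) {lo hi : ℝ}
    (hlo : 0 ≤ lo) (hhi : hi ≤ a) (t : ℕ → ℝ) (q m : ℕ)
    (hmem : ∀ i, q ≤ i → i ≤ q + m → lo ≤ t i ∧ t i ≤ hi)
    (hlt : ∀ i, q ≤ i → i < q + m → t i < t (i + 1))
    (hw : ∀ i, q ≤ i → i ≤ q + m → 0 ≤ (-1 : ℝ) ^ (i + r + 1) * F 0 (t i))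
    (hnz : ∀ i, q ≤ i → i < q + m → ∃ z ∈ Icc (t i) (t (i + 1)), F 0 z ≠ 0) :
    SAlt (F 1) lo hi (-(-1) ^ (q + r + 1)) m := by
  refine W (sgn_ne _) (h.c (by omega) hlo hhi) (h.d (by omega) hlo hhi) m (fun i => t (q + i))
    (fun i hi' => hmem _ (by omega) (by omega)) (fun i hi' => hlt _ (by omega) (by omega))
    (fun i hi' => ?_) (fun i hi' => hnz _ (by omega) (by omega))
  have := hw (q + i) (by omega) (by omega)
  rw [← pow_add]
  convert this using 3
  omega

lemma G_alt {f : ℝ → ℝ} {r n : ℕ} {a M : ℝ} {F : ℕ → ℝ → ℝ} {t : ℕ → ℝ} (hr : 1 ≤ r)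
    (h : Ch r a F) (ho : Osc f r n a M (F 0) t) (hM : 0 < M) (hf : ∀ x ∈ Icc 0 a, 0 < f x)
    (q : ℕ) (hq : 1 ≤ q) (hqn : q ≤ n + 1) : SAlt (F r) (t q) a ((-1) ^ (q + 1)) (n + 2 - q) := by
  have h1 : SAlt (F 1) (t q) a (-(-1) ^ (q + r + 1)) (n + r + 1 - q) := by
    have hv : ∀ i, q ≤ i → i ≤ q + (n + r + 1 - q) → 0 < (-1 : ℝ) ^ (i + r + 1) * F 0 (t i) := by
      intro i h1 h2
      rw [ho.val i (by omega) (by omega), ← mul_assoc, sgn_sq, one_mul]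
      exact mul_pos hM (hf _ (ho.mem (by omega) (by omega)))
    refine oscW hr h (ho.mem hq (by omega)).1 le_rfl t q _ ?_ ?_ (fun i h1 h2 => (hv i h1 h2).le) ?_
    · exact fun i h1 h2 => ⟨ho.mono hq h1 (by omega), (ho.mem (by omega) (by omega)).2⟩
    · exact fun i h1 h2 => ho.lt i (by omega) (by omega)
    · intro i h1 h2
      refine ⟨t i, ⟨le_rfl, (ho.lt i (by omega) (by omega)).le⟩, fun h0 => ?_⟩
      have := hv i h1 h2.le
      rw [h0] at this; simp at this
  have e : n + r + 1 - q = (n + 2 - q) + (r - 1) := by omega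
  rw [e] at h1
  have h2 := it_none h (neg_ne_zero.2 (sgn_ne _)) (ho.mem hq (by omega)).1 le_rfl 1 _ (r - 1)
    (by omega) h1
  have e2 : 1 + (r - 1) = r := by omega
  rw [e2] at h2
  convert h2 using 1
  have e3 : q + r + 1 = (r - 1) + (q + 2) := by omega
  rw [e3, pow_add _ (r - 1), mul_neg, ← mul_assoc, sgn_sq, pow_succ _ (q + 1)]; ring

lemma sg_G {g : ℝ → ℝ} {r n : ℕ} {a : ℝ} {G : ℕ → ℝ → ℝ} {N : ℝ → ℕ} (h : Spl g r n a G N)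
    (hg : ∀ x ∈ Icc 0 a, 0 < g x) {lo hi : ℝ} (hlo : 0 ≤ lo) (hhi : hi ≤ a) :
    ∀ x ∈ Ico lo hi, ∀ σ : ℝ, (σ = 1 ∨ σ = -1) → 0 < σ * G r x → (-1 : ℝ) ^ (N x) = 1 * σ := by
  intro x hx σ hσ hp
  have hx' : x ∈ Ico 0 a := ⟨hlo.trans hx.1, hx.2.trans_le hhi⟩
  rw [h.top x hx'] at hp
  have := hg x ⟨hx'.1, hx'.2.le⟩
  rcases sgn_cases (N x) with h | h <;> rw [h] at hp ⊢ <;> rcases hσ with rfl | rfl <;>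
    norm_num at hp ⊢ <;> linarith

lemma sg_D {g : ℝ → ℝ} {r n : ℕ} {a : ℝ} {G H : ℕ → ℝ → ℝ} {N N' : ℝ → ℕ} (h : Spl g r n a G N)
    (h' : Spl g r n a H N')
    (hg : ∀ x ∈ Icc 0 a, 0 < g x) {lo hi : ℝ} (hlo : 0 ≤ lo) (hhi : hi ≤ a) :
    ∀ x ∈ Ico lo hi, ∀ σ : ℝ, (σ = 1 ∨ σ = -1) → 0 < σ * (G r x - H r x) →
      (-1 : ℝ) ^ (N x) = 1 * σ ∧ (-1 : ℝ) ^ (N' x) = -1 * σ := by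
  intro x hx σ hσ hp
  have hx' : x ∈ Ico 0 a := ⟨hlo.trans hx.1, hx.2.trans_le hhi⟩
  rw [h.top x hx', h'.top x hx'] at hp
  have := hg x ⟨hx'.1, hx'.2.le⟩
  rcases sgn_cases (N x) with h | h <;> rcases sgn_cases (N' x) with h' | h' <;>
    rw [h, h'] at hp ⊢ <;> rcases hσ with rfl | rfl <;>
    first | (exfalso; linarith) | norm_num

lemma rd_nonpos {F : ℝ → ℝ} {d x a : ℝ} (hxa : x < a) (h : HasDerivWithinAt F d (Ici x) x)
    (hle : ∀ y ∈ Ioo x a, F y ≤ F x) : d ≤ 0 := by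
  have h1 := h.Ioi_of_Ici
  rw [hasDerivWithinAt_iff_tendsto_slope' (by simp)] at h1
  refine le_of_tendsto h1 ?_
  filter_upwards [Ioo_mem_nhdsGT hxa] with y hy
  rw [slope_def_field]
  exact div_nonpos_of_nonpos_of_nonneg (by linarith [hle y hy]) (by linarith [hy.1])

lemma Spl.mono' {g : ℝ → ℝ} {r n : ℕ} {a : ℝ} {G : ℕ → ℝ → ℝ} {N : ℝ → ℕ} (h : Spl g r n a G N)
    {lo hi : ℝ} (hlo : 0 ≤ lo) (hhi : hi ≤ a) :
    ∀ x ∈ Ico lo hi, ∀ y ∈ Ico lo hi, x ≤ y → N x ≤ N y :=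
  fun x hx y hy => h.mono x ⟨hlo.trans hx.1, hx.2.trans_le hhi⟩ y
    ⟨hlo.trans hy.1, hy.2.trans_le hhi⟩

/-- a knot-count bound at the right of `d` puts `t q` to the left of `d`. -/
lemma L4 {f g : ℝ → ℝ} {r n : ℕ} {a M : ℝ} {G : ℕ → ℝ → ℝ} {N : ℝ → ℕ} {t : ℕ → ℝ} (hr : 1 ≤ r)
    (h : Spl g r n a G N) (hg : ∀ x ∈ Icc 0 a, 0 < g x)
    (ho : Osc f r n a M (G 0) t) (hM : 0 < M) (hf : ∀ x ∈ Icc 0 a, 0 < f x)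
    {d : ℝ} (q : ℕ) (hq : 1 ≤ q) (hqn : q ≤ n) (hd : ∀ x ∈ Ico 0 a, d ≤ x → q ≤ N x) :
    t q < d := by
  by_contra hcon
  push Not at hcon
  have h1 := G_alt hr h.ch ho hM hf q hq (by omega)
  have h0 := (ho.mem hq (by omega)).1
  obtain ⟨x, hx, h2, -⟩ := L3 (P := q) (sgn_cases _) (sg_G h hg h0 le_rfl) (h.mono' h0 le_rfl)
    (fun x hx => hd x ⟨h0.trans hx.1, hx.2⟩ (hcon.trans hx.1)) h1 (by omega)
  have := h.bd x ⟨h0.trans hx.1, hx.2⟩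
  omega

lemma L2 {f g : ℝ → ℝ} {r n : ℕ} {a M : ℝ} {G X : ℕ → ℝ → ℝ} {N : ℝ → ℕ} {t : ℕ → ℝ} (hr : 1 ≤ r)
    (h : Spl g r n a X N) (hg : ∀ x ∈ Icc 0 a, 0 < g x)
    (ho : Osc f r n a M (G 0) t) (hM : 0 < M) (hf : ∀ x ∈ Icc 0 a, 0 < f x)
    (hfa : AntitoneOn f (Icc 0 a)) (hX : ∀ x ∈ Icc 0 a, |X 0 x| ≤ M * f x)
    {c : ℝ} (hc0 : 0 ≤ c) (hca : c < a) (hXG : ∀ x ∈ Icc 0 c, X 0 x = G 0 x) :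
    c < t (N c + r + 1) := by
  by_contra hcon
  push Not at hcon
  have hNc : N c ≤ n := h.bd c ⟨hc0, hca⟩
  have hmem : ∀ i, 1 ≤ i → i ≤ N c + r + 1 → 0 ≤ t i ∧ t i ≤ c := fun i h1 h2 =>
    ⟨(ho.mem h1 (by omega)).1, (ho.mono h1 h2 (by omega)).trans hcon⟩
  have hval : ∀ i, 1 ≤ i → i ≤ N c + r + 1 → 0 < (-1 : ℝ) ^ (i + r + 1) * X 0 (t i) := by
    intro i h1 h2
    rw [hXG _ (hmem i h1 h2), ho.val i (by omega) (by omega), ← mul_assoc, sgn_sq, one_mul]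
    exact mul_pos hM (hf _ (ho.mem (by omega) (by omega)))
  have hder : ∀ i, 1 ≤ i → i ≤ N c + r + 1 → (-1 : ℝ) ^ (i + r + 1) * X 1 (t i) ≤ 0 := by
    intro i h1 h2
    have hm := hmem i h1 h2
    have hta := hm.2.trans_lt hca
    refine rd_nonpos (F := fun x => (-1 : ℝ) ^ (i + r + 1) * X 0 x) hta
      (((h.ch 0 (by omega)).2 (t i) ⟨hm.1, hta⟩).const_mul _) ?_
    intro y hy
    have e1 : (-1 : ℝ) ^ (i + r + 1) * X 0 (t i) = M * f (t i) := by
      rw [hXG _ (hmem i h1 h2), ho.val i (by omega) (by omega), ← mul_assoc, sgn_sq, one_mul]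
    have hy' : y ∈ Icc 0 a := ⟨hm.1.trans hy.1.le, hy.2.le⟩
    have e2 := abs_le.1 (hX y hy')
    have e3 := mul_le_mul_of_nonneg_left (hfa ⟨hm.1, hta.le⟩ hy' hy.1.le) hM.le
    rw [e1]
    rcases sgn_cases (i + r + 1) with h | h <;> rw [h] <;> linarith
  -- strict alternation of the top derivative
  have hlt : ∀ i, 1 ≤ i → i < N c + r + 1 → t i < t (i + 1) := fun i h1 h2 =>
    ho.lt i h1 (by omega)
  rcases Nat.lt_or_ge r 2 with hr2 | hr2
  · have hr1 : r = 1 := by omega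
    subst hr1
    have hpos : ∀ i, 1 ≤ i → i ≤ N c + 2 → 0 < -(-1 : ℝ) ^ (i + 1 + 1) * X 1 (t i) := by
      intro i h1 h2
      have hm := hmem i h1 h2
      have hx' : t i ∈ Ico 0 a := ⟨hm.1, hm.2.trans_lt hca⟩
      have h3 := hder i h1 h2
      have hne : X 1 (t i) ≠ 0 := by
        rw [h.top _ hx']
        exact mul_ne_zero (sgn_ne _) (hg _ ⟨hx'.1, hx'.2.le⟩).ne'
      refine lt_of_le_of_ne (by linarith) (Ne.symm ?_)
      exact mul_ne_zero (neg_ne_zero.2 (sgn_ne _)) hne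
    have hS : SAlt (X 1) 0 a 1 (N c + 2) := by
      refine ⟨fun i => t (i + 1), ?_, ?_, ?_⟩
      · intro i hi'
        have hm := hmem (i + 1) (by omega) (by omega)
        exact ⟨hm.1, hm.2.trans_lt hca⟩
      · exact fun i hi' => hlt (i + 1) (by omega) (by omega)
      · intro i hi'
        have := hpos (i + 1) (by omega) (by omega)
        simp only [pow_succ] at this ⊢
        linarith
    obtain ⟨x, h1, h2, h3⟩ := hS
    have hS2 : SAlt (X 1) 0 (t (N c + 2)) 1 (N c + 1) := by
      refine ⟨fun i => t (i + 1), ?_, ?_, ?_⟩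
      · intro i hi'
        have hm := hmem (i + 1) (by omega) (by omega)
        exact ⟨hm.1, ho.smono (by omega) (by omega) (by omega)⟩
      · exact fun i hi' => hlt (i + 1) (by omega) (by omega)
      · intro i hi'
        have := hpos (i + 1) (by omega) (by omega)
        simp only [pow_succ] at this ⊢
        linarith
    have hm2 := hmem (N c + 2) (by omega) (by omega)
    have hta := hm2.2.trans hca.le
    obtain ⟨y, hy, h4, -⟩ := L3 (P := 0) (Or.inl rfl) (sg_G h hg le_rfl hta) (h.mono' le_rfl hta)
      (fun _ _ => Nat.zero_le _) hS2 (by omega)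
    have hy0 : y ∈ Ico 0 a := ⟨hy.1, hy.2.trans_le hta⟩
    have hc' : c ∈ Ico 0 a := ⟨hc0, hca⟩
    have h5 := h.mono y hy0 (t (N c + 2)) ⟨hm2.1, hm2.2.trans_lt hca⟩ hy.2.le
    have h6 := h.mono (t (N c + 2)) ⟨hm2.1, hm2.2.trans_lt hca⟩ c hc' hm2.2
    have h7 : N (t (N c + 2)) = N c := by omega
    have h8 := hpos (N c + 2) (by omega) le_rfl
    rw [h.top _ ⟨hm2.1, hm2.2.trans_lt hca⟩, h7] at h8
    have h9 := hg (t (N c + 2)) ⟨hm2.1, hta⟩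
    have : -(-1 : ℝ) ^ (N c + 2 + 1 + 1) * ((-1) ^ N c * g (t (N c + 2)))
      = - g (t (N c + 2)) := by
      have := sgn_sq (N c)
      rw [pow_succ, pow_succ, pow_succ, pow_succ]
      linear_combination (-g (t (N c + 2))) * this
    linarith
  · set b := t (N c + r + 1) with hb
    have hbm := hmem (N c + r + 1) (by omega) le_rfl
    rw [← hb] at hbm
    have hba : b ≤ a := hbm.2.trans hca.le
    have hW := W (F := X 1) (F' := X 2) (lo := 0) (hi := b) (s := (-1) ^ (r + 1)) (sgn_ne _)
      (h.ch.c (by omega) le_rfl hba)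
      (h.ch.d (by omega) le_rfl hba) (N c + r) (fun i => t (i + 1))
      (fun i hi' => ⟨(hmem (i + 1) (by omega) (by omega)).1,
        ho.mono (by omega) (by omega) (by omega)⟩) (fun i hi' => hlt _ (by omega) (by omega))
      (fun i hi' => ?_) (fun i hi' => ?_)
    · have e1 : N c + r = (N c + 2) + (r - 2) := by omega
      rw [e1] at hW
      have h2 := it_none h.ch (neg_ne_zero.2 (sgn_ne _)) le_rfl hba 2 _ (r - 2)
        (by omega) hW
      have e2 : 2 + (r - 2) = r := by omega
      rw [e2] at h2
      have hs : (-1 : ℝ) ^ (r - 2) * -(-1) ^ (r + 1) = 1 ∨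
        (-1 : ℝ) ^ (r - 2) * -(-1) ^ (r + 1) = -1 := by
        rcases sgn_cases (r - 2) with h | h <;> rcases sgn_cases (r + 1) with h' | h' <;>
          rw [h, h'] <;> norm_num
      obtain ⟨y, hy, h4, -⟩ := L3 (P := 0) hs (sg_G h hg le_rfl hba) (h.mono' le_rfl hba)
        (fun _ _ => Nat.zero_le _) h2 (by omega)
      have h5 := h.mono y ⟨hy.1, hy.2.trans_le hba⟩ c ⟨hc0, hca⟩ (hy.2.le.trans hbm.2)
      omega
    · have := hder (i + 1) (by omega) (by omega)
      have e : i + 1 + r + 1 = (r + 1) + i + 1 := by omega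
      rw [e, pow_succ, pow_add] at this
      linarith
    · by_contra hz
      push Not at hz
      have hm1 := hmem (i + 1) (by omega) (by omega)
      have hm2 := hmem (i + 1 + 1) (by omega) (by omega)
      have hl := hlt (i + 1) (by omega) (by omega)
      have hcst := constant_of_has_deriv_right_zero
        (h.ch.c (j := 0) (by omega) hm1.1 (hm2.2.trans hca.le)) (fun x hx => by
          have := h.ch.d (j := 0) (by omega) hm1.1 (hm2.2.trans hca.le) x hx
          simp only [zero_add] at this
          rwa [hz x ⟨hx.1, hx.2.le⟩] at this) (t (i + 1 + 1)) ⟨hl.le, le_rfl⟩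
      have v1 := hval (i + 1) (by omega) (by omega)
      have v2 := hval (i + 1 + 1) (by omega) (by omega)
      rw [hcst] at v2
      have e : i + 1 + 1 + r + 1 = (i + 1 + r + 1) + 1 := by omega
      rw [e, pow_succ] at v2
      linarith

lemma SAlt.neg' {F K : ℝ → ℝ} {lo hi s : ℝ} {m : ℕ}
    (h : SAlt (fun x => F x - K x) lo hi s m) : SAlt (fun x => K x - F x) lo hi (-s) m := by
  obtain ⟨x, h1, h2, h3⟩ := h
  refine ⟨x, h1, h2, fun i hi' => ?_⟩
  have := h3 i hi'
  have e : -s * (-1 : ℝ) ^ i * (K (x i) - F (x i)) = s * (-1) ^ i * (F (x i) - K (x i)) := by ring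
  simpa only [e] using this

lemma Fin0 {g : ℝ → ℝ} {r n : ℕ} {a : ℝ} {G H : ℕ → ℝ → ℝ} {N N' : ℝ → ℕ} (h : Spl g r n a G N)
    (h' : Spl g r n a H N') (hg : ∀ x ∈ Icc 0 a, 0 < g x) {lo hi : ℝ} (hlo : 0 ≤ lo)
    (hhi : hi ≤ a) (P q q' : ℕ) (hP : ∀ x ∈ Ico lo hi, P ≤ N x) (hP' : ∀ x ∈ Ico lo hi, P ≤ N' x)
    (hq : ∀ x ∈ Ico lo hi, N x ≤ q) (hq' : ∀ x ∈ Ico lo hi, N' x ≤ q')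
    (S1 : SAlt (fun x => G r x - H r x) lo hi ((-1) ^ P) (q - P))
    (S2 : SAlt (fun x => G r x - H r x) lo hi (-(-1) ^ P) (q' - P))
    (hne : ∃ x ∈ Ico lo hi, G r x - H r x ≠ 0) : False := by
  have sD := sg_D h h' hg hlo hhi
  have sH : ∀ x ∈ Ico lo hi, ∀ σ : ℝ, (σ = 1 ∨ σ = -1) → 0 < σ * (fun x => G r x - H r x) x →
      (-1 : ℝ) ^ (N' x) = -1 * σ := fun x hx σ hσ hp => (sD x hx σ hσ hp).2
  have sG : ∀ x ∈ Ico lo hi, ∀ σ : ℝ, (σ = 1 ∨ σ = -1) → 0 < σ * (fun x => G r x - H r x) x →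
      (-1 : ℝ) ^ (N x) = 1 * σ := fun x hx σ hσ hp => (sD x hx σ hσ hp).1
  have c1 : ((-1 : ℝ) ^ P = 1 ∨ (-1 : ℝ) ^ P = -1) := sgn_cases P
  have c2 : (-(-1 : ℝ) ^ P = 1 ∨ -(-1 : ℝ) ^ P = -1) := by
    rcases c1 with e | e <;> rw [e] <;> norm_num
  have A1 : ∀ m, 0 < m → SAlt (fun x => G r x - H r x) lo hi ((-1) ^ P) m → P + m ≤ q' := by
    intro m hm S
    obtain ⟨x, hx, -, h3⟩ := L3 c1 sH (h'.mono' hlo hhi) hP' S hm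
    exact (h3 (by ring)).trans (hq' x hx)
  have A2 : ∀ m, 0 < m → SAlt (fun x => G r x - H r x) lo hi (-(-1) ^ P) m → P + m ≤ q := by
    intro m hm S
    obtain ⟨x, hx, -, h3⟩ := L3 c2 sG (h.mono' hlo hhi) hP S hm
    exact (h3 (by ring)).trans (hq x hx)
  obtain ⟨z, hz, hz0⟩ := hne
  by_cases hqP : P < q
  · have h1 := A1 _ (by omega) S1
    have h2 := A2 _ (by omega) S2
    have e : q' = q := by omega
    subst e
    rcases SAlt.merge (by omega) S1 S2 with S | S
    · have := A1 _ (by omega) S; omega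
    · have := A2 _ (by omega) S; omega
  · by_cases hqP' : P < q'
    · have h2 := A2 _ (by omega) S2
      omega
    · apply hz0
      have hz' : z ∈ Ico 0 a := ⟨hlo.trans hz.1, hz.2.trans_le hhi⟩
      have e1 : N z = P := le_antisymm ((hq z hz).trans (by omega)) (hP z hz)
      have e2 : N' z = P := le_antisymm ((hq' z hz).trans (by omega)) (hP' z hz)
      rw [h.top z hz', h'.top z hz', e1, e2, sub_self]

lemma wk {f : ℝ → ℝ} {r n : ℕ} {a M M' : ℝ} {F K : ℝ → ℝ} {t : ℕ → ℝ}
    (ho : Osc f r n a M F t) (hM : M' ≤ M) (hf : ∀ x ∈ Icc 0 a, 0 < f x)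
    (hK : ∀ x ∈ Icc 0 a, |K x| ≤ M' * f x)
    (i : ℕ) (h1 : 1 ≤ i) (h2 : i ≤ n + r + 1) :
    0 ≤ (-1 : ℝ) ^ (i + r + 1) * (F (t i) - K (t i)) := by
  have hm := ho.mem h1 h2
  have := abs_le.1 (hK _ hm)
  have e := mul_le_mul_of_nonneg_right hM (hf _ hm).le
  rw [mul_sub, ho.val i h1 h2, ← mul_assoc, sgn_sq, one_mul]
  rcases sgn_cases (i + r + 1) with h | h <;> rw [h] <;> linarith

lemma caseBa {f g : ℝ → ℝ} {r n : ℕ} {a M M' : ℝ} {G H : ℕ → ℝ → ℝ} {N N' : ℝ → ℕ} {t : ℕ → ℝ}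
    (hr : 1 ≤ r) (h : Spl g r n a G N) (h' : Spl g r n a H N')
    (hg : ∀ x ∈ Icc 0 a, 0 < g x)
    (ho : Osc f r n a M (G 0) t) (hM : M' ≤ M) (hf : ∀ x ∈ Icc 0 a, 0 < f x)
    (hK : ∀ x ∈ Icc 0 a, |H 0 x| ≤ M' * f x)
    (hnz : ∀ i, 1 ≤ i → i < n + r + 1 → ∃ z ∈ Icc (t i) (t (i + 1)), G 0 z - H 0 z ≠ 0) :
    False := by
  have hD := h.ch.sub h'.ch
  have S := oscW hr hD le_rfl le_rfl t 1 (n + r)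
    (fun i h1 h2 => ho.mem h1 (by omega)) (fun i h1 h2 => ho.lt i h1 (by omega))
    (fun i h1 h2 => wk ho hM hf hK i h1 (by omega))
    (fun i h1 h2 => hnz i h1 (by omega))
  have e : n + r = (n + 1) + (r - 1) := by omega
  rw [e] at S
  have S2 := it_none hD (neg_ne_zero.2 (sgn_ne _)) le_rfl le_rfl 1 _ (r - 1) (by omega) S
  have e2 : 1 + (r - 1) = r := by omega
  have e3 : (-1 : ℝ) ^ (r - 1) * -(-1) ^ (1 + r + 1) = 1 := by
    have e : 1 + r + 1 = (r - 1) + 3 := by omega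
    rw [e, pow_add _ (r - 1), mul_neg, ← mul_assoc, sgn_sq]; norm_num
  rw [e2, e3] at S2
  obtain ⟨x, hx, -, h3⟩ := L3 (P := 0) (Or.inl rfl)
    (fun x hx σ hσ hp => (sg_D h h' hg le_rfl le_rfl x hx σ hσ hp).2)
    (h'.mono' le_rfl le_rfl) (fun _ _ => Nat.zero_le _) S2 (by omega)
  have := h3 (by norm_num)
  have := h'.bd x hx
  omega

lemma ex_q {g : ℝ → ℝ} {r n : ℕ} {a : ℝ} {G : ℕ → ℝ → ℝ} {N : ℝ → ℕ} (h : Spl g r n a G N)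
    {d : ℝ} (hd0 : 0 < d) (hda : d < a) : ∃ q, q ≤ n ∧ (∀ x ∈ Ico 0 d, N x ≤ q) ∧
      ∀ x ∈ Ico 0 a, d ≤ x → q ≤ N x := by
  have hb : BddAbove (N '' Ico 0 d) :=
    ⟨n, by rintro _ ⟨x, hx, rfl⟩; exact h.bd x ⟨hx.1, hx.2.trans hda⟩⟩
  obtain ⟨x0, hx0, e⟩ := Nat.sSup_mem (s := N '' Ico 0 d) ⟨_, 0, ⟨le_rfl, hd0⟩, rfl⟩ hb
  refine ⟨sSup (N '' Ico 0 d), ?_, fun x hx => le_csSup hb ⟨x, hx, rfl⟩, ?_⟩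
  · rw [← e]; exact h.bd x0 ⟨hx0.1, hx0.2.trans hda⟩
  · intro x hx hdx
    rw [← e]; exact h.mono x0 ⟨hx0.1, hx0.2.trans hda⟩ x hx (hx0.2.le.trans hdx)

lemma halfB {f g : ℝ → ℝ} {r n : ℕ} {a M : ℝ} {G H : ℕ → ℝ → ℝ} {N : ℝ → ℕ} {t : ℕ → ℝ}
    (hr : 1 ≤ r) (h : Spl g r n a G N) (h' : Ch r a H)
    (hg : ∀ x ∈ Icc 0 a, 0 < g x)
    (ho : Osc f r n a M (G 0) t) (hM : 0 < M) (hf : ∀ x ∈ Icc 0 a, 0 < f x)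
    (hK : ∀ x ∈ Icc 0 a, |H 0 x| ≤ M * f x) {d : ℝ} (hd0 : 0 < d) (hda : d < a)
    (hfl : ∀ j < r, G j d - H j d = 0)
    (hnz : ∀ x y, 0 ≤ x → x < y → y ≤ d → ∃ z ∈ Icc x y, G 0 z - H 0 z ≠ 0)
    (q : ℕ) (hqn : q ≤ n) (hq : ∀ x ∈ Ico 0 a, d ≤ x → q ≤ N x) :
    SAlt (fun x => G r x - H r x) 0 d 1 q := by
  rcases Nat.eq_zero_or_pos q with rfl | hq0
  · exact ⟨fun _ => 0, by simp, by simp, by simp⟩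
  have hD := h.ch.sub h'
  have htq := L4 hr h hg ho hM hf q hq0 hqn hq
  have hti : ∀ i, 1 ≤ i → i ≤ q → t i < d := fun i h1 h2 => (ho.mono h1 h2 (by omega)).trans_lt htq
  have hlt : ∀ i < q, (if i < q then t (i + 1) else d) < (if i + 1 < q then t (i + 1 + 1) else d) := by
    intro i hi'
    rw [if_pos hi']
    split_ifs
    · exact ho.lt _ (by omega) (by omega)
    · exact hti _ (by omega) (by omega)
  have hmem : ∀ i ≤ q, 0 ≤ (if i < q then t (i + 1) else d) ∧ (if i < q then t (i + 1) else d) ≤ d := by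
    intro i hi'
    split_ifs
    · exact ⟨(ho.mem (by omega) (by omega)).1, (hti _ (by omega) (by omega)).le⟩
    · exact ⟨hd0.le, le_rfl⟩
  have S := W (s := (-1 : ℝ) ^ r) (sgn_ne r) (hD.c (j := 0) (by omega) le_rfl hda.le)
    (hD.d (j := 0) (by omega) le_rfl hda.le) q (fun i => if i < q then t (i + 1) else d)
    hmem hlt ?_ ?_
  · have S2 := it_right hD (neg_ne_zero.2 (sgn_ne _)) le_rfl hda.le hd0.le hfl 1 _ (r - 1)
      (by omega) S
    have e2 : 1 + (r - 1) = r := by omega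
    have e3 : (-1 : ℝ) ^ (r - 1) * -(-1) ^ r = 1 := by
      obtain ⟨k, rfl⟩ : ∃ k, r = k + 1 := ⟨r - 1, by omega⟩
      rw [Nat.add_sub_cancel, pow_succ]
      linear_combination sgn_sq k
    rwa [e2, e3] at S2
  · intro i hi'
    try dsimp only
    split_ifs
    · have := wk ho le_rfl hf hK (i + 1) (by omega) (by omega)
      have e : i + 1 + r + 1 = r + i + 2 := by omega
      rw [e, pow_add _ (r + i), pow_add] at this
      simpa using this
    · rw [hfl 0 (by omega)]; simp
  · intro i hi'
    exact hnz _ _ (hmem i hi'.le).1 (hlt i hi') (hmem (i + 1) hi').2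

lemma halfA {f g : ℝ → ℝ} {r n : ℕ} {a M : ℝ} {G H : ℕ → ℝ → ℝ} {N : ℝ → ℕ} {t : ℕ → ℝ}
    (hr : 1 ≤ r) (h : Spl g r n a G N) (h' : Ch r a H)
    (hg : ∀ x ∈ Icc 0 a, 0 < g x)
    (ho : Osc f r n a M (G 0) t) (hM : 0 < M) (hf : ∀ x ∈ Icc 0 a, 0 < f x)
    (hK : ∀ x ∈ Icc 0 a, |H 0 x| ≤ M * f x) {c d : ℝ} (hc0 : 0 ≤ c) (hcd : c < d) (hda : d < a)
    (hfl : ∀ j < r, G j d - H j d = 0) (hfl' : ∀ j < r, G j c - H j c = 0)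
    (hnz : ∀ x y, c ≤ x → x < y → y ≤ d → ∃ z ∈ Icc x y, G 0 z - H 0 z ≠ 0)
    (q p : ℕ) (hqn : q ≤ n) (hq : ∀ x ∈ Ico 0 a, d ≤ x → q ≤ N x)
    (htp : c < t (p + r + 1)) :
    SAlt (fun x => G r x - H r x) c d ((-1) ^ p) (q - p) := by
  have hD := h.ch.sub h'
  by_cases hqp : p + r + 1 ≤ q
  · have htq := L4 hr h hg ho hM hf q (by omega) hqn hq
    have hti : ∀ i, 1 ≤ i → i ≤ q → t i < d :=
      fun i h1 h2 => (ho.mono h1 h2 (by omega)).trans_lt htq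
    have htc : ∀ i, p + r + 1 ≤ i → i ≤ q → c < t i :=
      fun i h1 h2 => htp.trans_le (ho.mono (by omega) h1 (by omega))
    obtain ⟨k, hk⟩ : ∃ k, q = p + r + k := ⟨q - p - r, by omega⟩
    let y : ℕ → ℝ := fun i => if i = 0 then c else if i ≤ k then t (p + r + i) else d
    have hlt : ∀ i < k + 1, y i < y (i + 1) := by
      intro i hi'
      simp only [y]
      rw [if_neg (by omega : ¬ i + 1 = 0)]
      split_ifs
      · exact htc _ (by omega) (by omega)
      · omega
      · exact ho.lt _ (by omega) (by omega)
      · exact hti _ (by omega) (by omega)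
      · omega
      · omega
    have hmem : ∀ i ≤ k + 1, c ≤ y i ∧ y i ≤ d := by
      intro i hi'
      simp only [y]
      split_ifs
      · exact ⟨le_rfl, hcd.le⟩
      · exact ⟨(htc _ (by omega) (by omega)).le, (hti _ (by omega) (by omega)).le⟩
      · exact ⟨hcd.le, le_rfl⟩
    have S := W (s := -(-1 : ℝ) ^ p) (neg_ne_zero.2 (sgn_ne p)) (hD.c (j := 0) (by omega) hc0 hda.le)
      (hD.d (j := 0) (by omega) hc0 hda.le) (k + 1) y hmem hlt ?_ ?_
    · rw [neg_neg] at S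
      have S2 := it_both hD (sgn_ne _) hc0 hda.le hfl' hfl 1 _ (r - 1) (by omega)
        (by omega) S
      have e2 : 1 + (r - 1) = r := by omega
      have e3 : k + 1 + (r - 1) = q - p := by omega
      rwa [e2, e3] at S2
    · intro i hi'
      simp only [y]
      split_ifs with h1 h2
      · rw [hfl' 0 (by omega)]; simp
      · have := wk ho le_rfl hf hK (p + r + i) (by omega) (by omega)
        have e : p + r + i + r + 1 = (p + i + 1) + r + r := by omega
        rw [e, pow_add _ (p + i + 1 + r), pow_add _ (p + i + 1), mul_assoc _ _ ((-1 : ℝ) ^ r),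
          sgn_sq, mul_one, pow_succ, pow_add] at this
        linarith
      · rw [hfl 0 (by omega)]; simp
    · intro i hi'
      exact hnz _ _ (hmem i hi'.le).1 (hlt i hi') (hmem (i + 1) hi').2
  · obtain ⟨z, hz, hz0⟩ := hnz c d le_rfl hcd le_rfl
    have hzd : z < d := lt_of_le_of_ne hz.2 fun e => hz0 (by rw [e]; exact hfl 0 (by omega))
    have key : ∀ s : ℝ, 0 < s * (G 0 z - H 0 z) → SAlt (fun x => G r x - H r x) c d s (r + 1) := by
      intro s hs
      have hs0 : s ≠ 0 := by rintro rfl; simp at hs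
      have := it_both hD hs0 hc0 hda.le hfl' hfl 0 1 r (by omega) (by omega)
        ⟨fun _ => z, fun i _ => ⟨hz.1, hzd⟩, fun i hi' => by omega, fun i hi' => by
          obtain rfl : i = 0 := by omega
          simpa using hs⟩
      rw [zero_add, add_comm] at this
      exact this
    rcases lt_or_gt_of_ne (mul_ne_zero (sgn_ne p) hz0) with hs | hs
    · have := (key (-(-1) ^ p) (by linarith)).tail
      rw [neg_neg] at this
      exact this.take (by omega)
    · exact (key _ hs).take (by omega)

lemma caseAa {f g : ℝ → ℝ} {r n : ℕ} {a M : ℝ} {G H : ℕ → ℝ → ℝ} {N N' : ℝ → ℕ} {t : ℕ → ℝ}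
    (hr : 1 ≤ r) (h : Spl g r n a G N) (h' : Spl g r n a H N')
    (hg : ∀ x ∈ Icc 0 a, 0 < g x)
    (ho : Osc f r n a M (G 0) t) (hf : ∀ x ∈ Icc 0 a, 0 < f x)
    (hK : ∀ x ∈ Icc 0 a, |H 0 x| ≤ M * f x) {c : ℝ} (hc0 : 0 ≤ c) (hca : c < a)
    (hfl' : ∀ j < r, G j c - H j c = 0)
    (hnz : ∀ x y, c ≤ x → x < y → y ≤ a → ∃ z ∈ Icc x y, G 0 z - H 0 z ≠ 0)
    (p : ℕ) (hpn : p ≤ n) (hP' : ∀ x ∈ Ico c a, p ≤ N' x)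
    (htp : c < t (p + r + 1)) : False := by
  have hD := h.ch.sub h'.ch
  have htc : ∀ i, p + r + 1 ≤ i → i ≤ n + r + 1 → c < t i :=
    fun i h1 h2 => htp.trans_le (ho.mono (by omega) h1 (by omega))
  obtain ⟨k, hk⟩ : ∃ k, n = p + k := ⟨n - p, by omega⟩
  let y : ℕ → ℝ := fun i => if i = 0 then c else t (p + r + i)
  have hlt : ∀ i < k + 1, y i < y (i + 1) := by
    intro i hi'
    simp only [y]
    rw [if_neg (by omega : ¬ i + 1 = 0)]
    split_ifs
    · exact htc _ (by omega) (by omega)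
    · exact ho.lt _ (by omega) (by omega)
  have hmem : ∀ i ≤ k + 1, c ≤ y i ∧ y i ≤ a := by
    intro i hi'
    simp only [y]
    split_ifs
    · exact ⟨le_rfl, hca.le⟩
    · exact ⟨(htc _ (by omega) (by omega)).le, (ho.mem (by omega) (by omega)).2⟩
  have S := W (s := -(-1 : ℝ) ^ p) (neg_ne_zero.2 (sgn_ne p)) (hD.c (j := 0) (by omega) hc0 le_rfl)
    (hD.d (j := 0) (by omega) hc0 le_rfl) (k + 1) y hmem hlt ?_ ?_
  · rw [neg_neg] at S
    have S2 := it_left hD (sgn_ne _) hc0 le_rfl hfl' 1 _ (r - 1) (by omega) S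
    have e2 : 1 + (r - 1) = r := by omega
    rw [e2] at S2
    obtain ⟨x, hx, -, h3⟩ := L3 (P := p) (sgn_cases p)
      (fun x hx σ hσ hp => (sg_D h h' hg hc0 le_rfl x hx σ hσ hp).2)
      (h'.mono' hc0 le_rfl) hP' S2 (by omega)
    have := h3 (by ring)
    have := h'.bd x ⟨hc0.trans hx.1, hx.2⟩
    omega
  · intro i hi'
    simp only [y]
    split_ifs with h1
    · rw [hfl' 0 (by omega)]; simp
    · have := wk ho le_rfl hf hK (p + r + i) (by omega) (by omega)
      have e : p + r + i + r + 1 = (p + i + 1) + r + r := by omega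
      rw [e, pow_add _ (p + i + 1 + r), pow_add _ (p + i + 1), mul_assoc _ _ ((-1 : ℝ) ^ r),
        sgn_sq, mul_one, pow_succ, pow_add] at this
      linarith
  · intro i hi'
    exact hnz _ _ (hmem i hi'.le).1 (hlt i hi') (hmem (i + 1) hi').2

lemma lim0 {F : ℝ → ℝ} {a d : ℝ} {T : Set ℝ} (hc : ContinuousOn F (Icc 0 a)) (hT : T ⊆ Icc 0 a)
    (h0 : ∀ x ∈ T, F x = 0) (hd : d ∈ closure T) : F d = 0 := by
  have hda : d ∈ Icc 0 a := by
    have := closure_mono hT hd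
    rwa [isClosed_Icc.closure_eq] at this
  have hsub : insert d T ⊆ Icc 0 a := insert_subset hda hT
  have : EqOn F (fun _ => 0) (insert d T) :=
    EqOn.of_subset_closure (fun x hx => h0 x hx) (hc.mono hsub) continuousOn_const
      (subset_insert _ _) (insert_subset hd subset_closure)
  exact this (mem_insert _ _)

lemma vanish {r : ℕ} {a : ℝ} {F : ℕ → ℝ → ℝ} (h : Ch r a F) {x y : ℝ} (hx : 0 ≤ x) (hy : y ≤ a)
    (h0 : ∀ z ∈ Icc x y, F 0 z = 0) : ∀ j ≤ r, ∀ z ∈ Ico x y, F j z = 0 := by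
  intro j
  induction j with
  | zero => exact fun _ z hz => h0 z ⟨hz.1, hz.2.le⟩
  | succ j ih =>
    intro hj z hz
    have h1 := h.d (j := j) (by omega) hx hy z hz
    have h2 : HasDerivWithinAt (F j) 0 (Ici z) z := by
      refine (hasDerivWithinAt_const z (Ici z) (0 : ℝ)).congr_of_eventuallyEq ?_
        (ih (by omega) z hz)
      filter_upwards [Ico_mem_nhdsGE hz.2] with w hw
      exact ih (by omega) w ⟨hz.1.trans hw.1, hw.2⟩
    exact (uniqueDiffOn_Ici z z self_mem_Ici).eq_deriv _ h1 h2

lemma rise {r : ℕ} {a : ℝ} {F : ℕ → ℝ → ℝ} (h : Ch r a F) {x y : ℝ} (hx : 0 ≤ x) (hy : y ≤ a)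
    (hfl : ∀ j < r, F j x = 0)
    (h0 : ∀ z ∈ Ico x y, F r z = 0) : ∀ z ∈ Ico x y, F 0 z = 0 := by
  have : ∀ k ≤ r, ∀ z ∈ Ico x y, F (r - k) z = 0 := by
    intro k
    induction k with
    | zero => exact fun _ => h0
    | succ k ih =>
      intro hk z hz
      have hza : z ≤ a := hz.2.le.trans hy
      have := constant_of_has_deriv_right_zero
        (h.c (j := r - (k + 1)) (by omega) hx hza) (fun w hw => by
          have := h.d (j := r - (k + 1)) (by omega) hx hza w hw
          have e : r - (k + 1) + 1 = r - k := by omega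
          rwa [e, ih (by omega) w ⟨hw.1, hw.2.trans hz.2⟩] at this) z ⟨hz.1, le_rfl⟩
      rw [this, hfl _ (by omega)]
  simpa using this r le_rfl

section
variable {f g : ℝ → ℝ} {r n : ℕ} {a M : ℝ} {G H : ℕ → ℝ → ℝ} {N N' : ℝ → ℕ} {t t' : ℕ → ℝ}

lemma caseB (hr : 1 ≤ r) (h : Spl g r n a G N) (h' : Spl g r n a H N')
    (hg : ∀ x ∈ Icc 0 a, 0 < g x) (hf : ∀ x ∈ Icc 0 a, 0 < f x)
    (ho : Osc f r n a M (G 0) t) (ho' : Osc f r n a M (H 0) t') (hM : 0 < M)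
    {d : ℝ} (hd0 : 0 < d) (hda : d < a)
    (hfl : ∀ j < r, G j d - H j d = 0)
    (hnz : ∀ x y, 0 ≤ x → x < y → y ≤ d → ∃ z ∈ Icc x y, G 0 z - H 0 z ≠ 0) : False := by
  obtain ⟨q, hqn, hq1, hq2⟩ := ex_q h hd0 hda
  obtain ⟨q', hqn', hq1', hq2'⟩ := ex_q h' hd0 hda
  have S1 := halfB hr h h'.ch hg ho hM hf ho'.le hd0 hda hfl hnz q hqn hq2
  have S2 := (halfB hr h' h.ch hg ho' hM hf ho.le hd0 hda
    (fun j hj => by rw [← neg_sub, hfl j hj, neg_zero])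
    (fun x y h1 h2 h3 => by
      obtain ⟨z, hz, hz0⟩ := hnz x y h1 h2 h3
      exact ⟨z, hz, fun e => hz0 (by rw [← neg_sub, e, neg_zero])⟩) q' hqn' hq2').neg'
  refine Fin0 h h' hg le_rfl hda.le 0 q q' (fun _ _ => Nat.zero_le _) (fun _ _ => Nat.zero_le _)
    hq1 hq1' (by simpa using S1) (by simpa using S2) ?_
  obtain ⟨z, hz, hz0⟩ := hnz 0 d le_rfl hd0 le_rfl
  have hzd : z < d := lt_of_le_of_ne hz.2 fun e => hz0 (by rw [e]; exact hfl 0 (by omega))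
  have := it_right (h.ch.sub h'.ch) (s := G 0 z - H 0 z) hz0 le_rfl hda.le hd0.le hfl 0 1 r
    (by omega) ⟨fun _ => z, fun i _ => ⟨hz.1, hzd⟩, fun i hi' => by omega, fun i hi' => by
          obtain rfl : i = 0 := by omega
          simpa using mul_self_pos.2 hz0⟩
  rw [zero_add] at this
  obtain ⟨x, h1, -, h3⟩ := this
  refine ⟨x 0, h1 0 (by omega), fun e => ?_⟩
  have := h3 0 (by omega)
  simp only [e] at this
  simp at this

lemma t_gt (hr : 1 ≤ r) (h : Spl g r n a G N) (h' : Spl g r n a H N')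
    (hg : ∀ x ∈ Icc 0 a, 0 < g x) (hf : ∀ x ∈ Icc 0 a, 0 < f x) (hfa : AntitoneOn f (Icc 0 a))
    (ho : Osc f r n a M (G 0) t) (ho' : Osc f r n a M (H 0) t') (hM : 0 < M)
    {c : ℝ} (hc0 : 0 ≤ c) (hca : c < a) (hz : ∀ x ∈ Icc 0 c, G 0 x - H 0 x = 0) :
    c < t (min (N c) (N' c) + r + 1) := by
  rcases min_choice (N c) (N' c) with e | e <;> rw [e]
  · exact L2 (G := G) hr h hg ho hM hf hfa ho.le hc0 hca (fun _ _ => rfl)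
  · exact L2 (G := G) hr h' hg ho hM hf hfa ho'.le hc0 hca
      (fun x hx => by linarith [hz x hx])

lemma caseA (hr : 1 ≤ r) (h : Spl g r n a G N) (h' : Spl g r n a H N')
    (hg : ∀ x ∈ Icc 0 a, 0 < g x) (hf : ∀ x ∈ Icc 0 a, 0 < f x) (hfa : AntitoneOn f (Icc 0 a))
    (ho : Osc f r n a M (G 0) t) (ho' : Osc f r n a M (H 0) t') (hM : 0 < M)
    {c d : ℝ} (hc0 : 0 ≤ c) (hcd : c < d) (hda : d < a)
    (hz : ∀ x ∈ Icc 0 c, G 0 x - H 0 x = 0)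
    (hfl : ∀ j < r, G j d - H j d = 0) (hfl' : ∀ j < r, G j c - H j c = 0)
    (hnz : ∀ x y, c ≤ x → x < y → y ≤ d → ∃ z ∈ Icc x y, G 0 z - H 0 z ≠ 0) : False := by
  have hca := hcd.trans hda
  have hc : c ∈ Ico 0 a := ⟨hc0, hca⟩
  obtain ⟨q, hqn, hq1, hq2⟩ := ex_q h (hc0.trans_lt hcd) hda
  obtain ⟨q', hqn', hq1', hq2'⟩ := ex_q h' (hc0.trans_lt hcd) hda
  have T1 := t_gt hr h h' hg hf hfa ho ho' hM hc0 hca hz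
  have T2 := t_gt hr h' h hg hf hfa ho' ho hM hc0 hca
    (fun x hx => by linarith [hz x hx])
  rw [min_comm] at T2
  set p := min (N c) (N' c) with hp
  have S1 := halfA hr h h'.ch hg ho hM hf ho'.le hc0 hcd hda hfl hfl' hnz q p hqn hq2 T1
  have S2 := (halfA hr h' h.ch hg ho' hM hf ho.le hc0 hcd hda
    (fun j hj => by rw [← neg_sub, hfl j hj, neg_zero])
    (fun j hj => by rw [← neg_sub, hfl' j hj, neg_zero])
    (fun x y h1 h2 h3 => by
      obtain ⟨z, hz, hz0⟩ := hnz x y h1 h2 h3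
      exact ⟨z, hz, fun e => hz0 (by rw [← neg_sub, e, neg_zero])⟩) q' p hqn' hq2' T2).neg'
  have hI : ∀ x ∈ Ico c d, x ∈ Ico 0 d := fun x hx => ⟨hc0.trans hx.1, hx.2⟩
  have hI' : ∀ x ∈ Ico c d, x ∈ Ico 0 a := fun x hx => ⟨hc0.trans hx.1, hx.2.trans hda⟩
  refine Fin0 h h' hg hc0 hda.le p q q'
    (fun x hx => (min_le_left _ _).trans (h.mono c hc x (hI' x hx) hx.1))
    (fun x hx => (min_le_right _ _).trans (h'.mono c hc x (hI' x hx) hx.1))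
    (fun x hx => hq1 x (hI x hx)) (fun x hx => hq1' x (hI x hx)) S1 S2 ?_
  obtain ⟨z, hz, hz0⟩ := hnz c d le_rfl hcd le_rfl
  have hzd : z < d := lt_of_le_of_ne hz.2 fun e => hz0 (by rw [e]; exact hfl 0 (by omega))
  have := it_right (h.ch.sub h'.ch) (s := G 0 z - H 0 z) hz0 hc0 hda.le hcd.le hfl 0 1 r
    (by omega) ⟨fun _ => z, fun i _ => ⟨hz.1, hzd⟩, fun i hi' => by omega, fun i hi' => by
          obtain rfl : i = 0 := by omega
          simpa using mul_self_pos.2 hz0⟩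
  rw [zero_add] at this
  obtain ⟨x, h1, -, h3⟩ := this
  refine ⟨x 0, h1 0 (by omega), fun e => ?_⟩
  have := h3 0 (by omega)
  simp only [e] at this
  simp at this

lemma core (hr : 1 ≤ r) (h : Spl g r n a G N) (h' : Spl g r n a H N')
    (hg : ∀ x ∈ Icc 0 a, 0 < g x) (hf : ∀ x ∈ Icc 0 a, 0 < f x) (hfa : AntitoneOn f (Icc 0 a))
    (ho : Osc f r n a M (G 0) t) (ho' : Osc f r n a M (H 0) t') (hM : 0 < M)
    {c : ℝ} (hc0 : 0 ≤ c) (hca : c < a)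
    (hc : (c = 0 ∧ ∃ j < r, G j 0 - H j 0 ≠ 0) ∨
      ((∀ x ∈ Icc 0 c, G 0 x - H 0 x = 0) ∧ (∀ j < r, G j c - H j c = 0) ∧
        ∀ e, c < e → e ≤ a → ∃ z ∈ Icc c e, G 0 z - H 0 z ≠ 0)) : False := by
  have hD := h.ch.sub h'.ch
  have hca' : c ∈ Ico 0 a := ⟨hc0, hca⟩
  set S : Set ℝ := {x | x ∈ Ico c a ∧ ∃ y, x < y ∧ y ≤ a ∧ ∀ z ∈ Icc x y, G 0 z - H 0 z = 0}
    with hS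
  rcases S.eq_empty_or_nonempty with hE | hE
  · have hnz : ∀ x y, c ≤ x → x < y → y ≤ a → ∃ z ∈ Icc x y, G 0 z - H 0 z ≠ 0 := by
      intro x y h1 h2 h3
      by_contra hcon
      push Not at hcon
      have : x ∈ S := ⟨⟨h1, h2.trans_le h3⟩, y, h2, h3, hcon⟩
      rw [hE] at this
      exact this
    rcases hc with ⟨rfl, -⟩ | ⟨hz, hfl, -⟩
    · exact caseBa hr h h' hg ho le_rfl hf ho'.le
        (fun i h1 h2 => hnz _ _ (ho.mem h1 (by omega)).1 (ho.lt i h1 h2) (ho.mem (by omega) h2).2)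
    · refine caseAa hr h h' hg ho hf ho'.le hc0 hca hfl hnz (min (N c) (N' c))
        ((min_le_left _ _).trans (h.bd c hca'))
        (fun x hx => (min_le_right _ _).trans (h'.mono c hca' x ⟨hc0.trans hx.1, hx.2⟩ hx.1))
        (t_gt hr h h' hg hf hfa ho ho' hM hc0 hca hz)
  · have hb : BddBelow S := ⟨c, fun x hx => hx.1.1⟩
    obtain ⟨x0, hx0⟩ := hE
    have hE : S.Nonempty := ⟨x0, hx0⟩
    set d := sInf S with hd
    have hcd : c ≤ d := le_csInf hE fun x hx => hx.1.1
    have hda : d < a := (csInf_le hb hx0).trans_lt hx0.1.2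
    have hnz : ∀ x y, c ≤ x → x < y → y ≤ d → ∃ z ∈ Icc x y, G 0 z - H 0 z ≠ 0 := by
      intro x y h1 h2 h3
      by_contra hcon
      push Not at hcon
      have : x ∈ S := ⟨⟨h1, h2.trans_le (h3.trans hda.le)⟩, y, h2, h3.trans hda.le, hcon⟩
      exact absurd (csInf_le hb this) (not_le.2 (h2.trans_le h3))
    have hv : ∀ x ∈ S, ∀ j ≤ r, G j x - H j x = 0 := by
      rintro x ⟨hx, y, hxy, hya, hz⟩ j hj
      exact vanish hD (hc0.trans hx.1) hya hz j hj x ⟨le_rfl, hxy⟩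
    have hfl : ∀ j < r, G j d - H j d = 0 := by
      intro j hj
      exact lim0 (F := fun x => G j x - H j x) (hD j hj).1 (fun x hx => ⟨hc0.trans hx.1.1, hx.1.2.le⟩)
        (fun x hx => hv x hx j hj.le) (csInf_mem_closure hE hb)
    rcases hc with ⟨rfl, j, hj, hj0⟩ | ⟨hz, hflc, hmax⟩
    · have : 0 < d := lt_of_le_of_ne hcd fun e => hj0 (by have := hfl j hj; rwa [← e] at this)
      exact caseB hr h h' hg hf ho ho' hM this hda hfl hnz
    · have hcd' : c < d := by
        refine lt_of_le_of_ne hcd fun e => ?_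
        obtain ⟨e1, h1, h1a, hN⟩ := h.rc c hca'
        obtain ⟨e2, h2, h2a, hN'⟩ := h'.rc c hca'
        obtain ⟨x, hxS, hxe⟩ := exists_lt_of_csInf_lt hE
          (show sInf S < min e1 e2 by rw [← hd, ← e]; exact lt_min h1 h2)
        have hx1 := hxe.trans_le (min_le_left e1 e2)
        have hx2 := hxe.trans_le (min_le_right e1 e2)
        have hxa : x ∈ Ico 0 a := ⟨hc0.trans hxS.1.1, hxS.1.2⟩
        have hx0 := hv x hxS r le_rfl
        rw [h.top x hxa, h'.top x hxa, hN x ⟨hxS.1.1, hx1⟩, hN' x ⟨hxS.1.1, hx2⟩, ← sub_mul] at hx0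
        have hgx := hg x ⟨hxa.1, hxa.2.le⟩
        have hs : (-1 : ℝ) ^ N c - (-1) ^ N' c = 0 := by
          rcases mul_eq_zero.1 hx0 with h | h
          · exact h
          · exact absurd h hgx.ne'
        have hR := rise hD hc0 (y := min e1 e2) ((min_le_left _ _).trans h1a) hflc (fun z hz => by
          have hza : z ∈ Ico 0 a :=
            ⟨hc0.trans hz.1, hz.2.trans_le ((min_le_left _ _).trans h1a)⟩
          rw [h.top z hza, h'.top z hza, hN z ⟨hz.1, hz.2.trans_le (min_le_left _ _)⟩,
            hN' z ⟨hz.1, hz.2.trans_le (min_le_right _ _)⟩, ← sub_mul, hs, zero_mul])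
        have hlt : c < min e1 e2 := lt_min h1 h2
        have hle : min e1 e2 ≤ a := (min_le_left _ _).trans h1a
        obtain ⟨z, hz, hz0⟩ := hmax ((c + min e1 e2) / 2) (by linarith) (by linarith)
        exact hz0 (hR z ⟨hz.1, by linarith [hz.2]⟩)
      exact caseA hr h h' hg hf hfa ho ho' hM hc0 hcd' hda hz hfl hflc hnz

lemma mainEq (hr : 1 ≤ r) (ha : 0 < a) (h : Spl g r n a G N) (h' : Spl g r n a H N')
    (hg : ∀ x ∈ Icc 0 a, 0 < g x) (hf : ∀ x ∈ Icc 0 a, 0 < f x) (hfa : AntitoneOn f (Icc 0 a))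
    (ho : Osc f r n a M (G 0) t) (ho' : Osc f r n a M (H 0) t') (hM : 0 < M) :
    ∀ x ∈ Icc 0 a, G 0 x = H 0 x := by
  by_contra hcon
  push Not at hcon
  obtain ⟨w, hw, hw0⟩ := hcon
  have hD := h.ch.sub h'.ch
  by_cases hfl0 : ∀ j < r, G j 0 - H j 0 = 0
  · set T : Set ℝ := {x | x ∈ Icc 0 a ∧ ∀ z ∈ Icc 0 x, G 0 z - H 0 z = 0} with hT
    have h0T : (0 : ℝ) ∈ T := ⟨⟨le_rfl, ha.le⟩, fun z hz => by
      rw [Icc_self] at hz; rw [hz]; exact hfl0 0 (by omega)⟩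
    have hb : BddAbove T := ⟨a, fun x hx => hx.1.2⟩
    set c := sSup T with hc
    have hc0 : 0 ≤ c := le_csSup hb h0T
    have hca : c ≤ a := csSup_le ⟨0, h0T⟩ fun x hx => hx.1.2
    have hv : ∀ z ∈ Ico 0 c, ∀ j ≤ r, G j z - H j z = 0 := by
      intro z hz j hj
      obtain ⟨x, hx, hzx⟩ := exists_lt_of_lt_csSup ⟨0, h0T⟩ hz.2
      exact vanish hD le_rfl hx.1.2 hx.2 j hj z ⟨hz.1, hzx⟩
    have hflc : ∀ j < r, G j c - H j c = 0 := by
      intro j hj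
      rcases hc0.eq_or_lt with e | hlt
      · rw [← e]; exact hfl0 j hj
      · refine lim0 (F := fun x => G j x - H j x) (hD j hj).1 (T := Ico 0 c) (fun x hx => ⟨hx.1, hx.2.le.trans hca⟩)
          (fun x hx => hv x hx j hj.le) ?_
        rw [closure_Ico hlt.ne]
        exact ⟨hc0, le_rfl⟩
    have hz : ∀ x ∈ Icc 0 c, G 0 x - H 0 x = 0 := by
      intro x hx
      rcases hx.2.eq_or_lt with e | hlt
      · rw [e]; exact hflc 0 (by omega)
      · exact hv x ⟨hx.1, hlt⟩ 0 (by omega)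
    have hca' : c < a := lt_of_le_of_ne hca fun e =>
      hw0 (sub_eq_zero.1 (hz w ⟨hw.1, by rw [e]; exact hw.2⟩))
    refine core hr h h' hg hf hfa ho ho' hM hc0 hca' (Or.inr ⟨hz, hflc, ?_⟩)
    intro e hce hea
    by_contra hcon
    push Not at hcon
    have : e ∈ T := ⟨⟨hc0.trans hce.le, hea⟩, fun z hz' => by
      rcases le_total z c with h1 | h1
      · exact hz z ⟨hz'.1, h1⟩
      · exact hcon z ⟨h1, hz'.2⟩⟩
    exact absurd (le_csSup hb this) (not_le.2 hce)
  · push Not at hfl0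
    exact core hr h h' hg hf hfa ho ho' hM le_rfl ha (Or.inl ⟨rfl, hfl0⟩)

lemma normLe {M' : ℝ} (hr : 1 ≤ r) (h : Spl g r n a G N) (h' : Spl g r n a H N')
    (hg : ∀ x ∈ Icc 0 a, 0 < g x) (hf : ∀ x ∈ Icc 0 a, 0 < f x)
    (ho : Osc f r n a M (G 0) t) (ho' : Osc f r n a M' (H 0) t') (hM : M' < M) : False := by
  refine caseBa hr h h' hg ho hM.le hf ho'.le ?_
  intro i h1 h2
  refine ⟨t i, ⟨le_rfl, (ho.lt i h1 h2).le⟩, fun e => ?_⟩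
  have hm := ho.mem h1 h2.le
  have e1 := ho'.le _ hm
  rw [← sub_eq_zero.1 e, ho.val i h1 h2.le] at e1
  have e2 := mul_lt_mul_of_pos_right hM (hf _ hm)
  have e3 := abs_nonneg (H 0 (t i))
  rcases sgn_cases (i + r + 1) with h | h <;> rw [h] at e1 <;>
    first | linarith [le_abs_self (1 * (M * f (t i)))] | linarith [neg_le_abs (-1 * (M * f (t i)))]
end

lemma extract {g : ℝ → ℝ} {r m : ℕ} {a ε : ℝ} {u : ℕ → ℝ} {G : ℝ → ℝ} (hr : 1 ≤ r) (ha : 0 < a)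
    (hg : ContinuousOn g (Icc 0 a)) (h : PerfectSplineWith g r a m u ε G) :
    ∃ (F : ℕ → ℝ → ℝ) (N : ℝ → ℕ), F 0 = G ∧ Ch r a F ∧
      (∀ x ∈ Ico 0 a, F r x = ε * (-1 : ℝ) ^ (N x) * g x) ∧
      (∀ x ∈ Ico 0 a, ∀ y ∈ Ico 0 a, x ≤ y → N x ≤ N y) ∧
      (∀ x ∈ Ico 0 a, N x ≤ m) ∧
      (∀ x ∈ Ico 0 a, ∃ e, x < e ∧ e ≤ a ∧ ∀ y ∈ Ico x e, N y = N x) := by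
  classical
  obtain ⟨hε, hu0, hua, hul, hC, hP⟩ := h
  let N : ℝ → ℕ := fun x => Nat.findGreatest (fun i => u i ≤ x) m
  have hmono : ∀ i j, i ≤ j → j ≤ m + 1 → u i ≤ u j := by
    intro i j hij
    induction j, hij using Nat.le_induction with
    | base => exact fun _ => le_rfl
    | succ j hij ih => exact fun hj => (ih (by omega)).trans (hul j (by omega)).le
  have hNm : ∀ x, N x ≤ m := fun x => Nat.findGreatest_le m
  have hN1 : ∀ x ∈ Ico 0 a, u (N x) ≤ x := fun x hx =>
    Nat.findGreatest_spec (P := fun i => u i ≤ x) (Nat.zero_le m) (by rw [hu0]; exact hx.1)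
  have hN2 : ∀ x ∈ Ico 0 a, x < u (N x + 1) := by
    intro x hx
    rcases (hNm x).lt_or_eq with h | h
    · exact not_le.1 (Nat.findGreatest_is_greatest (P := fun i => u i ≤ x) (n := m)
        (Nat.lt_succ_self _) h)
    · rw [h, hua]; exact hx.2
  have hNmono : ∀ x ∈ Ico 0 a, ∀ y ∈ Ico 0 a, x ≤ y → N x ≤ N y := by
    intro x hx y hy hxy
    exact Nat.le_findGreatest (hNm x) ((hN1 x hx).trans hxy)
  let F : ℕ → ℝ → ℝ := fun j => if j < r then iteratedDerivWithin j G (Icc 0 a)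
    else fun x => ε * (-1 : ℝ) ^ (N x) * g x
  have hud : UniqueDiffOn ℝ (Icc 0 a) := uniqueDiffOn_Icc ha
  have hcont : ∀ j < r, ContinuousOn (iteratedDerivWithin j G (Icc 0 a)) (Icc 0 a) := by
    intro j hj
    exact hC.continuousOn_iteratedDerivWithin (by exact_mod_cast (by omega : j ≤ r - 1)) hud
  refine ⟨F, N, ?_, ?_, ?_, hNmono, fun x _ => hNm x, ?_⟩
  · simp only [F]
    rw [if_pos (by omega), iteratedDerivWithin_zero]
  · intro j hj
    have e : F j = iteratedDerivWithin j G (Icc 0 a) := if_pos hj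
    rw [e]
    refine ⟨hcont j hj, fun x hx => ?_⟩
    by_cases hj' : j + 1 < r
    · have e : F (j + 1) = iteratedDerivWithin (j + 1) G (Icc 0 a) := if_pos hj'
      rw [e, iteratedDerivWithin_succ]
      have hd := hC.differentiableOn_iteratedDerivWithin (m := j)
        (by exact_mod_cast (by omega : j < r - 1)) hud
      exact (hd x ⟨hx.1, hx.2.le⟩).hasDerivWithinAt.mono_of_mem_nhdsWithin
        (Icc_mem_nhdsGE_of_mem hx)
    · have hjr : j + 1 = r := by omega
      have e : F (j + 1) = fun x => ε * (-1 : ℝ) ^ (N x) * g x := if_neg hj'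
      rw [e]
      set i := N x with hi
      have hi1 := hN1 x hx
      have hi2 := hN2 x hx
      obtain ⟨hCi, hDi⟩ := hP i (hNm x)
      have hui0 : 0 ≤ u i := by rw [← hu0]; exact hmono 0 i (by omega) ((hNm x).trans (by omega))
      have huia : u (i + 1) ≤ a := by
        rw [← hua]; exact hmono _ _ (Nat.succ_le_succ (hNm x)) le_rfl
      have key : ∀ y ∈ Ioo x (u (i + 1)), HasDerivAt (iteratedDerivWithin j G (Icc 0 a))
          (ε * (-1 : ℝ) ^ i * g y) y := by
        intro y hy
        have hy' : y ∈ Ioo (u i) (u (i + 1)) := ⟨hi1.trans_lt hy.1, hy.2⟩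
        have hd := hCi.differentiableOn_iteratedDerivWithin (m := j)
          (by exact_mod_cast (by omega : j < r)) isOpen_Ioo.uniqueDiffOn y hy'
        have h1 := hd.hasDerivWithinAt
        rw [← iteratedDerivWithin_succ, hjr, hDi y hy'] at h1
        have h2 := h1.hasDerivAt (isOpen_Ioo.mem_nhds hy')
        refine h2.congr_of_eventuallyEq ?_
        filter_upwards [isOpen_Ioo.mem_nhds hy'] with z hz
        simp only [iteratedDerivWithin]
        rw [iteratedFDerivWithin_congr_set (s := Icc 0 a) (t := Ioo (u i) (u (i + 1)))]
        have hz1 : Icc 0 a ∈ 𝓝 z := Icc_mem_nhds (hui0.trans_lt hz.1) (hz.2.trans_le huia)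
        have hz2 := isOpen_Ioo.mem_nhds hz
        filter_upwards [hz1, hz2] with w hw1 hw2
        exact propext ⟨fun _ => hw2, fun _ => hw1⟩
      refine hasDerivWithinAt_Ici_of_tendsto_deriv (s := Ioo x (u (i + 1)))
        (fun y hy => (key y hy).differentiableAt.differentiableWithinAt) ?_ (Ioo_mem_nhdsGT hi2) ?_
      · exact (hcont j hj x ⟨hx.1, hx.2.le⟩).mono
          fun y hy => ⟨hx.1.trans hy.1.le, hy.2.le.trans huia⟩
      · have hgx : Tendsto g (𝓝[>] x) (𝓝 (g x)) := by
          refine (hg x ⟨hx.1, hx.2.le⟩).mono_left ?_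
          refine nhdsWithin_le_of_mem ?_
          exact mem_of_superset (Ioo_mem_nhdsGT hx.2) fun y hy => ⟨hx.1.trans hy.1.le, hy.2.le⟩
        refine (hgx.const_mul (ε * (-1 : ℝ) ^ i)).congr' ?_
        filter_upwards [Ioo_mem_nhdsGT hi2] with y hy
        exact (key y hy).deriv.symm
  · intro x hx
    simp only [F]
    rw [if_neg (lt_irrefl r)]
  · intro x hx
    have hle : u (N x + 1) ≤ a := by
      rw [← hua]; exact hmono _ _ (Nat.succ_le_succ (hNm x)) le_rfl
    refine ⟨u (N x + 1), hN2 x hx, hle, fun y hy => ?_⟩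
    have hya : y ∈ Ico 0 a := ⟨hx.1.trans hy.1, hy.2.trans_le hle⟩
    refine le_antisymm ?_ (hNmono x hx y hya hy.1)
    by_contra hcon
    push Not at hcon
    have h1 := hmono (N x + 1) (N y) hcon ((hNm y).trans (by omega))
    linarith [hN1 y hya, hy.2]

lemma extract2 {f g : ℝ → ℝ} {r n : ℕ} {a : ℝ} {G : ℝ → ℝ} (hr : 1 ≤ r) (ha : 0 < a)
    (hf : ContinuousOn f (Icc 0 a)) (hfp : ∀ x ∈ Icc 0 a, 0 < f x)
    (hg : ContinuousOn g (Icc 0 a)) (hgp : ∀ x ∈ Icc 0 a, 0 < g x)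
    (h : IsExtremalSpline f g r n a G) :
    ∃ (F : ℕ → ℝ → ℝ) (N : ℝ → ℕ) (M : ℝ) (t : ℕ → ℝ), F 0 = G ∧ 0 < M ∧ Spl g r n a F N ∧
      Osc f r n a M (F 0) t := by
  obtain ⟨⟨m, hmn, u, ε, hS⟩, t, ht1, ht2, ht3, ht4⟩ := h
  obtain ⟨F, N, hF0, hF, hN1, hN2, hN3, hN4⟩ := extract hr ha hg hS
  have hGc : ContinuousOn G (Icc 0 a) := by rw [← hF0]; exact (hF 0 (by omega)).1
  have hbdd : BddAbove ((fun t => |G t| / f t) '' Icc 0 a) :=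
    (isCompact_Icc.image_of_continuousOn (hGc.abs.div hf fun x hx => (hfp x hx).ne')).bddAbove
  have hle : ∀ x ∈ Icc 0 a, |G x| ≤ wNorm G f (Icc 0 a) * f x := by
    intro x hx
    have := le_csSup hbdd ⟨x, hx, rfl⟩
    exact (div_le_iff₀ (hfp x hx)).1 this
  have ho : Osc f r n a (wNorm G f (Icc 0 a)) (F 0) t := by
    rw [hF0]; exact ⟨ht1, ht2, ht3, ht4, hle⟩
  have hM : 0 < wNorm G f (Icc 0 a) := by
    by_contra hcon
    push Not at hcon
    have hz : ∀ x ∈ Icc 0 a, F 0 x = 0 := by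
      intro x hx
      have h1 := hle x hx
      have h2 := mul_nonpos_of_nonpos_of_nonneg hcon (hfp x hx).le
      rw [hF0]
      exact abs_eq_zero.1 (le_antisymm (h1.trans h2) (abs_nonneg _))
    have h0 := vanish hF le_rfl le_rfl hz r le_rfl 0 ⟨le_rfl, ha⟩
    rw [hN1 0 ⟨le_rfl, ha⟩] at h0
    have hg0 := hgp 0 ⟨le_rfl, ha.le⟩
    have hε : ε ≠ 0 := by rcases hS.1 with e | e <;> rw [e] <;> norm_num
    exact mul_ne_zero (mul_ne_zero hε (sgn_ne _)) hg0.ne' h0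
  refine ⟨F, N, _, t, hF0, hM, ?_, ho⟩
  have hε : ε = 1 := by
    rcases hS.1 with e | e
    · exact e
    · exfalso
      have hA := G_alt hr hF ho hM hfp 1 le_rfl (by omega)
      have h0 : 0 ≤ t 1 := ht1
      obtain ⟨x, hx, -, h3⟩ := L3 (N := N) (κ := -1) (P := 0) (sgn_cases _)
        (fun x hx σ hσ hp => by
          have hx' : x ∈ Ico 0 a := ⟨h0.trans hx.1, hx.2⟩
          rw [hN1 x hx', e] at hp
          have := hgp x ⟨hx'.1, hx'.2.le⟩
          rcases sgn_cases (N x) with h | h <;> rw [h] at hp ⊢ <;> rcases hσ with rfl | rfl <;>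
            first | (exfalso; linarith) | norm_num)
        (fun x hx y hy => hN2 x ⟨h0.trans hx.1, hx.2⟩ y ⟨h0.trans hy.1, hy.2⟩)
        (fun _ _ => Nat.zero_le _) hA (by omega)
      have h4 := h3 (by norm_num)
      have h5 := hN3 x ⟨h0.trans hx.1, hx.2⟩
      omega
  exact ⟨hF, fun x hx => by rw [hN1 x hx, hε, one_mul], hN2, fun x hx => (hN3 x hx).trans hmn, hN4⟩

/-- Theorem 1 (uniqueness): a perfect g-spline in Γ^r_{n,g}[0,a] with n+r+1
oscillation points is unique. -/
theorem statement1
    (f g : ℝ → ℝ)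
    (hf_c : ContinuousOn f (Ici 0)) (hf_pos : ∀ t ∈ Ici (0:ℝ), 0 < f t)
    (hf_anti : AntitoneOn f (Ici 0))
    (hg_c : ContinuousOn g (Ici 0)) (hg_pos : ∀ t ∈ Ici (0:ℝ), 0 < g t)
    (hg_anti : AntitoneOn g (Ici 0))
    (r : ℕ) (hr : 1 ≤ r) (n : ℕ) (a : ℝ) (ha : 0 < a)
    (G H : ℝ → ℝ)
    (hG : IsExtremalSpline f g r n a G) (hH : IsExtremalSpline f g r n a H) :
    EqOn G H (Icc 0 a) := by

  have hsub : Icc 0 a ⊆ Ici (0 : ℝ) := fun x hx => hx.1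
  have hfp : ∀ x ∈ Icc 0 a, 0 < f x := fun x hx => hf_pos x hx.1
  have hgp : ∀ x ∈ Icc 0 a, 0 < g x := fun x hx => hg_pos x hx.1
  obtain ⟨F, N, M, t, hF, hM, hS, hO⟩ :=
    extract2 hr ha (hf_c.mono hsub) hfp (hg_c.mono hsub) hgp hG
  obtain ⟨F', N', M', t', hF', hM', hS', hO'⟩ :=
    extract2 hr ha (hf_c.mono hsub) hfp (hg_c.mono hsub) hgp hH
  rcases lt_trichotomy M M' with hlt | heq | hlt
  · exact (normLe hr hS' hS hgp hfp hO' hO hlt).elim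
  · subst heq
    have := mainEq hr ha hS hS' hgp hfp (hf_anti.mono hsub) hO hO' hM
    rw [hF, hF'] at this
    exact this
  · exact (normLe hr hS hS' hgp hfp hO hO' hlt).elim
end

section
/- Let f and g be continuous, positive, non-increasing functions on [0,∞), let r ∈ ℕ, n ∈ ℤ₊. The function φ_{r,n,f} : (0,∞) → ℝ defined by φ_{r,n,f}(a) := ‖G_{r,n,f,a}‖_{C[0,a],f}, where G_{r,n,f,a} is the unique perfect g-spline in Γ^r_{n,g}[0,a] with n+r+1 oscillation points, is continuous on (0,∞) and strictly increasing in a. -/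
open Set Filter MeasureTheory
open scoped Topology

theorem mvt_pos (h d : ℝ → ℝ) (s : Finset ℝ) : ∀ x y : ℝ, x < y → ContinuousOn h (Icc x y) →
    (∀ t ∈ Ioo x y, t ∉ s → HasDerivAt h (d t) t) → h x < h y →
    ∃ z ∈ Ioo x y, z ∉ s ∧ 0 < d z := by
  induction s using Finset.induction with
  | empty =>
    intro x y hxy hc hd hlt
    obtain ⟨z, hz, hzd⟩ := exists_hasDerivAt_eq_slope h d hxy hc (fun t ht => hd t ht (by simp))
    refine ⟨z, hz, by simp, ?_⟩
    rw [hzd]; exact div_pos (by linarith) (by linarith)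
  | insert w s hw ih =>
    intro x y hxy hc hd hlt
    by_cases hwm : w ∈ Ioo x y
    · have key : h x < h w ∨ h w < h y := by
        by_contra hcon; push Not at hcon; linarith [hcon.1, hcon.2]
      rcases key with k | k
      · obtain ⟨z, hz, hzs, hzd⟩ := ih x w hwm.1 (hc.mono (Icc_subset_Icc_right hwm.2.le))
          (fun t ht hts => hd t ⟨ht.1, ht.2.trans hwm.2⟩ (by
            simp only [Finset.mem_insert, not_or]; exact ⟨ht.2.ne, hts⟩)) k
        exact ⟨z, ⟨hz.1, hz.2.trans hwm.2⟩, by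
          simp only [Finset.mem_insert, not_or]; exact ⟨hz.2.ne, hzs⟩, hzd⟩
      · obtain ⟨z, hz, hzs, hzd⟩ := ih w y hwm.2 (hc.mono (Icc_subset_Icc_left hwm.1.le))
          (fun t ht hts => hd t ⟨hwm.1.trans ht.1, ht.2⟩ (by
            simp only [Finset.mem_insert, not_or]; exact ⟨ht.1.ne', hts⟩)) k
        exact ⟨z, ⟨hwm.1.trans hz.1, hz.2⟩, by
          simp only [Finset.mem_insert, not_or]; exact ⟨hz.1.ne', hzs⟩, hzd⟩
    · obtain ⟨z, hz, hzs, hzd⟩ := ih x y hxy hc (fun t ht hts => hd t ht (by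
            simp only [Finset.mem_insert, not_or]
            exact ⟨fun h => hwm (h ▸ ht), hts⟩)) hlt
      exact ⟨z, hz, by
        simp only [Finset.mem_insert, not_or]; exact ⟨fun h => hwm (h ▸ hz), hzs⟩, hzd⟩

theorem mvt_sign (h d : ℝ → ℝ) (s : Finset ℝ) (e x y : ℝ) (hxy : x < y)
    (hc : ContinuousOn h (Icc x y))
    (hd : ∀ t ∈ Ioo x y, t ∉ s → HasDerivAt h (d t) t) (hlt : e * h x < e * h y) :
    ∃ z ∈ Ioo x y, z ∉ s ∧ 0 < e * d z :=
  mvt_pos (fun t => e * h t) (fun t => e * d t) s x y hxy (hc.const_smul e)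
    (fun t ht hts => (hd t ht hts).const_mul e) hlt

theorem mvt_weak (h d : ℝ → ℝ) (s : Finset ℝ) (e x y : ℝ) (hxy : x < y) (he : e ≠ 0)
    (hc : ContinuousOn h (Icc x y))
    (hd : ∀ t ∈ Ioo x y, t ∉ s → HasDerivAt h (d t) t) (hx : e * h x ≤ 0) (hy : 0 ≤ e * h y)
    (hnz : ∃ t ∈ Icc x y, h t ≠ 0) :
    ∃ z ∈ Ioo x y, z ∉ s ∧ 0 < e * d z := by
  by_cases hlt : e * h x < e * h y
  · exact mvt_sign h d s e x y hxy hc hd hlt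
  · have h1 : e * h x = 0 := by linarith
    have h2 : e * h y = 0 := by linarith
    have h1' : h x = 0 := by simpa [he] using h1
    have h2' : h y = 0 := by simpa [he] using h2
    obtain ⟨t, ht, htn⟩ := hnz
    have htx : x < t := lt_of_le_of_ne ht.1 (fun h => htn (h ▸ h1'))
    have hty : t < y := lt_of_le_of_ne ht.2 (fun h => htn (h ▸ h2'))
    have het : e * h t ≠ 0 := mul_ne_zero he htn
    rcases lt_or_gt_of_ne het with k | k
    · obtain ⟨z, hz, hzs, hzd⟩ := mvt_sign h d s e t y hty
        (hc.mono (Icc_subset_Icc_left htx.le))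
        (fun w hw => hd w ⟨htx.trans hw.1, hw.2⟩) (by linarith)
      exact ⟨z, ⟨htx.trans hz.1, hz.2⟩, hzs, hzd⟩
    · obtain ⟨z, hz, hzs, hzd⟩ := mvt_sign h d s e x t htx
        (hc.mono (Icc_subset_Icc_right hty.le))
        (fun w hw => hd w ⟨hw.1, hw.2.trans hty⟩) (by linarith)
      exact ⟨z, ⟨hz.1, hz.2.trans hty⟩, hzs, hzd⟩

theorem seq_lt (x : ℕ → ℝ) (N : ℕ) (hinc : ∀ i, i + 1 < N → x i < x (i + 1)) :
    ∀ i j, i < j → j < N → x i < x j := by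
  intro i j hij
  induction j with
  | zero => omega
  | succ j ih =>
    intro hj
    rcases Nat.lt_succ_iff_lt_or_eq.mp hij with h | h
    · exact (ih h (by omega)).trans (hinc j hj)
    · subst h; exact hinc i hj

theorem seq_le (x : ℕ → ℝ) (N : ℕ) (hinc : ∀ i, i + 1 < N → x i < x (i + 1)) :
    ∀ i j, i ≤ j → j < N → x i ≤ x j := by
  intro i j hij hj
  rcases Nat.lt_or_eq_of_le hij with h | h
  · exact (seq_lt x N hinc i j h hj).le
  · rw [h]

theorem step_rolle (h d : ℝ → ℝ) (s : Finset ℝ) (p q e : ℝ) (he : e ≠ 0)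
    (hc : ContinuousOn h (Icc p q))
    (hd : ∀ t ∈ Ioo p q, t ∉ s → HasDerivAt h (d t) t)
    (l ρ N : ℕ) (hl : l ≤ 1) (hρ : ρ ≤ 1) (hN : 1 ≤ N)
    (zl : l = 1 → h p = 0) (zr : ρ = 1 → h q = 0) (x : ℕ → ℝ)
    (hmem : ∀ i < N, x i ∈ Icc p q) (hinc : ∀ i, i + 1 < N → x i < x (i + 1))
    (hpx : l = 1 → p < x 0) (hqx : ρ = 1 → x (N - 1) < q)
    (hs : ∀ i < N, 0 ≤ e * (-1) ^ i * h (x i))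
    (hC : (∀ i < N, h (x i) ≠ 0) ∨
      ∀ a b, p ≤ a → a < b → b ≤ q → ∃ t ∈ Icc a b, h t ≠ 0) :
    ∃ z : ℕ → ℝ, (∀ i, i + 1 < N + l + ρ → z i ∈ Ioo p q ∧ z i ∉ s ∧
      0 < e * (-1) ^ (l + 1) * (-1) ^ i * d (z i)) ∧
      ∀ i, i + 2 < N + l + ρ → z i < z (i + 1) := by
  set y : ℕ → ℝ := fun i => if i < l then p else if i < l + N then x (i - l) else q with hy
  have hpq : p ≤ q := (hmem 0 (by omega)).1.trans (hmem 0 (by omega)).2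
  have ymem : ∀ i, y i ∈ Icc p q := by
    intro i
    simp only [hy]
    split_ifs with h1 h2
    · exact ⟨le_rfl, hpq⟩
    · exact hmem _ (by omega)
    · exact ⟨hpq, le_rfl⟩
  have yinc : ∀ i, i + 1 < N + l + ρ → y i < y (i + 1) := by
    intro i hi
    simp only [hy]
    by_cases h1 : i < l
    · have h2 : ¬ (i + 1 < l) := by omega
      have h3 : i + 1 < l + N := by omega
      have h4 : i + 1 - l = 0 := by omega
      rw [if_pos h1, if_neg h2, if_pos h3, h4]
      exact hpx (by omega)
    · have h2 : ¬ (i + 1 < l) := by omega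
      rw [if_neg h1, if_neg h2]
      by_cases h3 : i + 1 < l + N
      · rw [if_pos (by omega), if_pos h3]
        have := hinc (i - l) (by omega)
        rwa [show i - l + 1 = i + 1 - l by omega] at this
      · rw [if_pos (by omega), if_neg h3, show i - l = N - 1 by omega]
        exact hqx (by omega)
  have ysign : ∀ i, i < N + l + ρ → 0 ≤ e * (-1) ^ l * (-1) ^ i * h (y i) := by
    intro i hi
    simp only [hy]
    by_cases h1 : i < l
    · rw [if_pos h1, zl (by omega)]; simp
    · rw [if_neg h1]
      by_cases h2 : i < l + N
      · rw [if_pos h2]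
        obtain ⟨j, rfl⟩ : ∃ j, i = l + j := ⟨i - l, by omega⟩
        have := hs j (by omega)
        rw [show l + j - l = j by omega]
        have h5 : ((-1:ℝ)) ^ l * (-1) ^ l = 1 := by rw [← mul_pow]; norm_num
        calc (0:ℝ) ≤ e * (-1) ^ j * h (x j) := this
          _ = e * ((-1) ^ l * (-1) ^ l) * (-1) ^ j * h (x j) := by rw [h5]; ring
          _ = _ := by rw [pow_add]; ring
      · rw [if_neg h2, zr (by omega)]; simp
  have ynz : ∀ i, i + 1 < N + l + ρ → ∃ t ∈ Icc (y i) (y (i + 1)), h t ≠ 0 := by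
    intro i hi
    rcases hC with hC | hC
    · by_cases h1 : i < l
      · refine ⟨y (i + 1), ⟨(yinc i hi).le, le_rfl⟩, ?_⟩
        simp only [hy]
        rw [if_neg (by omega), if_pos (by omega)]
        exact hC _ (by omega)
      · refine ⟨y i, ⟨le_rfl, (yinc i hi).le⟩, ?_⟩
        simp only [hy]
        rw [if_neg (by omega), if_pos (by omega)]
        exact hC _ (by omega)
    · exact hC _ _ (ymem i).1 (yinc i hi) (ymem (i + 1)).2
  have ex : ∀ i, ∃ z, i + 1 < N + l + ρ → z ∈ Ioo (y i) (y (i + 1)) ∧ z ∉ s ∧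
      0 < e * (-1) ^ (l + 1) * (-1) ^ i * d z := by
    intro i
    by_cases hi : i + 1 < N + l + ρ
    · obtain ⟨z, hz, hzs, hzd⟩ := mvt_weak h d s (e * (-1) ^ (l + 1) * (-1) ^ i) (y i) (y (i + 1))
        (yinc i hi) (by simp [he]) (hc.mono (Icc_subset_Icc (ymem i).1 (ymem (i + 1)).2))
        (fun t ht => hd t ⟨(ymem i).1.trans_lt ht.1, ht.2.trans_le (ymem (i + 1)).2⟩)
        (by have := ysign i (by omega); rw [pow_succ]; linarith)
        (by have := ysign (i + 1) (by omega); rw [pow_succ] at this ⊢; linarith) (ynz i hi)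
      exact ⟨z, fun _ => ⟨hz, hzs, hzd⟩⟩
    · exact ⟨0, fun h => absurd h hi⟩
  choose z hz using ex
  refine ⟨z, fun i hi => ?_, fun i hi => ?_⟩
  · obtain ⟨h1, h2, h3⟩ := hz i hi
    exact ⟨⟨(ymem i).1.trans_lt h1.1, h1.2.trans_le (ymem (i + 1)).2⟩, h2, h3⟩
  · exact (hz i (by omega)).1.2.trans (hz (i + 1) (by omega)).1.1

theorem iter_arith (K N k l ρ : ℕ) (hl : l ≤ 1) (hρ : ρ ≤ 1) (hN : 1 ≤ N) (hK : 1 ≤ K)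
    (h : K + (k + 1) = N + (k + 1) * (l + ρ)) :
    1 ≤ K + 1 - (l + ρ) ∧ K + 1 - (l + ρ) + k = N + k * (l + ρ) := by
  have h1 : l = 0 ∨ l = 1 := by omega
  have h2 : ρ = 0 ∨ ρ = 1 := by omega
  rcases h1 with rfl | rfl <;> rcases h2 with rfl | rfl <;> omega

theorem iter_rolle (D : ℕ → ℝ → ℝ) (s : Finset ℝ) (p q e : ℝ) (he : e ≠ 0) (r : ℕ)
    (hc : ∀ k < r, ContinuousOn (D k) (Icc p q))
    (hd : ∀ k < r, ∀ t ∈ Ioo p q, t ∉ s → HasDerivAt (D k) (D (k + 1) t) t)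
    (l ρ N : ℕ) (hl : l ≤ 1) (hρ : ρ ≤ 1) (hN : 1 ≤ N)
    (zl : l = 1 → ∀ k < r, D k p = 0) (zr : ρ = 1 → ∀ k < r, D k q = 0) (x : ℕ → ℝ)
    (hmem : ∀ i < N, x i ∈ Icc p q) (hinc : ∀ i, i + 1 < N → x i < x (i + 1))
    (hpx : l = 1 → p < x 0) (hqx : ρ = 1 → x (N - 1) < q)
    (hs : ∀ i < N, 0 ≤ e * (-1) ^ i * D 0 (x i))
    (hC : (∀ i < N, D 0 (x i) ≠ 0) ∨
      ∀ a b, p ≤ a → a < b → b ≤ q → ∃ t ∈ Icc a b, D 0 t ≠ 0) :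
    ∀ k, 1 ≤ k → k ≤ r → ∀ K, 1 ≤ K → K + k = N + k * (l + ρ) →
    ∃ z : ℕ → ℝ, (∀ i < K, z i ∈ Ioo p q ∧ z i ∉ s ∧
      0 < e * (-1) ^ (k * (l + 1)) * (-1) ^ i * D k (z i)) ∧
      ∀ i, i + 1 < K → z i < z (i + 1) := by
  intro k hk
  induction k, hk using Nat.le_induction with
  | base =>
    intro hr K hK hKe
    obtain ⟨z, h1, h2⟩ := step_rolle (D 0) (D 1) s p q e he (hc 0 (by omega)) (hd 0 (by omega))
      l ρ N hl hρ hN (fun h => zl h 0 (by omega)) (fun h => zr h 0 (by omega)) x hmem hinc hpx hqx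
      hs hC
    refine ⟨z, fun i hi => ?_, fun i hi => h2 i (by omega)⟩
    have := h1 i (by omega)
    simpa using this
  | succ k hk ih =>
    intro hr K hK hKe
    obtain ⟨hK1, hK2⟩ := iter_arith K N k l ρ hl hρ hN hK hKe
    obtain ⟨x', h1, h2⟩ := ih (by omega) (K + 1 - (l + ρ)) hK1 hK2
    obtain ⟨z, h3, h4⟩ := step_rolle (D k) (D (k + 1)) s p q (e * (-1) ^ (k * (l + 1)))
      (by simp [he]) (hc k (by omega)) (hd k (by omega))
      l ρ (K + 1 - (l + ρ)) hl hρ hK1 (fun h => zl h k (by omega)) (fun h => zr h k (by omega)) x'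
      (fun i hi => ⟨(h1 i hi).1.1.le, (h1 i hi).1.2.le⟩) h2 (fun _ => (h1 0 (by omega)).1.1)
      (fun _ => (h1 _ (by omega)).1.2) (fun i hi => (h1 i hi).2.2.le)
      (Or.inl (fun i hi h0 => by have := (h1 i hi).2.2; rw [h0] at this; simp at this))
    refine ⟨z, fun i hi => ?_, fun i hi => h4 i (by omega)⟩
    have := h3 i (by omega)
    rw [show (k + 1) * (l + 1) = k * (l + 1) + (l + 1) by ring, pow_add, ← mul_assoc]
    exact this

noncomputable def cnt (U : Finset ℝ) (t : ℝ) : ℕ := (U.filter (fun u => u < t)).card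
noncomputable def cntle (U : Finset ℝ) (t : ℝ) : ℕ := (U.filter (fun u => u ≤ t)).card

structure Chain (r : ℕ) (A : ℝ) (s : Finset ℝ) (D : ℕ → ℝ → ℝ) : Prop where
  cont : ∀ k < r, ContinuousOn (D k) (Icc 0 A)
  der : ∀ k < r, ∀ t ∈ Ioo 0 A, t ∉ s → HasDerivAt (D k) (D (k + 1) t) t

structure Spl_s2 (g : ℝ → ℝ) (r : ℕ) (A : ℝ) (U s : Finset ℝ) (F : ℕ → ℝ → ℝ) : Prop where
  ch : Chain r A s F
  top : ∀ t, F r t = (-1) ^ (cnt U t) * g t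
  pos : ∀ u ∈ U, 0 < u
  sub : U ⊆ s

theorem cnt_mono (U : Finset ℝ) {x y : ℝ} (h : x ≤ y) : cnt U x ≤ cnt U y :=
  Finset.card_le_card (fun u hu => by
    simp only [Finset.mem_filter] at hu ⊢; exact ⟨hu.1, hu.2.trans_le h⟩)

theorem cnt_le_card (U : Finset ℝ) (x : ℝ) : cnt U x ≤ U.card :=
  Finset.card_le_card (Finset.filter_subset _ _)

theorem cnt_le_cntle (U : Finset ℝ) (x : ℝ) : cnt U x ≤ cntle U x :=
  Finset.card_le_card (fun u hu => by
    simp only [Finset.mem_filter] at hu ⊢; exact ⟨hu.1, hu.2.le⟩)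

theorem cntle_le_cnt (U : Finset ℝ) {x y : ℝ} (h : x < y) : cntle U x ≤ cnt U y :=
  Finset.card_le_card (fun u hu => by
    simp only [Finset.mem_filter] at hu ⊢; exact ⟨hu.1, hu.2.trans_lt h⟩)

theorem cntle_le_card (U : Finset ℝ) (x : ℝ) : cntle U x ≤ U.card :=
  Finset.card_le_card (Finset.filter_subset _ _)

theorem cntle_eq_cnt (U : Finset ℝ) (x : ℝ) (h : x ∉ U) : cntle U x = cnt U x := by
  unfold cntle cnt
  congr 1
  apply Finset.filter_congr
  intro u hu
  exact ⟨fun h' => lt_of_le_of_ne h' (fun e => h (e ▸ hu)), le_of_lt⟩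

theorem cntle_eq_cnt_succ (U : Finset ℝ) (x : ℝ) (h : x ∈ U) : cntle U x = cnt U x + 1 := by
  unfold cntle cnt
  have : U.filter (fun u => u ≤ x) = insert x (U.filter (fun u => u < x)) := by
    ext u
    simp only [Finset.mem_filter, Finset.mem_insert]
    constructor
    · rintro ⟨h1, h2⟩
      rcases h2.lt_or_eq with h3 | h3
      · exact Or.inr ⟨h1, h3⟩
      · exact Or.inl h3
    · rintro (rfl | ⟨h1, h2⟩)
      · exact ⟨h, le_rfl⟩
      · exact ⟨h1, h2.le⟩
  rw [this, Finset.card_insert_of_notMem (by simp)]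

theorem gap (S : Finset ℝ) (w : ℝ) : ∃ η > 0, ∀ u ∈ S, u ≠ w → η ≤ |u - w| := by
  induction S using Finset.induction with
  | empty => exact ⟨1, one_pos, by simp⟩
  | insert v S hv ih =>
    obtain ⟨η, h0, h⟩ := ih
    by_cases hvw : v = w
    · refine ⟨η, h0, fun u hu hne => ?_⟩
      rcases Finset.mem_insert.mp hu with rfl | hu
      · exact absurd hvw hne
      · exact h u hu hne
    · refine ⟨min η |v - w|, lt_min h0 (abs_pos.mpr (sub_ne_zero.mpr hvw)), fun u hu hne => ?_⟩
      rcases Finset.mem_insert.mp hu with rfl | hu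
      · exact min_le_right _ _
      · exact (min_le_left _ _).trans (h u hu hne)

theorem cnt_left (U : Finset ℝ) (w η : ℝ) (h : ∀ u ∈ U, u ≠ w → η ≤ |u - w|) (t : ℝ)
    (ht : t ∈ Ioo (w - η) w) : cnt U t = cnt U w ∧ t ∉ U := by
  refine ⟨?_, fun hu => ?_⟩
  · unfold cnt
    congr 1
    apply Finset.filter_congr
    intro u hu
    refine ⟨fun h' => h'.trans ht.2, fun h' => ?_⟩
    have := h u hu h'.ne
    rw [abs_of_neg (by linarith)] at this
    linarith [ht.1]
  · have := h t hu ht.2.ne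
    rw [abs_of_neg (by linarith [ht.2])] at this
    linarith [ht.1]

theorem cnt_right (U : Finset ℝ) (w η : ℝ) (h : ∀ u ∈ U, u ≠ w → η ≤ |u - w|) (t : ℝ)
    (ht : t ∈ Ioo w (w + η)) : cnt U t = cntle U w ∧ t ∉ U := by
  refine ⟨?_, fun hu => ?_⟩
  · unfold cnt cntle
    congr 1
    apply Finset.filter_congr
    intro u hu
    refine ⟨fun h' => ?_, fun h' => h'.trans_lt ht.1⟩
    by_contra hcon
    push Not at hcon
    have := h u hu hcon.ne'
    rw [abs_of_pos (by linarith)] at this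
    linarith [ht.2]
  · have := h t hu ht.1.ne'
    rw [abs_of_pos (by linarith [ht.1])] at this
    linarith [ht.2]

theorem Chain.mono {r : ℕ} {A A' : ℝ} {s : Finset ℝ} {D : ℕ → ℝ → ℝ} (h : Chain r A s D)
    (hA : A' ≤ A) : Chain r A' s D :=
  ⟨fun k hk => (h.cont k hk).mono (Icc_subset_Icc_right hA),
   fun k hk t ht => h.der k hk t ⟨ht.1, ht.2.trans_le hA⟩⟩

theorem Chain.sub {r : ℕ} {A : ℝ} {s s' : Finset ℝ} {D D' : ℕ → ℝ → ℝ} (h : Chain r A s D)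
    (h' : Chain r A s' D') : Chain r A (s ∪ s') (fun k t => D k t - D' k t) :=
  ⟨fun k hk => (h.cont k hk).sub (h'.cont k hk),
   fun k hk t ht hs => (h.der k hk t ht (fun h1 => hs (Finset.mem_union_left _ h1))).sub
     (h'.der k hk t ht (fun h1 => hs (Finset.mem_union_right _ h1)))⟩

theorem Spl_s2.mono {g : ℝ → ℝ} {r : ℕ} {A A' : ℝ} {U s : Finset ℝ} {F : ℕ → ℝ → ℝ}
    (h : Spl_s2 g r A U s F) (hA : A' ≤ A) : Spl_s2 g r A' U s F :=
  ⟨h.ch.mono hA, h.top, h.pos, h.sub⟩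

theorem sub_closure (s : Finset ℝ) (x y : ℝ) (hxy : x < y) :
    Icc x y ⊆ closure (Ioo x y ∩ {t | t ∉ s}) := by
  have hd : Dense ({t : ℝ | t ∉ s}) := by
    have := (dense_univ (X := ℝ)).sdiff_finset s
    convert this using 1
    ext t; simp
  have h1 := hd.open_subset_closure_inter (isOpen_Ioo (a := x) (b := y))
  rw [← closure_Ioo hxy.ne]
  exact closure_minimal h1 isClosed_closure

theorem Chain.vanish {r : ℕ} {A : ℝ} {s : Finset ℝ} {D : ℕ → ℝ → ℝ} (h : Chain r A s D)
    {x y : ℝ} (hx : 0 ≤ x) (hxy : x < y) (hy : y ≤ A) (h0 : ∀ t ∈ Ioo x y, D 0 t = 0) :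
    ∀ k ≤ r, ∀ t ∈ Ioo x y, t ∉ s → D k t = 0 := by
  intro k
  induction k with
  | zero => intro _ t ht _; exact h0 t ht
  | succ k ih =>
    intro hk t ht hts
    have hd := h.der k (by omega) t ⟨hx.trans_lt ht.1, ht.2.trans_le hy⟩ hts
    have ho : IsOpen (Ioo x y ∩ {t | t ∉ s}) :=
      isOpen_Ioo.inter (s.finite_toSet.isClosed.isOpen_compl)
    have he : D k =ᶠ[𝓝 t] fun _ => 0 := by
      filter_upwards [ho.mem_nhds ⟨ht, hts⟩] with w hw
      exact ih (by omega) w hw.1 hw.2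
    exact hd.unique ((hasDerivAt_const t (0:ℝ)).congr_of_eventuallyEq he)

theorem Chain.vanish_closed {r : ℕ} {A : ℝ} {s : Finset ℝ} {D : ℕ → ℝ → ℝ} (h : Chain r A s D)
    {x y : ℝ} (hx : 0 ≤ x) (hxy : x < y) (hy : y ≤ A) (h0 : ∀ t ∈ Ioo x y, D 0 t = 0) :
    ∀ k < r, ∀ t ∈ Icc x y, D k t = 0 := by
  intro k hk
  have : EqOn (D k) (fun _ => 0) (Icc x y) := by
    refine Set.EqOn.of_subset_closure (s := Ioo x y ∩ {t | t ∉ s}) (fun t ht => ?_)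
      ((h.cont k hk).mono (Icc_subset_Icc hx hy)) continuousOn_const
      (fun t ht => ⟨ht.1.1.le, ht.1.2.le⟩) (sub_closure s x y hxy)
    exact h.vanish hx hxy hy h0 k hk.le t ht.1 ht.2
  exact this

theorem const_of_zero (h d : ℝ → ℝ) (s : Finset ℝ) (x y : ℝ) (hc : ContinuousOn h (Icc x y))
    (hd : ∀ t ∈ Ioo x y, t ∉ s → HasDerivAt h (d t) t) (hz : ∀ t ∈ Ioo x y, t ∉ s → d t = 0) :
    ∀ t ∈ Icc x y, ∀ t' ∈ Icc x y, t < t' → h t = h t' := by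
  intro t ht t' ht' htt
  by_contra hne
  have key : ∀ e : ℝ, ¬ (e * h t < e * h t') := by
    intro e he
    obtain ⟨z, hz1, hz2, hz3⟩ := mvt_sign h d s e t t' htt (hc.mono (Icc_subset_Icc ht.1 ht'.2))
      (fun w hw => hd w ⟨ht.1.trans_lt hw.1, hw.2.trans_le ht'.2⟩) he
    rw [hz z ⟨ht.1.trans_lt hz1.1, hz1.2.trans_le ht'.2⟩ hz2] at hz3
    simp at hz3
  have h1 := key 1
  have h2 := key (-1)
  apply hne
  linarith

theorem Chain.vanish_down {r : ℕ} {A : ℝ} {s : Finset ℝ} {D : ℕ → ℝ → ℝ} (h : Chain r A s D)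
    {x y : ℝ} (hx : 0 ≤ x) (hy : y ≤ A) (hr : 1 ≤ r)
    (h0 : ∀ t ∈ Ioo x y, t ∉ s → D r t = 0) (z : ℝ) (hz : z ∈ Icc x y)
    (hz0 : ∀ k < r, D k z = 0) : ∀ t ∈ Icc x y, D 0 t = 0 := by
  have key : ∀ j, j < r → ∀ t ∈ Icc x y, D (r - 1 - j) t = 0 := by
    intro j
    induction j with
    | zero =>
      intro hj t ht
      have hc := const_of_zero (D (r - 1)) (D r) s x y
        ((h.cont (r - 1) (by omega)).mono (Icc_subset_Icc hx hy))
        (fun t ht hts => by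
          have := h.der (r - 1) (by omega) t ⟨hx.trans_lt ht.1, ht.2.trans_le hy⟩ hts
          rwa [show r - 1 + 1 = r by omega] at this) h0
      rw [Nat.sub_zero]
      have h3 := hz0 (r - 1) (by omega)
      rcases lt_trichotomy t z with h1 | h1 | h1
      · rw [hc t ht z hz h1, h3]
      · rw [h1, h3]
      · rw [← hc z hz t ht h1, h3]
    | succ j ih =>
      intro hj t ht
      have hc := const_of_zero (D (r - 1 - (j + 1))) (D (r - 1 - j)) s x y
        ((h.cont _ (by omega)).mono (Icc_subset_Icc hx hy))
        (fun t ht hts => by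
          have := h.der (r - 1 - (j + 1)) (by omega) t ⟨hx.trans_lt ht.1, ht.2.trans_le hy⟩ hts
          rwa [show r - 1 - (j + 1) + 1 = r - 1 - j by omega] at this)
        (fun t ht _ => ih (by omega) t ⟨ht.1.le, ht.2.le⟩)
      have h3 := hz0 (r - 1 - (j + 1)) (by omega)
      rcases lt_trichotomy t z with h1 | h1 | h1
      · rw [hc t ht z hz h1, h3]
      · rw [h1, h3]
      · rw [← hc z hz t ht h1, h3]
  intro t ht
  have := key (r - 1) (by omega) t ht
  rwa [Nat.sub_self] at this

theorem grow (κ : ℕ → ℕ) (N K : ℕ) (h0 : K ≤ κ 0) (hm : ∀ i, i + 1 < N → κ i ≤ κ (i + 1))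
    (par : ∀ i < N, (-1:ℝ) ^ κ i = (-1) ^ (K + i)) : ∀ i < N, K + i ≤ κ i := by
  intro i
  induction i with
  | zero => intro _; exact h0
  | succ i ih =>
    intro hi
    have h1 := ih (by omega)
    have h2 := hm i hi
    have h3 : κ (i + 1) ≠ K + i := by
      intro he
      have := par (i + 1) hi
      rw [he, ← add_assoc, pow_succ] at this
      have h4 : ((-1:ℝ)) ^ (K + i) ≠ 0 := by simp
      apply h4; linarith
    omega

theorem sgnA (K i κ : ℕ) (g : ℝ) (hg : 0 < g) (h : 0 < (-1:ℝ) ^ K * (-1) ^ i * ((-1) ^ κ * g)) :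
    (-1:ℝ) ^ κ = (-1) ^ (K + i) := by
  rw [pow_add]
  rcases neg_one_pow_eq_or ℝ κ with h1 | h1 <;> rcases neg_one_pow_eq_or ℝ K with h2 | h2 <;>
    rcases neg_one_pow_eq_or ℝ i with h3 | h3 <;> rw [h1, h2, h3] at h <;> rw [h1, h2, h3] <;>
    linarith

theorem sgnB (K i κ κ' : ℕ) (g : ℝ) (hg : 0 < g)
    (h : 0 < (-1:ℝ) ^ K * (-1) ^ i * ((-1) ^ κ * g - (-1) ^ κ' * g)) :
    (-1:ℝ) ^ κ' = (-1) ^ (K + 1 + i) := by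
  rw [pow_add, pow_succ]
  rcases neg_one_pow_eq_or ℝ κ with h1 | h1 <;> rcases neg_one_pow_eq_or ℝ K with h2 | h2 <;>
    rcases neg_one_pow_eq_or ℝ i with h3 | h3 <;> rcases neg_one_pow_eq_or ℝ κ' with h4 | h4 <;>
    rw [h1, h2, h3, h4] at h <;> rw [h2, h3, h4] <;>
    linarith

/-- single spline alternation count -/
theorem count1 {g : ℝ → ℝ} {r : ℕ} {A : ℝ} {U s : Finset ℝ} {F : ℕ → ℝ → ℝ}
    (hF : Spl_s2 g r A U s F) (hg : ∀ t ∈ Ici (0:ℝ), 0 < g t) (K k0 : ℕ) (z : ℕ → ℝ) (hK : 1 ≤ K)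
    (hz0 : ∀ i < K, 0 ≤ z i)
    (hz : ∀ i < K, 0 < (-1:ℝ) ^ k0 * (-1) ^ i * F r (z i))
    (hinc : ∀ i, i + 1 < K → z i < z (i + 1)) (h0 : k0 ≤ cnt U (z 0)) :
    k0 + (K - 1) ≤ cnt U (z (K - 1)) := by
  refine grow (fun i => cnt U (z i)) K k0 h0 (fun i hi => cnt_mono U (hinc i hi).le)
    (fun i hi => ?_) (K - 1) (by omega)
  have := hz i hi
  rw [hF.top] at this
  exact sgnA k0 i _ _ (hg _ (hz0 i hi)) this

/-- difference alternation count -/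
theorem count2 {g : ℝ → ℝ} {r : ℕ} {A A' : ℝ} {U s V s' : Finset ℝ} {F F' : ℕ → ℝ → ℝ}
    (hF : Spl_s2 g r A U s F) (hF' : Spl_s2 g r A' V s' F')
    (hg : ∀ t ∈ Ici (0:ℝ), 0 < g t) (K k0 : ℕ) (z : ℕ → ℝ) (hK : 1 ≤ K)
    (hz0 : ∀ i < K, 0 ≤ z i)
    (hz : ∀ i < K, 0 < (-1:ℝ) ^ k0 * (-1) ^ i * (F r (z i) - F' r (z i)))
    (hinc : ∀ i, i + 1 < K → z i < z (i + 1)) (h0 : k0 ≤ cnt V (z 0)) :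
    k0 + K ≤ cnt V (z (K - 1)) := by
  have par : ∀ i < K, (-1:ℝ) ^ cnt V (z i) = (-1) ^ (k0 + 1 + i) := by
    intro i hi
    have := hz i hi
    rw [hF.top, hF'.top] at this
    exact sgnB k0 i _ _ _ (hg _ (hz0 i hi)) this
  have h1 : k0 + 1 ≤ cnt V (z 0) := by
    have hne : cnt V (z 0) ≠ k0 := by
      intro he
      have := par 0 (by omega)
      rw [he, add_zero, pow_succ] at this
      have h4 : ((-1:ℝ)) ^ k0 ≠ 0 := by simp
      apply h4; linarith
    omega
  have := grow (fun i => cnt V (z i)) K (k0 + 1) h1 (fun i hi => cnt_mono V (hinc i hi).le)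
    par (K - 1) (by omega)
  omega

theorem nhds_congr_iter (G : ℝ → ℝ) (k : ℕ) (S T : Set ℝ) (t : ℝ) (hS : S ∈ 𝓝 t) (hT : T ∈ 𝓝 t) :
    iteratedDerivWithin k G S t = iteratedDerivWithin k G T t := by
  have h : S =ᶠ[𝓝 t] T := by
    filter_upwards [hS, hT] with w h1 h2
    exact propext ⟨fun _ => h2, fun _ => h1⟩
  rw [iteratedDerivWithin, iteratedDerivWithin, iteratedFDerivWithin_congr_set h]

theorem spl_build (g : ℝ → ℝ) (r : ℕ) (hr : 1 ≤ r) (a : ℝ) (m : ℕ) (u : ℕ → ℝ) (ε : ℝ)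
    (G : ℝ → ℝ) (h : PerfectSplineWith g r a m u ε G) :
    ∃ (U : Finset ℝ) (F : ℕ → ℝ → ℝ), U.card ≤ m ∧ (∀ v ∈ U, 0 < v) ∧ Chain r a U F ∧
      F 0 = G ∧ ∀ t, F r t = ε * ((-1) ^ cnt U t * g t) := by
  obtain ⟨-, hu0, hum, hinc, hG, hGi⟩ := h
  have hlt := seq_lt u (m + 2) (fun i hi => hinc i (by omega))
  have hle := seq_le u (m + 2) (fun i hi => hinc i (by omega))
  have ha : 0 < a := by
    have := hlt 0 (m + 1) (by omega) (by omega)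
    rwa [hu0, hum] at this
  have hud := uniqueDiffOn_Icc ha
  set U := (Finset.Icc 1 m).image u with hU
  have hcnt : ∀ i ≤ m, ∀ t ∈ Ioo (u i) (u (i + 1)), cnt U t = i := by
    intro i hi t ht
    have h1 : U.filter (fun v => v < t) = (Finset.Icc 1 i).image u := by
      ext v
      simp only [hU, Finset.mem_filter, Finset.mem_image, Finset.mem_Icc]
      constructor
      · rintro ⟨⟨j, ⟨hj1, hj2⟩, rfl⟩, hv⟩
        refine ⟨j, ⟨hj1, ?_⟩, rfl⟩
        by_contra hcon
        have := hle (i + 1) j (by omega) (by omega)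
        linarith [ht.2]
      · rintro ⟨j, ⟨hj1, hj2⟩, rfl⟩
        exact ⟨⟨j, ⟨hj1, by omega⟩, rfl⟩, (hle j i hj2 (by omega)).trans_lt ht.1⟩
    unfold cnt
    rw [h1, Finset.card_image_of_injOn]
    · simp
    · intro j hj j' hj' he
      simp only [Finset.coe_Icc, mem_Icc] at hj hj'
      rcases lt_trichotomy j j' with h3 | h3 | h3
      · have := hlt j j' h3 (by omega); rw [he] at this; exact absurd this (lt_irrefl _)
      · exact h3
      · have := hlt j' j h3 (by omega); rw [he] at this; exact absurd this (lt_irrefl _)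
  have hloc : ∀ t ∈ Ioo 0 a, t ∉ U → ∃ i ≤ m, t ∈ Ioo (u i) (u (i + 1)) := by
    intro t ht htU
    have : ∀ i ≤ m + 1, t < u i → ∃ i ≤ m, t ∈ Ioo (u i) (u (i + 1)) := by
      intro i
      induction i with
      | zero => intro _ h; rw [hu0] at h; exact absurd h (not_lt.mpr ht.1.le)
      | succ i ih =>
        intro hi h
        rcases lt_trichotomy t (u i) with h1 | h1 | h1
        · exact ih (by omega) h1
        · exfalso
          rcases Nat.eq_zero_or_pos i with h0 | h0
          · rw [h0, hu0] at h1; exact ht.1.ne' h1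
          · exact htU (Finset.mem_image.mpr ⟨i, Finset.mem_Icc.mpr ⟨h0, by omega⟩, h1.symm⟩)
        · exact ⟨i, by omega, h1, h⟩
    exact this (m + 1) le_rfl (by rw [hum]; exact ht.2)
  refine ⟨U, fun k t => if k = r then ε * ((-1) ^ cnt U t * g t) else
    iteratedDerivWithin k G (Icc 0 a) t, ?_, ?_, ⟨?_, ?_⟩, ?_, ?_⟩
  · exact Finset.card_image_le.trans (by simp)
  · intro v hv
    obtain ⟨j, hj, rfl⟩ := Finset.mem_image.mp hv
    rw [Finset.mem_Icc] at hj
    have := hlt 0 j (by omega) (by omega)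
    rwa [hu0] at this
  · intro k hk
    simp only [hk.ne, if_false]
    exact hG.continuousOn_iteratedDerivWithin (by norm_cast; omega) hud
  · intro k hk t ht hts
    have hIcc : Icc 0 a ∈ 𝓝 t := Icc_mem_nhds ht.1 ht.2
    simp only [hk.ne, if_false]
    by_cases hk1 : k + 1 = r
    · simp only [hk1, if_true]
      obtain ⟨i, hi, hti⟩ := hloc t ht hts
      have hI : Ioo (u i) (u (i + 1)) ∈ 𝓝 t := Ioo_mem_nhds hti.1 hti.2
      rw [hcnt i hi t hti, ← mul_assoc, ← (hGi i hi).2 t hti, ← hk1, iteratedDerivWithin_succ]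
      have hd := ((hGi i hi).1.differentiableOn_iteratedDerivWithin (m := k)
        (by norm_cast) isOpen_Ioo.uniqueDiffOn t hti).hasDerivWithinAt.hasDerivAt hI
      refine hd.congr_of_eventuallyEq ?_
      filter_upwards [isOpen_Ioo.mem_nhds hti, isOpen_Ioo.mem_nhds ht] with w hw hw'
      exact nhds_congr_iter G k _ _ w (Icc_mem_nhds hw'.1 hw'.2) (Ioo_mem_nhds hw.1 hw.2)
    · simp only [hk1, if_false]
      rw [iteratedDerivWithin_succ]
      exact (hG.differentiableOn_iteratedDerivWithin (m := k)
        (by norm_cast; omega) hud t ⟨ht.1.le, ht.2.le⟩).hasDerivWithinAt.hasDerivAt hIcc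
  · have : (0:ℕ) ≠ r := by omega
    simp only [this, if_false]
    exact iteratedDerivWithin_zero
  · intro t; simp

structure ExtS (f g : ℝ → ℝ) (r n : ℕ) (a M : ℝ) (U s : Finset ℝ) (F : ℕ → ℝ → ℝ)
    (x : ℕ → ℝ) : Prop where
  spl : Spl_s2 g r a U s F
  card : U.card ≤ n
  Mpos : 0 < M
  bd : ∀ t ∈ Icc 0 a, |F 0 t| ≤ M * f t
  x0 : 0 ≤ x 0
  xl : x (n + r) = a
  inc : ∀ i, i + 1 < n + r + 1 → x i < x (i + 1)
  val : ∀ i < n + r + 1, F 0 (x i) = (-1) ^ r * (-1) ^ i * (M * f (x i))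

theorem ExtS.mem {f g : ℝ → ℝ} {r n : ℕ} {a M : ℝ} {U s : Finset ℝ} {F : ℕ → ℝ → ℝ}
    {x : ℕ → ℝ} (h : ExtS f g r n a M U s F x) : ∀ i < n + r + 1, x i ∈ Icc 0 a := by
  intro i hi
  have hle := seq_le x _ h.inc
  exact ⟨h.x0.trans (hle 0 i (by omega) hi), by rw [← h.xl]; exact hle i _ (by omega) (by omega)⟩

theorem sq_pow (k : ℕ) : ((-1:ℝ)) ^ k * (-1) ^ k = 1 := by
  rw [← mul_pow]; simp

theorem ext_of (f g : ℝ → ℝ) (hf_c : ContinuousOn f (Ici 0)) (hf_pos : ∀ t ∈ Ici (0:ℝ), 0 < f t)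
    (hg_pos : ∀ t ∈ Ici (0:ℝ), 0 < g t) (r : ℕ) (hr : 1 ≤ r) (n : ℕ) (a : ℝ) (ha : 0 < a)
    (G : ℝ → ℝ) (hE : IsExtremalSpline f g r n a G) :
    ∃ U s F x, ExtS f g r n a (wNorm G f (Icc 0 a)) U s F x := by
  obtain ⟨⟨m, hm, u, ε, hP⟩, b, hb0, hba, hbi, hbv⟩ := hE
  obtain ⟨U, F, hUc, hUp, hch, hF0, hFr⟩ := spl_build g r hr a m u ε G hP
  have hGc : ContinuousOn G (Icc 0 a) := by rw [← hF0]; exact hch.cont 0 (by omega)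
  have hε := hP.1
  set M := wNorm G f (Icc 0 a) with hM
  have hq : ContinuousOn (fun t => |G t| / f t) (Icc 0 a) :=
    hGc.abs.div (hf_c.mono Icc_subset_Ici_self) (fun t ht => (hf_pos t ht.1).ne')
  have hbdd : BddAbove ((fun t => |G t| / f t) '' Icc 0 a) := isCompact_Icc.bddAbove_image hq
  have hbd : ∀ t ∈ Icc 0 a, |G t| ≤ M * f t := by
    intro t ht
    have := le_csSup hbdd (mem_image_of_mem _ ht)
    rw [div_le_iff₀ (hf_pos t ht.1)] at this
    exact this
  have hM0 : 0 ≤ M := by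
    have := le_csSup hbdd (mem_image_of_mem _ (left_mem_Icc.mpr ha.le))
    exact (div_nonneg (abs_nonneg _) (hf_pos 0 self_mem_Ici).le).trans this
  have hMp : 0 < M := by
    rcases hM0.lt_or_eq with h | h
    · exact h
    exfalso
    have hz : ∀ t ∈ Ioo 0 a, F 0 t = 0 := by
      intro t ht
      have := hbd t ⟨ht.1.le, ht.2.le⟩
      rw [← h, zero_mul] at this
      rw [hF0]; exact abs_nonpos_iff.mp this
    have hv := hch.vanish le_rfl ha le_rfl hz r le_rfl
    have hne : (Ioo 0 a ∩ {t | t ∉ U}).Nonempty := by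
      rw [← closure_nonempty_iff]
      exact ⟨0, sub_closure U 0 a ha (left_mem_Icc.mpr ha.le)⟩
    obtain ⟨t, ht, htU⟩ := hne
    have h1 := hv t ht htU
    rw [hFr] at h1
    have h2 := hg_pos t ht.1.le
    rcases hε with rfl | rfl <;> simp at h1 <;> linarith
  have hbmem : ∀ i < n + r + 1, b (i + 1) ∈ Icc 0 a := by
    intro i hi
    have hle := seq_le (fun i => b (i + 1)) (n + r + 1) (fun i hi => hbi (i + 1) (by omega) (by omega))
    exact ⟨hb0.trans (hle 0 i (by omega) hi), by
      rw [← hba]; exact hle i (n + r) (by omega) (by omega)⟩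
  have hval : ∀ i < n + r + 1, F 0 (b (i + 1)) = (-1) ^ r * (-1) ^ i * (M * f (b (i + 1))) := by
    intro i hi
    rw [hF0, hbv (i + 1) (by omega) (by omega)]
    congr 1
    rw [show i + 1 + r + 1 = r + i + 2 by ring, pow_add, pow_add]; norm_num
  have hε1 : ε = 1 := by
    rcases hε with h | h
    · exact h
    exfalso
    have hS : Spl_s2 g r a U U (fun k t => - F k t) := by
      refine ⟨⟨fun k hk => (hch.cont k hk).neg, fun k hk t ht hts => (hch.der k hk t ht hts).neg⟩,
        fun t => ?_, hUp, le_rfl⟩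
      simp only [hFr t, h]; ring
    have hpos : ∀ i < n + r + 1, 0 < (-1) ^ r * (-1) ^ i * F 0 (b (i + 1)) := by
      intro i hi
      rw [hval i hi]
      have e1 := sq_pow r
      have e2 := sq_pow i
      have : ((-1:ℝ)) ^ r * (-1) ^ i * ((-1) ^ r * (-1) ^ i * (M * f (b (i + 1)))) =
        ((-1) ^ r * (-1) ^ r) * ((-1) ^ i * (-1) ^ i) * (M * f (b (i + 1))) := by ring
      rw [this, e1, e2]
      have := hf_pos _ (hbmem i hi).1
      positivity
    obtain ⟨z, hz, hzi⟩ := iter_rolle F U 0 a ((-1) ^ r) (by simp) r hch.cont hch.der 0 0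
      (n + r + 1) (by omega) (by omega) (by omega) (by simp) (by simp) (fun i => b (i + 1)) hbmem
      (fun i hi => hbi (i + 1) (by omega) (by omega)) (by simp) (by simp) (fun i hi => (hpos i hi).le)
      (Or.inl (fun i hi h0 => by have := hpos i hi; rw [h0] at this; simp at this)) r hr le_rfl
      (n + 1) (by omega) (by ring)
    have hz' : ∀ i < n + 1, 0 < (-1:ℝ) ^ 1 * (-1) ^ i * (fun k t => - F k t) r (z i) := by
      intro i hi
      have := (hz i hi).2.2
      simp only [zero_add, mul_one, sq_pow, one_mul] at this
      simp only; linarith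
    have h0 : 1 ≤ cnt U (z 0) := by
      by_contra hcon
      have h1 : cnt U (z 0) = 0 := by omega
      have h2 := hz' 0 (by omega)
      have h3 := hS.top (z 0)
      rw [h1] at h3
      have h4 := hg_pos _ (hz 0 (by omega)).1.1.le
      simp only [pow_zero, one_mul, pow_one, mul_one] at h2 h3
      linarith
    have := count1 hS hg_pos (n + 1) 1 z (by omega) (fun i hi => (hz i hi).1.1.le) hz' hzi h0
    have := cnt_le_card U (z (n + 1 - 1))
    omega
  refine ⟨U, U, F, fun i => b (i + 1), ⟨⟨hch, ?_, hUp, le_rfl⟩, by omega, hMp, ?_, hb0, hba, ?_, hval⟩⟩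
  · intro t; rw [hFr, hε1, one_mul]
  · rw [hF0]; exact hbd
  · exact fun i hi => hbi (i + 1) (by omega) (by omega)

theorem dvp {g : ℝ → ℝ} {r n : ℕ} {A A' : ℝ} {U s V s' : Finset ℝ} {F F' : ℕ → ℝ → ℝ}
    (hg : ∀ t ∈ Ici (0:ℝ), 0 < g t) (hr : 1 ≤ r)
    (hF : Spl_s2 g r A U s F) (hF' : Spl_s2 g r A' V s' F') (a : ℝ) (hA : a ≤ A) (hA' : a ≤ A')
    (hV : V.card ≤ n) (x : ℕ → ℝ) (hmem : ∀ i < n + r + 1, x i ∈ Icc 0 a)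
    (hinc : ∀ i, i + 1 < n + r + 1 → x i < x (i + 1))
    (hs : ∀ i < n + r + 1, |F' 0 (x i)| < (-1) ^ r * (-1) ^ i * F 0 (x i)) : False := by
  have hch := (hF.ch.mono hA).sub (hF'.ch.mono hA')
  have hs' : ∀ i < n + r + 1, 0 < (-1) ^ r * (-1) ^ i * (F 0 (x i) - F' 0 (x i)) := by
    intro i hi
    have h1 := hs i hi
    have h2 : (-1) ^ r * (-1) ^ i * F' 0 (x i) ≤ |F' 0 (x i)| := by
      refine (le_abs_self _).trans (le_of_eq ?_)
      rw [abs_mul, abs_mul]; simp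
    rw [mul_sub]; linarith
  obtain ⟨z, hz, hzi⟩ := iter_rolle _ _ 0 a ((-1) ^ r) (by simp) r hch.cont hch.der 0 0
      (n + r + 1) (by omega) (by omega) (by omega) (by simp) (by simp) x hmem
      hinc (by simp) (by simp) (fun i hi => (hs' i hi).le)
      (Or.inl (fun i hi h0 => by have := hs' i hi; rw [h0] at this; simp at this)) r hr le_rfl
      (n + 1) (by omega) (by ring)
  have := count2 hF hF' hg (n + 1) 0 z (by omega) (fun i hi => (hz i hi).1.1.le)
    (fun i hi => by
      have := (hz i hi).2.2
      simpa only [zero_add, mul_one, sq_pow, one_mul, pow_zero] using this) hzi (by omega)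
  have := cnt_le_card V (z (n + 1 - 1))
  omega

theorem sgn_val {r i : ℕ} {y c : ℝ} (h : y = (-1) ^ r * (-1) ^ i * c) :
    (-1) ^ r * (-1) ^ i * y = c := by
  have e1 := sq_pow r
  have e2 := sq_pow i
  have : ((-1:ℝ)) ^ r * (-1) ^ i * ((-1) ^ r * (-1) ^ i * c) =
    ((-1) ^ r * (-1) ^ r) * ((-1) ^ i * (-1) ^ i) * c := by ring
  rw [h, this, e1, e2]; ring

theorem weak_mono {f g : ℝ → ℝ} (hf : ∀ t ∈ Ici (0:ℝ), 0 < f t) (hg : ∀ t ∈ Ici (0:ℝ), 0 < g t)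
    {r n : ℕ} (hr : 1 ≤ r) {a b M M' : ℝ} {U s V s' : Finset ℝ} {F F' : ℕ → ℝ → ℝ} {x c : ℕ → ℝ}
    (hE : ExtS f g r n a M U s F x) (hE' : ExtS f g r n b M' V s' F' c) (hab : a ≤ b) :
    M ≤ M' := by
  by_contra hcon
  push Not at hcon
  refine dvp hg hr hE.spl hE'.spl a le_rfl hab hE'.card x hE.mem hE.inc (fun i hi => ?_)
  rw [sgn_val (hE.val i hi)]
  have hm := hE.mem i hi
  exact (hE'.bd _ ⟨hm.1, hm.2.trans hab⟩).trans_lt (mul_lt_mul_of_pos_right hcon (hf _ hm.1))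

theorem left_cont {f g : ℝ → ℝ} (hf_c : ContinuousOn f (Ici 0)) (hf : ∀ t ∈ Ici (0:ℝ), 0 < f t)
    (hg : ∀ t ∈ Ici (0:ℝ), 0 < g t)
    {r n : ℕ} (hr : 1 ≤ r) {b M : ℝ} {V s' : Finset ℝ} {F' : ℕ → ℝ → ℝ} {c : ℕ → ℝ}
    (hE' : ExtS f g r n b M V s' F' c) (hb : 0 < b) (ε : ℝ) (hε : 0 < ε) :
    ∃ δ < b, ∀ a ∈ Ioo δ b, ∀ M' U s F x, ExtS f g r n a M' U s F x → M - ε < M' := by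
  have hlast := sgn_val (hE'.val (n + r) (by omega))
  rw [hE'.xl] at hlast
  have hc1 : ContinuousWithinAt (fun t => (-1) ^ r * (-1) ^ (n + r) * F' 0 t - (M - ε) * f t)
      (Icc 0 b) b :=
    ((hE'.spl.ch.cont 0 (by omega)).const_smul ((-1:ℝ) ^ r * (-1) ^ (n + r)) |>.sub
      ((hf_c.mono Icc_subset_Ici_self).const_smul (M - ε))) b (right_mem_Icc.mpr hb.le)
  have hpos : 0 < (-1) ^ r * (-1) ^ (n + r) * F' 0 b - (M - ε) * f b := by
    rw [hlast]; have := hf b hb.le; nlinarith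
  have hev := hc1.eventually (lt_mem_nhds hpos)
  rw [nhdsWithin_Icc_eq_nhdsLE hb] at hev
  obtain ⟨d, hd, hdd⟩ := (mem_nhdsLE_iff_exists_Ioc_subset).mp hev
  have hl : c (n + r - 1) < b := by
    rw [← hE'.xl]
    have := hE'.inc (n + r - 1) (by omega)
    rwa [show n + r - 1 + 1 = n + r by omega] at this
  have hc0 : 0 ≤ c (n + r - 1) := (hE'.mem _ (by omega)).1
  refine ⟨max d (c (n + r - 1)), max_lt hd hl, ?_⟩
  intro a ha M' U s F x hE
  have had : d < a := (le_max_left _ _).trans_lt ha.1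
  have hac : c (n + r - 1) < a := (le_max_right _ _).trans_lt ha.1
  by_contra hcon
  push Not at hcon
  have hle := seq_le c _ hE'.inc
  refine dvp hg hr hE'.spl hE.spl a ha.2.le le_rfl hE.card
    (fun i => if i < n + r then c i else a) ?_ ?_ ?_
  · intro i hi
    by_cases h : i < n + r
    · simp only [h, if_true]
      exact ⟨(hE'.mem i hi).1, (hle i (n + r - 1) (by omega) (by omega)).trans hac.le⟩
    · simp only [h, if_false]
      exact ⟨hc0.trans hac.le, le_rfl⟩
  · intro i hi
    have h : i < n + r := by omega
    by_cases h' : i + 1 < n + r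
    · simp only [h, h', if_true]; exact hE'.inc i hi
    · simp only [h, h', if_true, if_false]
      rwa [show i = n + r - 1 by omega]
  · intro i hi
    have key : ∀ t ∈ Icc 0 a, |F 0 t| ≤ (M - ε) * f t := fun t ht =>
      (hE.bd t ht).trans (mul_le_mul_of_nonneg_right hcon (hf t ht.1).le)
    by_cases h : i < n + r
    · simp only [h, if_true]
      rw [sgn_val (hE'.val i hi)]
      have h1 := key (c i) ⟨(hE'.mem i hi).1, (hle i (n + r - 1) (by omega) (by omega)).trans hac.le⟩
      have := hf (c i) (hE'.mem i hi).1
      nlinarith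
    · simp only [h, if_false]
      have h1 := key a ⟨hc0.trans hac.le, le_rfl⟩
      have h2 := hdd ⟨had, ha.2.le⟩
      simp only [mem_ofPred_eq] at h2
      rw [show i = n + r by omega]
      linarith

noncomputable def exE (g : ℝ → ℝ) (κ : ℕ) (a : ℝ) (c : ℕ → ℝ) : ℕ → ℝ → ℝ
  | 0 => fun t => (-1) ^ κ * g (max t 0)
  | j + 1 => fun t => c j + ∫ w in a..t, exE g κ a c j w

theorem exE_cont (g : ℝ → ℝ) (hg : ContinuousOn g (Ici 0)) (κ : ℕ) (a : ℝ) (c : ℕ → ℝ) (j : ℕ) :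
    Continuous (exE g κ a c j) := by
  induction j with
  | zero =>
    have : Continuous (fun t : ℝ => g (max t 0)) :=
      hg.comp_continuous (continuous_id.max continuous_const) (fun t => mem_Ici.mpr (le_max_right _ _))
    exact continuous_const.mul this
  | succ j ih =>
    exact continuous_const.add (intervalIntegral.continuous_primitive
      (fun x y => ih.intervalIntegrable x y) a)

theorem exE_der (g : ℝ → ℝ) (hg : ContinuousOn g (Ici 0)) (κ : ℕ) (a : ℝ) (c : ℕ → ℝ) (j : ℕ)
    (t : ℝ) : HasDerivAt (exE g κ a c (j + 1)) (exE g κ a c j t) t := by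
  have hc := exE_cont g hg κ a c j
  exact ((hc.integral_hasStrictDerivAt a t).hasDerivAt).const_add (c j)

theorem extend {g : ℝ → ℝ} (hg : ContinuousOn g (Ici 0)) {r : ℕ} {a : ℝ} (ha : 0 < a)
    {U s : Finset ℝ} {F : ℕ → ℝ → ℝ} (hF : Spl_s2 g r a U s F) (B : ℝ) (hB : a < B) :
    ∃ (V s' : Finset ℝ) (F' : ℕ → ℝ → ℝ), Spl_s2 g r B V s' F' ∧ V.card ≤ U.card ∧
      ∀ k, ∀ t ≤ a, F' k t = F k t := by
  set V := U.filter (fun u => u < a) with hV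
  set E := exE g V.card a (fun j => F (r - 1 - j) a) with hEdef
  have hcnt1 : ∀ t ≤ a, cnt V t = cnt U t := by
    intro t ht
    unfold cnt
    congr 1
    ext u
    simp only [hV, Finset.mem_filter]
    exact ⟨fun h => ⟨h.1.1, h.2⟩, fun h => ⟨⟨h.1, h.2.trans_le ht⟩, h.2⟩⟩
  have hcnt2 : ∀ t, a < t → cnt V t = V.card := by
    intro t ht
    unfold cnt
    rw [Finset.filter_true_of_mem]
    intro u hu
    exact (Finset.mem_filter.mp hu).2.trans ht
  refine ⟨V, insert a s, fun k t => if t ≤ a then F k t else E (r - k) t, ⟨⟨?_, ?_⟩, ?_, ?_, ?_⟩,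
    Finset.card_le_card (Finset.filter_subset _ _), ?_⟩
  · intro k hk
    have h1 : ContinuousOn (fun t => if t ≤ a then F k t else E (r - k) t) (Icc 0 a) :=
      (hF.ch.cont k hk).congr (fun t ht => by simp [ht.2])
    have h2 : ContinuousOn (fun t => if t ≤ a then F k t else E (r - k) t) (Icc a B) := by
      refine ((exE_cont g hg V.card a (fun j => F (r - 1 - j) a) (r - k)).continuousOn).congr
        (fun t ht => ?_)
      rcases ht.1.lt_or_eq with h | h
      · simp [not_le.mpr h, hEdef]
      · subst h
        simp only [le_refl, if_true]
        obtain ⟨j, hj⟩ : ∃ j, r - k = j + 1 := ⟨r - k - 1, by omega⟩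
        rw [hj]
        simp only [exE, intervalIntegral.integral_same, add_zero]
        rw [show r - 1 - j = k by omega]
    have := h1.union_of_isClosed h2 isClosed_Icc isClosed_Icc
    rwa [Icc_union_Icc_eq_Icc ha.le hB.le] at this
  · intro k hk t ht hts
    rw [Finset.mem_insert, not_or] at hts
    rcases lt_or_gt_of_ne hts.1 with h | h
    · simp only [h.le, if_true]
      refine (hF.ch.der k hk t ⟨ht.1, h⟩ hts.2).congr_of_eventuallyEq ?_
      filter_upwards [Iio_mem_nhds h] with w hw
      simp [le_of_lt (mem_Iio.mp hw)]
    · simp only [not_le.mpr h, if_false]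
      have := exE_der g hg V.card a (fun j => F (r - 1 - j) a) (r - (k + 1)) t
      rw [show r - (k + 1) + 1 = r - k by omega] at this
      refine this.congr_of_eventuallyEq ?_
      filter_upwards [Ioi_mem_nhds h] with w hw
      simp [not_le.mpr (mem_Ioi.mp hw), hEdef]
  · intro t
    by_cases h : t ≤ a
    · simp only [h, if_true]; rw [hF.top, hcnt1 t h]
    · simp only [h, if_false]
      push Not at h
      rw [hcnt2 t h, Nat.sub_self]
      simp only [hEdef, exE]
      rw [max_eq_left (ha.trans h).le]
  · intro u hu; exact hF.pos u (Finset.mem_filter.mp hu).1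
  · intro u hu
    exact Finset.mem_insert_of_mem (hF.sub (Finset.mem_filter.mp hu).1)
  · intro k t ht; simp [ht]

theorem right_cont {f g : ℝ → ℝ} (hf_c : ContinuousOn f (Ici 0)) (hf : ∀ t ∈ Ici (0:ℝ), 0 < f t)
    (hg_c : ContinuousOn g (Ici 0)) (hg : ∀ t ∈ Ici (0:ℝ), 0 < g t)
    {r n : ℕ} (hr : 1 ≤ r) {a M : ℝ} {U s : Finset ℝ} {F : ℕ → ℝ → ℝ} {x : ℕ → ℝ}
    (hE : ExtS f g r n a M U s F x) (ha : 0 < a) (ε : ℝ) (hε : 0 < ε) :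
    ∃ δ > a, ∀ b ∈ Ioo a δ, ∀ M' V s' F' c, ExtS f g r n b M' V s' F' c → M' < M + ε := by
  obtain ⟨W, s1, H, hH, hW, hHF⟩ := extend hg_c ha hE.spl (a + 1) (by linarith)
  have hc1 : ContinuousWithinAt (fun t => (M + ε) * f t - |H 0 t|) (Icc a (a + 1)) a :=
    (((hf_c.mono (fun t ht => ha.le.trans ht.1)).const_smul (M + ε)).sub
      ((hH.ch.cont 0 (by omega)).mono (Icc_subset_Icc_left ha.le)).abs) a
      (left_mem_Icc.mpr (by linarith))
  have hlt : ∀ t ∈ Icc 0 a, |H 0 t| < (M + ε) * f t := by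
    intro t ht
    rw [hHF 0 t ht.2]
    have h1 := hE.bd t ht
    have h2 := hf t ht.1
    nlinarith
  have hpos : 0 < (M + ε) * f a - |H 0 a| := by
    linarith [hlt a (right_mem_Icc.mpr ha.le)]
  have hev := hc1.eventually (lt_mem_nhds hpos)
  rw [nhdsWithin_Icc_eq_nhdsGE (by linarith)] at hev
  obtain ⟨d, hd, hdd⟩ := (mem_nhdsGE_iff_exists_Ico_subset).mp hev
  refine ⟨min d (a + 1), lt_min hd (by linarith), ?_⟩
  intro b hb M' V s' F' c hE'
  have hbd : b < d := hb.2.trans_le (min_le_left _ _)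
  have hb1 : b < a + 1 := hb.2.trans_le (min_le_right _ _)
  by_contra hcon
  push Not at hcon
  refine dvp hg hr hE'.spl hH b le_rfl hb1.le (hW.trans hE.card) c hE'.mem hE'.inc (fun i hi => ?_)
  rw [sgn_val (hE'.val i hi)]
  have hm := hE'.mem i hi
  refine lt_of_lt_of_le ?_ (mul_le_mul_of_nonneg_right hcon (hf _ hm.1).le)
  rcases le_or_gt (c i) a with h | h
  · exact hlt _ ⟨hm.1, h⟩
  · have := hdd ⟨h.le, hm.2.trans_lt hbd⟩
    simp only [mem_ofPred_eq] at this
    linarith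

theorem exists_off (s : Finset ℝ) {x y : ℝ} (h : x < y) : ∃ t ∈ Ioo x y, t ∉ s := by
  have hne : (Ioo x y ∩ {t | t ∉ s}).Nonempty := by
    rw [← closure_nonempty_iff]
    exact ⟨x, sub_closure s x y h (left_mem_Icc.mpr h.le)⟩
  obtain ⟨t, ht, hts⟩ := hne
  exact ⟨t, ht, hts⟩

theorem Spl_s2.shift {g : ℝ → ℝ} {r : ℕ} {A : ℝ} {U s : Finset ℝ} {F : ℕ → ℝ → ℝ}
    (h : Spl_s2 g r A U s F) (hr : 1 ≤ r) (C : ℝ) :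
    Spl_s2 g r A U s (fun k t => F k t - if k = 0 then C else 0) := by
  refine ⟨⟨fun k hk => (h.ch.cont k hk).sub continuousOn_const, fun k hk t ht hts => ?_⟩,
    fun t => ?_, h.pos, h.sub⟩
  · have := (h.ch.der k hk t ht hts).sub_const (if k = 0 then C else 0)
    simpa using this
  · have : r ≠ 0 := by omega
    simp [this, h.top t]

theorem lemA {f g : ℝ → ℝ} (hf : ∀ t ∈ Ici (0:ℝ), 0 < f t) (hfa : AntitoneOn f (Ici 0))
    (hg : ∀ t ∈ Ici (0:ℝ), 0 < g t) {r : ℕ} (hr : 1 ≤ r) {A M : ℝ} {U s : Finset ℝ}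
    {F : ℕ → ℝ → ℝ} (hF : Spl_s2 g r A U s F) (hM : 0 < M) (bd : ∀ t ∈ Icc 0 A, |F 0 t| ≤ M * f t)
    (k : ℕ) (x : ℕ → ℝ) (hx0 : 0 ≤ x 0) (hinc : ∀ i, i + 1 < k + r + 1 → x i < x (i + 1))
    (A' : ℝ) (hA : A' ≤ A) (hlast : x (k + r) < A')
    (val : ∀ i < k + r + 1, F 0 (x i) = (-1) ^ r * (-1) ^ i * (M * f (x i)))
    (hU : cnt U A' ≤ k) : False := by
  have hle := seq_le x _ hinc
  set c := x (k + r) with hc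
  have hc0 : 0 ≤ c := hx0.trans (hle 0 (k + r) (by omega) (by omega))
  set e : ℝ := (-1) ^ r * (-1) ^ (k + r) with he
  have hee : e * e = 1 := by
    have := sgn_val (r := r) (i := k + r) (y := e) (c := 1) (by rw [mul_one])
    exact this
  have hval := sgn_val (val (k + r) (by omega))
  set m := M * f c with hm
  have hmpos : 0 < m := mul_pos hM (hf c hc0)
  change e * F 0 c = m at hval
  have hle_m : ∀ t ∈ Ioo c A', e * F 0 t ≤ m := by
    intro t ht
    have h0 : 0 ≤ t := hc0.trans ht.1.le
    have h1 := bd t ⟨h0, ht.2.le.trans hA⟩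
    have h2 : f t ≤ f c := hfa hc0 h0 ht.1.le
    have h3 : e * F 0 t ≤ |F 0 t| := by
      refine (le_abs_self _).trans (le_of_eq ?_)
      rw [abs_mul, he, abs_mul]; simp
    have h4 : M * f t ≤ m := mul_le_mul_of_nonneg_left h2 hM.le
    linarith
  have hq : ∃ q ∈ Ioo c A', e * F 0 q < m := by
    by_contra hcon
    push Not at hcon
    have hS := hF.shift hr (e * m)
    have hz : ∀ t ∈ Ioo c A', F 0 t - (if (0:ℕ) = 0 then e * m else 0) = 0 := by
      intro t ht
      have : e * F 0 t = m := le_antisymm (hle_m t ht) (hcon t ht)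
      simp only [if_true]
      rw [← this, ← mul_assoc, hee]; ring
    have hv := hS.ch.vanish hc0 hlast hA hz r le_rfl
    obtain ⟨t, ht, hts⟩ := exists_off s hlast
    have h1 := hv t ht hts
    have h2 := hS.top t
    rw [h1] at h2
    have h3 := hg t (hc0.trans ht.1.le)
    have : ((-1:ℝ)) ^ cnt U t * g t ≠ 0 := mul_ne_zero (by simp) h3.ne'
    exact this h2.symm
  obtain ⟨q, hq, hqm⟩ := hq
  set C := (max (e * F 0 q) 0 + m) / 2 with hC
  have hC1 : e * F 0 q < C := by
    have := le_max_left (e * F 0 q) 0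
    linarith
  have hC0 : 0 < C := by
    have := le_max_right (e * F 0 q) 0
    linarith
  have hC2 : C < m := by
    have := max_lt hqm hmpos
    linarith
  have hS := hF.shift hr (e * C)
  set D : ℕ → ℝ → ℝ := fun k t => F k t - if k = 0 then e * C else 0 with hD
  have hD0 : ∀ t, D 0 t = F 0 t - e * C := fun t => by simp [hD]
  set y : ℕ → ℝ := fun i => if i < k + r + 1 then x i else q with hy
  have hy1 : ∀ i < k + r + 1, y i = x i := fun i hi => by simp only [hy, hi, if_true, if_false]
  have hy2 : ∀ i, ¬ i < k + r + 1 → y i = q := fun i hi => by simp only [hy, hi, if_true, if_false]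
  have hq0 : 0 ≤ q := hc0.trans hq.1.le
  have hmem : ∀ i < k + r + 2, y i ∈ Icc 0 A' := by
    intro i hi
    by_cases h : i < k + r + 1
    · rw [hy1 i h]
      exact ⟨hx0.trans (hle 0 i (by omega) h), (hle i (k + r) (by omega) (by omega)).trans hlast.le⟩
    · rw [hy2 i h]; exact ⟨hq0, hq.2.le⟩
  have hyinc : ∀ i, i + 1 < k + r + 2 → y i < y (i + 1) := by
    intro i hi
    rw [hy1 i (by omega)]
    by_cases h : i + 1 < k + r + 1
    · rw [hy1 _ h]; exact hinc i h
    · rw [hy2 _ h, show i = k + r by omega]; exact hq.1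
  have hsgn : ∀ i < k + r + 2, 0 < (-1) ^ r * (-1) ^ i * D 0 (y i) := by
    intro i hi
    rw [hD0]
    by_cases h : i < k + r + 1
    · rw [hy1 i h, mul_sub, sgn_val (val i h)]
      have h1 : (-1) ^ r * (-1) ^ i * (e * C) ≤ C := by
        refine (le_abs_self _).trans (le_of_eq ?_)
        rw [abs_mul, abs_mul, abs_mul, he, abs_mul, abs_of_pos hC0]; simp
      have hxi : 0 ≤ x i := hx0.trans (hle 0 i (by omega) h)
      have h2 : m ≤ M * f (x i) :=
        mul_le_mul_of_nonneg_left (hfa hxi hc0 (hle i (k + r) (by omega) (by omega))) hM.le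
      linarith
    · rw [hy2 i h, show i = k + r + 1 by omega, pow_succ]
      have : (-1:ℝ) ^ r * ((-1) ^ (k + r) * -1) * (F 0 q - e * C) = (e * e) * C - e * F 0 q := by
        rw [he]; ring
      rw [this, hee]; linarith
  obtain ⟨z, hz, hzi⟩ := iter_rolle D s 0 A' ((-1) ^ r) (by simp) r (hS.ch.mono hA).cont
      (hS.ch.mono hA).der 0 0
      (k + r + 2) (by omega) (by omega) (by omega) (by simp) (by simp) y hmem
      hyinc (by simp) (by simp) (fun i hi => (hsgn i hi).le)
      (Or.inl (fun i hi h0 => by have := hsgn i hi; rw [h0] at this; simp at this)) r hr le_rfl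
      (k + 2) (by omega) (by ring)
  have := count1 hS hg (k + 2) 0 z (by omega) (fun i hi => (hz i hi).1.1.le)
    (fun i hi => by
      have := (hz i hi).2.2
      simpa only [zero_add, mul_one, sq_pow, one_mul, pow_zero] using this) hzi (by omega)
  have := cnt_mono U (hz (k + 2 - 1) (by omega)).1.2.le
  omega

theorem past {f g : ℝ → ℝ} (hf : ∀ t ∈ Ici (0:ℝ), 0 < f t) (hfa : AntitoneOn f (Ici 0))
    (hg : ∀ t ∈ Ici (0:ℝ), 0 < g t) {r : ℕ} (hr : 1 ≤ r) {A M : ℝ} {U s : Finset ℝ}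
    {F : ℕ → ℝ → ℝ} (hF : Spl_s2 g r A U s F) (hM : 0 < M) (bd : ∀ t ∈ Icc 0 A, |F 0 t| ≤ M * f t)
    (k : ℕ) (x : ℕ → ℝ) (hx0 : 0 ≤ x 0) (hinc : ∀ i, i + 1 < k + r + 1 → x i < x (i + 1))
    (p : ℝ) (hp : p < A) (hpU : p ∉ U) (hlast : x (k + r) ≤ p)
    (val : ∀ i < k + r + 1, F 0 (x i) = (-1) ^ r * (-1) ^ i * (M * f (x i)))
    (hU : cnt U p ≤ k) : False := by
  obtain ⟨η, hη, hgap⟩ := gap U p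
  obtain ⟨A', h1, h2⟩ := exists_between (show p < min A (p + η) from lt_min hp (by linarith))
  refine lemA hf hfa hg hr hF hM bd k x hx0 hinc A' (h2.le.trans (min_le_left _ _))
    (hlast.trans_lt h1) val ?_
  rw [(cnt_right U p η hgap A' ⟨h1, h2.trans_le (min_le_right _ _)⟩).1, cntle_eq_cnt U p hpU]
  exact hU

theorem interlace {f g : ℝ → ℝ} (hf : ∀ t ∈ Ici (0:ℝ), 0 < f t)
    (hg : ∀ t ∈ Ici (0:ℝ), 0 < g t) {r n : ℕ} (hr : 1 ≤ r) {a M : ℝ} {U s : Finset ℝ}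
    {F : ℕ → ℝ → ℝ} {x : ℕ → ℝ} (hE : ExtS f g r n a M U s F x) (q : ℝ)
    (j : ℕ) (hj : j + 1 = cntle U q) : x j < q := by
  by_contra hcon
  push Not at hcon
  have hjn : j + 1 ≤ n := by have := cntle_le_card U q; have := hE.card; omega
  have hq0 : 0 ≤ q := by
    have : (U.filter (fun u => u ≤ q)).Nonempty := by
      rw [← Finset.card_pos]; change 0 < cntle U q; omega
    obtain ⟨u, hu⟩ := this
    rw [Finset.mem_filter] at hu
    exact (hE.spl.pos u hu.1).le.trans hu.2
  have hle := seq_le x _ hE.inc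
  have hsgn : ∀ i < n + r - j + 1, 0 < (-1) ^ r * (-1) ^ j * (-1) ^ i * F 0 (x (j + i)) := by
    intro i hi
    have h1 := sgn_val (hE.val (j + i) (by omega))
    rw [pow_add, ← mul_assoc] at h1
    rw [h1]
    exact mul_pos hE.Mpos (hf _ (hE.mem _ (by omega)).1)
  obtain ⟨z, hz, hzi⟩ := iter_rolle F s q a ((-1) ^ r * (-1) ^ j) (by simp) r
      (fun k hk => (hE.spl.ch.cont k hk).mono (Icc_subset_Icc_left hq0))
      (fun k hk t ht => hE.spl.ch.der k hk t ⟨hq0.trans_lt ht.1, ht.2⟩) 0 0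
      (n + r - j + 1) (by omega) (by omega) (by omega) (by simp) (by simp) (fun i => x (j + i))
      (fun i hi => ⟨hcon.trans (hle j (j + i) (by omega) (by omega)), (hE.mem _ (by omega)).2⟩)
      (fun i hi => hE.inc (j + i) (by omega)) (by simp) (by simp) (fun i hi => (hsgn i hi).le)
      (Or.inl (fun i hi h0 => by have := hsgn i hi; rw [h0] at this; simp at this)) r hr le_rfl
      (n - j + 1) (by omega) (by simp only [add_zero, mul_zero]; omega)
  have hz' : ∀ i < n - j + 1, 0 < (-1:ℝ) ^ (j + 2) * (-1) ^ i * F r (z i) := by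
    intro i hi
    have h1 := (hz i hi).2.2
    have : (-1:ℝ) ^ (j + 2) * (-1) ^ i * F r (z i) =
      ((-1) ^ r * (-1) ^ r) * (-1) ^ j * (-1) ^ i * F r (z i) := by
      rw [sq_pow, pow_add]; ring
    rw [this]
    simp only [zero_add, mul_one] at h1
    linarith
  have h0 : j + 2 ≤ cnt U (z 0) := by
    have h1 := (hz 0 (by omega)).1
    have h2 : j + 1 ≤ cnt U (z 0) := by rw [hj]; exact cntle_le_cnt U h1.1
    have h3 : cnt U (z 0) ≠ j + 1 := by
      intro h3
      have h4 := hz' 0 (by omega)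
      rw [hE.spl.top] at h4
      have := sgnA _ _ _ _ (hg _ (hq0.trans h1.1.le)) h4
      rw [h3, add_zero, pow_succ, pow_add] at this
      have h5 : ((-1:ℝ)) ^ j ≠ 0 := by simp
      apply h5; linarith
    omega
  have := count1 hE.spl hg (n - j + 1) (j + 2) z (by omega)
    (fun i hi => hq0.trans (hz i hi).1.1.le) hz' hzi h0
  have := cnt_le_card U (z (n - j + 1 - 1))
  have := hE.card
  omega

theorem claimJ {g : ℝ → ℝ} {r n : ℕ} {A A' : ℝ} {U s V s' : Finset ℝ} {F F' : ℕ → ℝ → ℝ}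
    (hg : ∀ t ∈ Ici (0:ℝ), 0 < g t) (hr : 1 ≤ r)
    (hF : Spl_s2 g r A U s F) (hF' : Spl_s2 g r A' V s' F') (p q : ℝ) (hp : 0 ≤ p) (hpq : p < q)
    (hA : q ≤ A) (hA' : q ≤ A') (k0 : ℕ) (hk0 : k0 ≤ cnt V p) (hp0 : p = 0 → k0 = 0)
    (zl : 0 < p → ∀ k < r, F k p - F' k p = 0) (zr : ∀ k < r, F k q - F' k q = 0)
    (NZ : ∀ α β, p ≤ α → α < β → β ≤ q → ∃ t ∈ Icc α β, F 0 t - F' 0 t ≠ 0)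
    (x : ℕ → ℝ) (hx0 : 0 ≤ x 0) (hinc : ∀ i, i + 1 < n + r + 1 → x i < x (i + 1))
    (hw : ∀ i < n + r + 1, x i ≤ q → 0 ≤ (-1) ^ r * (-1) ^ i * (F 0 (x i) - F' 0 (x i)))
    (hpx : 0 < p → p < x (k0 + r)) (J : ℕ) (hJn : k0 + J ≤ n)
    (hJq : ∀ j, j + 1 = k0 + J → x j < q) : k0 + J ≤ cnt V q := by
  rcases Nat.eq_zero_or_pos J with hJ | hJ
  · rw [hJ]; exact hk0.trans (cnt_mono V hpq.le)
  have hch := (hF.ch.mono hA).sub (hF'.ch.mono hA')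
  have hle := seq_le x _ hinc
  have hlt := seq_lt x _ hinc
  have hcont : ∀ k < r, ContinuousOn (fun t => F k t - F' k t) (Icc p q) :=
    fun k hk => (hch.cont k hk).mono (Icc_subset_Icc_left hp)
  have hder : ∀ k < r, ∀ t ∈ Ioo p q, t ∉ s ∪ s' →
      HasDerivAt (fun t => F k t - F' k t) (F (k + 1) t - F' (k + 1) t) t :=
    fun k hk t ht => hch.der k hk t ⟨hp.trans_lt ht.1, ht.2⟩
  have fin : ∀ z : ℕ → ℝ, (∀ i < J, z i ∈ Ioo p q) → (∀ i, i + 1 < J → z i < z (i + 1)) →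
      (∀ i < J, 0 < (-1:ℝ) ^ k0 * (-1) ^ i * (F r (z i) - F' r (z i))) → k0 + J ≤ cnt V q := by
    intro z hz hzi hzs
    have h1 := count2 hF hF' hg J k0 z hJ (fun i hi => hp.trans (hz i hi).1.le) hzs hzi
      (hk0.trans (cnt_mono V (hz 0 hJ).1.le))
    exact h1.trans (cnt_mono V (hz (J - 1) (by omega)).2.le)
  have hlastq := hJq (k0 + J - 1) (by omega)
  rcases hp.eq_or_lt with hp' | hp'
  · have hk := hp0 hp'.symm
    subst hk
    obtain ⟨z, hz, hzi⟩ := iter_rolle (fun k t => F k t - F' k t) (s ∪ s') p q ((-1) ^ r) (by simp)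
      r hcont hder 0 1 J (by omega) (by omega) hJ (by simp) (fun _ => zr) x
      (fun i hi => ⟨by rw [← hp']; exact hx0.trans (hle 0 i (by omega) (by omega)),
        (hle i (0 + J - 1) (by omega) (by omega)).trans hlastq.le⟩)
      (fun i hi => hinc i (by omega)) (by simp) (fun _ => by simpa using hlastq)
      (fun i hi => hw i (by omega) ((hle i (0 + J - 1) (by omega) (by omega)).trans hlastq.le))
      (Or.inr NZ) r hr le_rfl J hJ (by ring)
    refine fin z (fun i hi => (hz i hi).1) hzi (fun i hi => ?_)
    have := (hz i hi).2.2
    simpa only [zero_add, mul_one, sq_pow, one_mul, pow_zero] using this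
  · by_cases hJr : r + 1 ≤ J
    · obtain ⟨z, hz, hzi⟩ := iter_rolle (fun k t => F k t - F' k t) (s ∪ s') p q
        ((-1) ^ r * (-1) ^ (k0 + r)) (by simp)
        r hcont hder 1 1 (J - r) (by omega) (by omega) (by omega) (fun _ => zl hp') (fun _ => zr)
        (fun i => x (k0 + r + i))
        (fun i hi => ⟨(hpx hp').le.trans (hle _ _ (by omega) (by omega)),
          (hle _ (k0 + J - 1) (by omega) (by omega)).trans hlastq.le⟩)
        (fun i hi => hinc _ (by omega)) (fun _ => hpx hp')
        (fun _ => by rwa [show k0 + r + (J - r - 1) = k0 + J - 1 by omega])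
        (fun i hi => by
          have := hw (k0 + r + i) (by omega)
            ((hle _ (k0 + J - 1) (by omega) (by omega)).trans hlastq.le)
          rwa [pow_add, ← mul_assoc] at this)
        (Or.inr NZ) r hr le_rfl J hJ (by omega)
      refine fin z (fun i hi => (hz i hi).1) hzi (fun i hi => ?_)
      have h1 := (hz i hi).2.2
      have h2 : ((-1:ℝ)) ^ r * (-1) ^ (k0 + r) * (-1) ^ (r * (1 + 1)) = (-1) ^ k0 := by
        rw [mul_comm r, pow_mul, pow_add]
        have := sq_pow r
        norm_num
        linear_combination (-1:ℝ) ^ k0 * this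
      rwa [h2] at h1
    · obtain ⟨t, ht, ht0⟩ := NZ p q le_rfl hpq le_rfl
      have htp : p < t := lt_of_le_of_ne ht.1 (fun h => ht0 (h ▸ zl hp' 0 (by omega)))
      have htq : t < q := lt_of_le_of_ne ht.2 (fun h => ht0 (by rw [h]; exact zr 0 (by omega)))
      have key : ∀ e : ℝ, e ≠ 0 → 0 ≤ e * (F 0 t - F' 0 t) → ∃ z : ℕ → ℝ,
          (∀ i < r + 1, z i ∈ Ioo p q ∧ 0 < e * (-1) ^ i * (F r (z i) - F' r (z i))) ∧
          ∀ i, i + 1 < r + 1 → z i < z (i + 1) := by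
        intro e he het
        obtain ⟨z, hz, hzi⟩ := iter_rolle (fun k t => F k t - F' k t) (s ∪ s') p q e he
          r hcont hder 1 1 1 (by omega) (by omega) (by omega) (fun _ => zl hp') (fun _ => zr)
          (fun i => t) (fun i hi => ht) (fun i hi => by omega) (fun _ => htp) (fun _ => htq)
          (fun i hi => by rw [show i = 0 by omega]; simpa using het)
          (Or.inr NZ) r hr le_rfl (r + 1) (by omega) (by ring)
        refine ⟨z, fun i hi => ⟨(hz i hi).1, ?_⟩, hzi⟩
        have h1 := (hz i hi).2.2
        rw [mul_comm r, pow_mul] at h1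
        norm_num at h1
        exact h1
      rcases le_total 0 ((-1) ^ k0 * (F 0 t - F' 0 t)) with h | h
      · obtain ⟨z, hz, hzi⟩ := key _ (by simp) h
        exact fin z (fun i hi => (hz i (by omega)).1) (fun i hi => hzi i (by omega))
          (fun i hi => (hz i (by omega)).2)
      · obtain ⟨z, hz, hzi⟩ := key (-(-1) ^ k0) (by simp) (by linarith)
        refine fin (fun i => z (i + 1)) (fun i hi => (hz (i + 1) (by omega)).1)
          (fun i hi => hzi (i + 1) (by omega)) (fun i hi => ?_)
        have := (hz (i + 1) (by omega)).2
        rw [pow_succ] at this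
        linarith

theorem par_eq {κ κ' : ℕ} {g : ℝ} (hg : 0 < g) (h : (-1:ℝ) ^ κ * g - (-1) ^ κ' * g = 0) :
    (-1:ℝ) ^ κ = (-1) ^ κ' := by
  have : ((-1:ℝ) ^ κ - (-1) ^ κ') * g = 0 := by linarith
  rcases mul_eq_zero.mp this with h | h
  · linarith
  · exact absurd h hg.ne'

theorem pre_sub {g : ℝ → ℝ} {r : ℕ} {A A' : ℝ} {U s V s' : Finset ℝ} {F F' : ℕ → ℝ → ℝ}
    (hg : ∀ t ∈ Ici (0:ℝ), 0 < g t) (hF : Spl_s2 g r A U s F) (hF' : Spl_s2 g r A' V s' F') (p : ℝ)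
    (S : Finset ℝ) (hS1 : U ⊆ S) (hS2 : V ⊆ S)
    (h : ∀ t ∈ Ioo 0 p, t ∉ S → F r t - F' r t = 0) : cnt U p ≤ cnt V p := by
  refine Finset.card_le_card (fun w hw => ?_)
  rw [Finset.mem_filter] at hw ⊢
  refine ⟨?_, hw.2⟩
  by_contra hV
  obtain ⟨η, hη, hgap⟩ := gap S w
  have hw0 := hF.pos w hw.1
  obtain ⟨t1, h1, h1'⟩ := exists_between (show max 0 (w - η) < w from max_lt hw0 (by linarith))
  obtain ⟨t2, h2, h2'⟩ := exists_between (show w < min p (w + η) from lt_min hw.2 (by linarith))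
  rw [max_lt_iff] at h1
  rw [lt_min_iff] at h2'
  have gU : ∀ u ∈ U, u ≠ w → η ≤ |u - w| := fun u hu => hgap u (hS1 hu)
  have gV : ∀ u ∈ V, u ≠ w → η ≤ |u - w| := fun u hu => hgap u (hS2 hu)
  have e1 := h t1 ⟨h1.1, h1'.trans hw.2⟩ (cnt_left S w η hgap t1 ⟨h1.2, h1'⟩).2
  have e2 := h t2 ⟨hw0.trans h2, h2'.1⟩ (cnt_right S w η hgap t2 ⟨h2, h2'.2⟩).2
  rw [hF.top, hF'.top, (cnt_left U w η gU t1 ⟨h1.2, h1'⟩).1,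
    (cnt_left V w η gV t1 ⟨h1.2, h1'⟩).1] at e1
  rw [hF.top, hF'.top, (cnt_right U w η gU t2 ⟨h2, h2'.2⟩).1,
    (cnt_right V w η gV t2 ⟨h2, h2'.2⟩).1, cntle_eq_cnt V w hV, cntle_eq_cnt_succ U w hw.1] at e2
  have p1 := par_eq (hg t1 h1.1.le) e1
  have p2 := par_eq (hg t2 (hw0.trans h2).le) e2
  rw [pow_succ, ← p1] at p2
  have h5 : ((-1:ℝ)) ^ cnt U w ≠ 0 := by simp
  apply h5; linarith

theorem q_exists {g : ℝ → ℝ} {r : ℕ} {a : ℝ} {U s V s' : Finset ℝ} {F F' : ℕ → ℝ → ℝ}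
    (hg : ∀ t ∈ Ici (0:ℝ), 0 < g t) (hr : 1 ≤ r) (hF : Spl_s2 g r a U s F) (hF' : Spl_s2 g r a V s' F')
    (p : ℝ) (hp : 0 ≤ p) (hpa : p < a)
    (hmax : ∀ y, p < y → y ≤ a → ¬ ∀ t ∈ Icc p y, F 0 t - F' 0 t = 0) :
    ∃ q, p < q ∧ q ≤ a ∧
      (∀ α β, p ≤ α → α < β → β ≤ q → ∃ t ∈ Icc α β, F 0 t - F' 0 t ≠ 0) ∧
      (q = a ∨ (q < a ∧ ∀ k < r, F k q - F' k q = 0)) := by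
  have hch := hF.ch.sub hF'.ch
  set T : Set ℝ := {y | p ≤ y ∧ y < a ∧ ∃ y', y < y' ∧ y' ≤ a ∧ ∀ t ∈ Icc y y', F 0 t - F' 0 t = 0}
    with hT
  by_cases hne : T.Nonempty
  · have hbb : BddBelow T := ⟨p, fun y hy => hy.1⟩
    set q := sInf T with hq
    have hpq : p ≤ q := le_csInf hne (fun y hy => hy.1)
    have hqT : q ∈ T := by
      by_contra hqn
      obtain ⟨η, hη, hgap⟩ := gap (s ∪ s') q
      obtain ⟨y, hyT, hyη⟩ := exists_lt_of_csInf_lt hne (show sInf T < q + η by linarith)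
      have hqy : q < y := lt_of_le_of_ne (csInf_le hbb hyT) (fun h => hqn (h ▸ hyT))
      obtain ⟨hy1, hy2, y', hy3, hy4, hy5⟩ := hyT
      have gU : ∀ u ∈ U, u ≠ q → η ≤ |u - q| :=
        fun u hu => hgap u (Finset.mem_union_left _ (hF.sub hu))
      have gV : ∀ u ∈ V, u ≠ q → η ≤ |u - q| :=
        fun u hu => hgap u (Finset.mem_union_right _ (hF'.sub hu))
      have hy0 : 0 ≤ y := hp.trans hy1
      obtain ⟨t0, ht0, ht0s⟩ := exists_off (s ∪ s') (show y < min y' (q + η) from lt_min hy3 hyη)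
      have ht0' := lt_min_iff.mp ht0.2
      have hz := hch.vanish hy0 hy3 hy4 (fun t ht => hy5 t ⟨ht.1.le, ht.2.le⟩) r le_rfl t0
        ⟨ht0.1, ht0'.1⟩ ht0s
      have hzc := hch.vanish_closed hy0 hy3 hy4 (fun t ht => hy5 t ⟨ht.1.le, ht.2.le⟩)
      rw [hF.top, hF'.top, (cnt_right U q η gU t0 ⟨hqy.trans ht0.1, ht0'.2⟩).1,
        (cnt_right V q η gV t0 ⟨hqy.trans ht0.1, ht0'.2⟩).1] at hz
      have hpar := par_eq (hg t0 (hy0.trans ht0.1.le)) hz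
      have hdown := hch.vanish_down (x := q) (y := y) (hp.trans hpq) hy2.le hr (fun t ht _ => by
        have htq : t ∈ Ioo q (q + η) := ⟨ht.1, ht.2.trans hyη⟩
        rw [hF.top, hF'.top, (cnt_right U q η gU t htq).1, (cnt_right V q η gV t htq).1, hpar,
          sub_self]) y ⟨hqy.le, le_rfl⟩ (fun k hk => hzc k hk y ⟨le_rfl, hy3.le⟩)
      exact hqn ⟨hpq, hqy.trans hy2, y, hqy, hy2.le, hdown⟩
    obtain ⟨h1, h2, y', h3, h4, h5⟩ := hqT
    refine ⟨q, lt_of_le_of_ne hpq (fun h => ?_), h2.le, ?_, Or.inr ⟨h2, ?_⟩⟩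
    · exact hmax y' (h ▸ h3) h4 (by rw [h]; exact h5)
    · intro α β hα hαβ hβ
      by_contra hcon
      push Not at hcon
      have : α ∈ T := ⟨hα, by linarith, β, hαβ, hβ.trans h2.le, hcon⟩
      have := csInf_le hbb this
      linarith
    · intro k hk
      exact hch.vanish_closed (hp.trans hpq) h3 h4 (fun t ht => h5 t ⟨ht.1.le, ht.2.le⟩) k hk q
        ⟨le_rfl, h3.le⟩
  · refine ⟨a, hpa, le_rfl, ?_, Or.inl rfl⟩
    intro α β hα hαβ hβ
    by_contra hcon
    push Not at hcon
    exact hne ⟨α, hα, by linarith, β, hαβ, hβ, hcon⟩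

theorem strict_aux {f g : ℝ → ℝ} (hf : ∀ t ∈ Ici (0:ℝ), 0 < f t) (hfa : AntitoneOn f (Ici 0))
    (hg : ∀ t ∈ Ici (0:ℝ), 0 < g t)
    {r n : ℕ} (hr : 1 ≤ r) {a b M : ℝ} {U s V s' : Finset ℝ} {F F' : ℕ → ℝ → ℝ} {x c : ℕ → ℝ}
    (hE : ExtS f g r n a M U s F x) (hE' : ExtS f g r n b M V s' F' c) (ha : 0 < a)
    (hab : a < b) : False := by
  have hF := hE.spl
  have hF' := hE'.spl.mono hab.le
  have hch := hF.ch.sub hF'.ch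
  have sgn_le : ∀ i : ℕ, ∀ v : ℝ, (-1) ^ r * (-1) ^ i * v ≤ |v| := by
    intro i v
    refine (le_abs_self _).trans (le_of_eq ?_)
    rw [abs_mul, abs_mul]; simp
  have hw1 : ∀ i < n + r + 1, 0 ≤ (-1) ^ r * (-1) ^ i * (F 0 (x i) - F' 0 (x i)) := by
    intro i hi
    have hm := hE.mem i hi
    rw [mul_sub, sgn_val (hE.val i hi)]
    linarith [sgn_le i (F' 0 (x i)), hE'.bd (x i) ⟨hm.1, hm.2.trans hab.le⟩]
  have hw2 : ∀ i < n + r + 1, c i ≤ a → 0 ≤ (-1) ^ r * (-1) ^ i * (F' 0 (c i) - F 0 (c i)) := by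
    intro i hi hca
    have hm := hE'.mem i hi
    rw [mul_sub, sgn_val (hE'.val i hi)]
    linarith [sgn_le i (F 0 (c i)), hE.bd (c i) ⟨hm.1, hca⟩]
  -- definition of p
  set P : Set ℝ := {y | 0 ≤ y ∧ y ≤ a ∧ ∀ t ∈ Ico 0 y, F 0 t - F' 0 t = 0} with hP
  have hPb : BddAbove P := ⟨a, fun y hy => hy.2.1⟩
  have hP0 : (0:ℝ) ∈ P := ⟨le_rfl, ha.le, fun t ht => absurd ht.2 (not_lt.mpr ht.1)⟩
  set p := sSup P with hp
  have hp0 : 0 ≤ p := le_csSup hPb hP0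
  have hpa : p ≤ a := csSup_le ⟨0, hP0⟩ (fun y hy => hy.2.1)
  have hpz : ∀ t ∈ Ico 0 p, F 0 t - F' 0 t = 0 := by
    intro t ht
    obtain ⟨y, hy, hty⟩ := exists_lt_of_lt_csSup ⟨0, hP0⟩ ht.2
    exact hy.2.2 t ⟨ht.1, hty⟩
  have hpv : 0 < p → ∀ k < r, ∀ t ∈ Icc 0 p, F k t - F' k t = 0 := fun h =>
    hch.vanish_closed le_rfl h hpa (fun t ht => hpz t ⟨ht.1.le, ht.2⟩)
  rcases hpa.eq_or_lt with hpe | hpa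
  · have hz := hpv (by rw [hpe]; exact ha) 0 (by omega)
    rw [hpe] at hz
    refine lemA hf hfa hg hr hE'.spl hE.Mpos hE'.bd n x hE.x0 hE.inc b le_rfl
      (by rw [hE.xl]; exact hab) (fun i hi => ?_) ((cnt_le_card V b).trans hE'.card)
    rw [← hE.val i hi]
    linarith [hz (x i) (hE.mem i hi)]
  have hmax : ∀ y, p < y → y ≤ a → ¬ ∀ t ∈ Icc p y, F 0 t - F' 0 t = 0 := by
    intro y hy hya hz
    have : y ∈ P := ⟨hp0.trans hy.le, hya, fun t ht => by
      rcases lt_or_ge t p with h | h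
      · exact hpz t ⟨ht.1, h⟩
      · exact hz t ⟨h, ht.2.le⟩⟩
    have := le_csSup hPb this
    linarith
  have hcnt : cnt U p = cnt V p := by
    have hz : ∀ t ∈ Ioo 0 p, t ∉ s ∪ s' → F r t - F' r t = 0 := by
      intro t ht hts
      exact hch.vanish le_rfl (ht.1.trans ht.2) hpa.le (fun t ht => hpz t ⟨ht.1.le, ht.2⟩) r
        le_rfl t ht hts
    have i1 : U ⊆ s ∪ s' := hF.sub.trans Finset.subset_union_left
    have i2 : V ⊆ s ∪ s' := hF'.sub.trans Finset.subset_union_right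
    exact le_antisymm (pre_sub hg hF hF' p (s ∪ s') i1 i2 hz)
      (pre_sub hg hF' hF p (s ∪ s') i2 i1 (fun t ht hts => by linarith [hz t ht hts]))
  set k0 := cnt U p with hk0
  have hk0n : k0 ≤ n := (cnt_le_card U p).trans hE.card
  have hk00 : p = 0 → k0 = 0 := by
    intro h
    rw [hk0]; unfold cnt
    rw [Finset.card_eq_zero, Finset.filter_eq_empty_iff]
    intro u hu
    rw [h]; exact not_lt.mpr (hF.pos u hu).le
  have hboth : 0 < p → ¬ (p ∈ U ∧ p ∈ V) := by
    rintro hpp ⟨h1, h2⟩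
    obtain ⟨η, hη, hgap⟩ := gap (s ∪ s') p
    have gU : ∀ u ∈ U, u ≠ p → η ≤ |u - p| :=
      fun u hu => hgap u (Finset.mem_union_left _ (hF.sub hu))
    have gV : ∀ u ∈ V, u ≠ p → η ≤ |u - p| :=
      fun u hu => hgap u (Finset.mem_union_right _ (hF'.sub hu))
    have hlt : p < min a (p + η) := lt_min hpa (by linarith)
    refine hmax (min a (p + η)) hlt (min_le_left _ _) ?_
    refine hch.vanish_down hp0 (min_le_left _ _) hr (fun t ht _ => ?_) p ⟨le_rfl, hlt.le⟩
      (fun k hk => hpv hpp k hk p ⟨hp0, le_rfl⟩)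
    have htq : t ∈ Ioo p (p + η) := ⟨ht.1, ht.2.trans_le (min_le_right _ _)⟩
    rw [hF.top, hF'.top, (cnt_right U p η gU t htq).1, (cnt_right V p η gV t htq).1,
      cntle_eq_cnt_succ U p h1, cntle_eq_cnt_succ V p h2, ← hk0, hcnt, sub_self]
  have hpx : 0 < p → p < x (k0 + r) := by
    intro hpp
    by_contra hcon
    push Not at hcon
    have hle := seq_le x _ hE.inc
    by_cases h : p ∈ U
    · have hV : p ∉ V := fun h' => hboth hpp ⟨h, h'⟩
      refine past hf hfa hg hr hE'.spl hE.Mpos hE'.bd k0 x hE.x0 (fun i hi => hE.inc i (by omega))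
        p (hpa.trans hab) hV hcon (fun i hi => ?_) hcnt.symm.le
      rw [← hE.val i (by omega)]
      linarith [hpv hpp 0 (by omega) (x i) ⟨(hE.mem i (by omega)).1,
        (hle i (k0 + r) (by omega) (by omega)).trans hcon⟩]
    · exact past hf hfa hg hr hE.spl hE.Mpos hE.bd k0 x hE.x0 (fun i hi => hE.inc i (by omega))
        p hpa h hcon (fun i hi => hE.val i (by omega)) le_rfl
  have hpc : 0 < p → p < c (k0 + r) := by
    intro hpp
    by_contra hcon
    push Not at hcon
    have hle := seq_le c _ hE'.inc
    by_cases h : p ∈ U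
    · have hV : p ∉ V := fun h' => hboth hpp ⟨h, h'⟩
      exact past hf hfa hg hr hE'.spl hE'.Mpos hE'.bd k0 c hE'.x0 (fun i hi => hE'.inc i (by omega))
        p (hpa.trans hab) hV hcon (fun i hi => hE'.val i (by omega)) hcnt.symm.le
    · refine past hf hfa hg hr hE.spl hE.Mpos hE.bd k0 c hE'.x0 (fun i hi => hE'.inc i (by omega))
        p hpa h hcon (fun i hi => ?_) le_rfl
      rw [← hE'.val i (by omega)]
      linarith [hpv hpp 0 (by omega) (c i) ⟨(hE'.mem i (by omega)).1,
        (hle i (k0 + r) (by omega) (by omega)).trans hcon⟩]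
  obtain ⟨q, hpq, hqa, NZ, hq⟩ := q_exists hg hr hF hF' p hp0 hpa hmax
  have zl : 0 < p → ∀ k < r, F k p - F' k p = 0 :=
    fun hpp k hk => hpv hpp k hk p ⟨hp0, le_rfl⟩
  rcases hq with rfl | ⟨hqa', zr⟩
  · have hcont : ∀ k < r, ContinuousOn (fun t => F k t - F' k t) (Icc p q) :=
      fun k hk => (hch.cont k hk).mono (Icc_subset_Icc_left hp0)
    have hder : ∀ k < r, ∀ t ∈ Ioo p q, t ∉ s ∪ s' →
        HasDerivAt (fun t => F k t - F' k t) (F (k + 1) t - F' (k + 1) t) t :=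
      fun k hk t ht => hch.der k hk t ⟨hp0.trans_lt ht.1, ht.2⟩
    have hle := seq_le x _ hE.inc
    have fin : ∀ z : ℕ → ℝ, (∀ i < n + 1 - k0, z i ∈ Ioo p q) →
        (∀ i, i + 1 < n + 1 - k0 → z i < z (i + 1)) →
        (∀ i < n + 1 - k0, 0 < (-1:ℝ) ^ k0 * (-1) ^ i * (F r (z i) - F' r (z i))) → False := by
      intro z hz hzi hzs
      have h1 := count2 hF hF' hg (n + 1 - k0) k0 z (by omega)
        (fun i hi => hp0.trans (hz i hi).1.le) hzs hzi
        (hcnt.le.trans (cnt_mono V (hz 0 (by omega)).1.le))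
      have := cnt_le_card V (z (n + 1 - k0 - 1))
      have := hE'.card
      omega
    rcases hp0.eq_or_lt with hp' | hp'
    · have hk := hk00 hp'.symm
      obtain ⟨z, hz, hzi⟩ := iter_rolle (fun k t => F k t - F' k t) (s ∪ s') p q ((-1) ^ r)
        (by simp) r hcont hder 0 0 (n + r + 1) (by omega) (by omega) (by omega) (by simp) (by simp) x
        (fun i hi => by rw [← hp']; exact hE.mem i hi) hE.inc (by simp) (by simp)
        hw1 (Or.inr NZ) r hr le_rfl (n + 1 - k0) (by omega)
        (by simp only [add_zero, mul_zero]; omega)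
      refine fin z (fun i hi => (hz i hi).1) hzi (fun i hi => ?_)
      have := (hz i hi).2.2
      rw [hk]
      simpa only [zero_add, mul_one, sq_pow, one_mul, pow_zero] using this
    · obtain ⟨z, hz, hzi⟩ := iter_rolle (fun k t => F k t - F' k t) (s ∪ s') p q
        ((-1) ^ r * (-1) ^ (k0 + r)) (by simp)
        r hcont hder 1 0 (n + 1 - k0) (by omega) (by omega) (by omega) (fun _ => zl hp') (by simp)
        (fun i => x (k0 + r + i))
        (fun i hi => ⟨(hpx hp').le.trans (hle _ _ (by omega) (by omega)),
          (hE.mem _ (by omega)).2⟩)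
        (fun i hi => hE.inc _ (by omega)) (fun _ => hpx hp') (by simp)
        (fun i hi => by
          have := hw1 (k0 + r + i) (by omega)
          rwa [pow_add, ← mul_assoc] at this)
        (Or.inr NZ) r hr le_rfl (n + 1 - k0) (by omega) (by omega)
      refine fin z (fun i hi => (hz i hi).1) hzi (fun i hi => ?_)
      have h1 := (hz i hi).2.2
      have h2 : ((-1:ℝ)) ^ r * (-1) ^ (k0 + r) * (-1) ^ (r * (1 + 1)) = (-1) ^ k0 := by
        rw [mul_comm r, pow_mul, pow_add]
        have := sq_pow r
        norm_num
        linear_combination (-1:ℝ) ^ k0 * this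
      rwa [h2] at h1
  · have e1 : k0 ≤ cntle U q := (cnt_mono U hpq.le).trans (cnt_le_cntle U q)
    have e2 : k0 ≤ cntle V q := hcnt.le.trans ((cnt_mono V hpq.le).trans (cnt_le_cntle V q))
    have n1 := (cntle_le_card U q).trans hE.card
    have n2 := (cntle_le_card V q).trans hE'.card
    have c1 := claimJ hg hr hF hF' p q hp0 hpq hqa hqa k0 hcnt.le hk00 zl zr NZ x hE.x0 hE.inc
      (fun i hi _ => hw1 i hi) hpx (cntle U q - k0) (by omega)
      (fun j hj => interlace hf hg hr hE q j (by omega))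
    have c2 := claimJ hg hr hF' hF p q hp0 hpq hqa hqa k0 le_rfl hk00
      (fun h k hk => by linarith [zl h k hk]) (fun k hk => by linarith [zr k hk])
      (fun α β h1 h2 h3 => by
        obtain ⟨t, ht, h⟩ := NZ α β h1 h2 h3
        exact ⟨t, ht, fun h' => h (by linarith)⟩) c hE'.x0 hE'.inc
      (fun i hi h => hw2 i hi (h.trans hqa)) hpc (cntle V q - k0) (by omega)
      (fun j hj => interlace hf hg hr hE' q j (by omega))
    have c3 := cnt_le_cntle U q
    have c4 := cnt_le_cntle V q
    have ceq : cnt U q = cnt V q := by omega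
    obtain ⟨η, hη, hgap⟩ := gap (s ∪ s') q
    have gU : ∀ u ∈ U, u ≠ q → η ≤ |u - q| :=
      fun u hu => hgap u (Finset.mem_union_left _ (hF.sub hu))
    have gV : ∀ u ∈ V, u ≠ q → η ≤ |u - q| :=
      fun u hu => hgap u (Finset.mem_union_right _ (hF'.sub hu))
    have hlt : max p (q - η) < q := max_lt hpq (by linarith)
    have hdown := hch.vanish_down (hp0.trans (le_max_left p (q - η))) hqa hr (fun t ht _ => by
      have htq : t ∈ Ioo (q - η) q := ⟨(le_max_right _ _).trans_lt ht.1, ht.2⟩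
      rw [hF.top, hF'.top, (cnt_left U q η gU t htq).1, (cnt_left V q η gV t htq).1, ceq,
        sub_self]) q ⟨hlt.le, le_rfl⟩ zr
    obtain ⟨t, ht, h⟩ := NZ _ q (le_max_left p (q - η)) hlt le_rfl
    exact h (hdown t ht)


/-- Theorem 1 (properties of φ): a ↦ φ_{r,n,f}(a) := ‖G_{r,n,f,a}‖_{C[0,a],f}
is continuous and strictly increasing on (0,∞). -/
theorem statement2
    (f g : ℝ → ℝ)
    (hf_c : ContinuousOn f (Ici 0)) (hf_pos : ∀ t ∈ Ici (0:ℝ), 0 < f t)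
    (hf_anti : AntitoneOn f (Ici 0))
    (hg_c : ContinuousOn g (Ici 0)) (hg_pos : ∀ t ∈ Ici (0:ℝ), 0 < g t)
    (hg_anti : AntitoneOn g (Ici 0))
    (r : ℕ) (hr : 1 ≤ r) (n : ℕ) (φ : ℝ → ℝ)
    (hφ : ∀ a, 0 < a → ∃ G : ℝ → ℝ,
      IsExtremalSpline f g r n a G ∧ φ a = wNorm G f (Icc 0 a)) :
    ContinuousOn φ (Ioi 0) ∧ StrictMonoOn φ (Ioi 0) := by
  have hex : ∀ a, 0 < a → ∃ U s F x, ExtS f g r n a (φ a) U s F x := by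
    intro a ha
    obtain ⟨G, hG, hφa⟩ := hφ a ha
    rw [hφa]
    exact ext_of f g hf_c hf_pos hg_pos r hr n a ha G hG
  have hstrict : StrictMonoOn φ (Ioi 0) := by
    intro a ha b hb hab
    obtain ⟨U, s, F, x, hE⟩ := hex a ha
    obtain ⟨V, s', F', c, hE'⟩ := hex b hb
    refine lt_of_le_of_ne (weak_mono hf_pos hg_pos hr hE hE' hab.le) (fun h => ?_)
    rw [← h] at hE'
    exact strict_aux hf_pos hf_anti hg_pos hr hE hE' ha hab
  refine ⟨?_, hstrict⟩
  intro a ha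
  have ha' : 0 < a := ha
  obtain ⟨U, s, F, x, hE⟩ := hex a ha'
  apply ContinuousAt.continuousWithinAt
  rw [ContinuousAt, tendsto_order]
  constructor
  · intro v hv
    obtain ⟨δ, hδ, h⟩ := left_cont hf_c hf_pos hg_pos hr hE ha' (φ a - v) (by linarith)
    filter_upwards [Ioi_mem_nhds (max_lt hδ ha')] with t ht
    have ht' := max_lt_iff.mp (mem_Ioi.mp ht)
    rcases lt_or_ge t a with hta | hta
    · obtain ⟨V, s', F', c, hE'⟩ := hex t ht'.2
      have := h t ⟨ht'.1, hta⟩ _ _ _ _ _ hE'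
      linarith
    · exact hv.trans_le (hstrict.monotoneOn ha (mem_Ioi.mpr ht'.2) hta)
  · intro v hv
    obtain ⟨δ, hδ, h⟩ := right_cont hf_c hf_pos hg_c hg_pos hr hE ha' (v - φ a) (by linarith)
    filter_upwards [Ioo_mem_nhds ha' hδ] with t ht
    rcases lt_or_ge a t with hta | hta
    · obtain ⟨V, s', F', c, hE'⟩ := hex t ht.1
      have := h t ⟨hta, ht.2⟩ _ _ _ _ _ hE'
      linarith
    · exact (hstrict.monotoneOn (mem_Ioi.mpr ht.1) ha hta).trans_lt hv
end
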